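/- arXiv:1011.4776 — 2 statements merged into one kernel-verified Lean document; each statement's English description precedes it below -/
import Mathlib

section
/- For every natural number k ≥ 2 there exist an infinite-dimensional separable real Banach space X and a bounded linear operator S : X → X with S^k = 0, S^(k-1) ≠ 0, S strictly singular and not compact, such that whenever λ_0, …, λ_{k-1} ∈ ℝ are scalars for which the operator ∑_{i=0}^{k-1} λ_i S^i is compact, then λ_i = 0 for every i; in particular no S^j (0 ≤ j ≤ k-1) is a compact perturbation of a linear combination of the operators S^l with l ≠ j. -/
open scoped ENNReal

/-- A bounded linear operator is strictly singular if for every infinite-dimensional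
subspace `Y` and every `c > 0` there is `y ∈ Y` with `‖S y‖ < c * ‖y‖`. -/
def StrictlySingular {X : Type*} [NormedAddCommGroup X] [NormedSpace ℝ X]
    (S : X →L[ℝ] X) : Prop :=
  ∀ Y : Submodule ℝ X, ¬FiniteDimensional ℝ Y → ∀ c : ℝ, 0 < c → ∃ y ∈ Y, ‖S y‖ < c * ‖y‖

/-- In an infinite-dimensional space of null families, some vector of supremum norm at most one
attains modulus one at as many indices as desired. -/
theorem exists_card_eq_abs_eq_one {V ι : Type*} [AddCommGroup V] [Module ℝ V]
    (φ : V →ₗ[ℝ] ι → ℝ) (hφ : Function.Injective φ)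
    (hfin : ∀ v, ∀ ε : ℝ, 0 < ε → {i | ε ≤ |φ v i|}.Finite)
    (hV : ¬FiniteDimensional ℝ V) (M : ℕ) :
    ∃ v, (∀ i, |φ v i| ≤ 1) ∧ ∃ A : Finset ι, A.card = M ∧ ∀ i ∈ A, |φ v i| = 1 := by
  classical
  induction M with
  | zero => exact ⟨0, by simp, ∅, by simp⟩
  | succ M ih =>
    obtain ⟨y, hy, A, hA, hyA⟩ := ih
    obtain ⟨z, hz, hzA⟩ : ∃ z : V, z ≠ 0 ∧ ∀ i ∈ A, φ z i = 0 := by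
      by_contra! hcon
      refine hV (FiniteDimensional.of_injective
        ((LinearMap.funLeft ℝ ℝ (Subtype.val : A → ι)).comp φ) ?_)
      rw [← LinearMap.ker_eq_bot, LinearMap.ker_eq_bot']
      intro z hz
      by_contra hne
      obtain ⟨i, hi, h⟩ := hcon z hne
      exact h (congrFun hz ⟨i, hi⟩)
    obtain ⟨i₀, hi₀⟩ : ∃ i, φ z i ≠ 0 := by
      by_contra! hcon
      exact hz (hφ (by ext i; simp [hcon i]))
    let t : ι → ℝ := fun i => (|φ z i| - φ y i * φ z i) / φ z i ^ 2
    have t_nonneg (i : ι) : 0 ≤ t i := by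
      refine div_nonneg (sub_nonneg.2 ((le_abs_self _).trans ?_)) (sq_nonneg _)
      rw [abs_mul]
      exact mul_le_of_le_one_left (abs_nonneg _) (hy i)
    have t_mul (i : ι) (hi : φ z i ≠ 0) : t i * φ z i ^ 2 = |φ z i| - φ y i * φ z i :=
      div_mul_cancel₀ _ (pow_ne_zero 2 hi)
    let F : Set ι := {i | φ z i ≠ 0 ∧ t i ≤ t i₀}
    have hF : F.Finite := by
      have hT : 0 < 2 * (t i₀ + 1) := by linarith [t_nonneg i₀]
      refine ((hfin y (1 / 2) (by norm_num)).union
        (hfin z (1 / (2 * (t i₀ + 1))) (by positivity))).subset ?_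
      rintro i ⟨hi, hti⟩
      by_contra hcon
      simp only [Set.mem_union, Set.mem_ofPred_eq, not_or, not_le] at hcon
      obtain ⟨h1, h2⟩ := hcon
      rw [lt_div_iff₀ hT] at h2
      have h3 := t_mul i hi
      have hpos : 0 < |φ z i| := abs_pos.2 hi
      have h4 : φ y i * φ z i ≤ |φ y i| * |φ z i| := by
        rw [← abs_mul]
        exact le_abs_self _
      rw [← sq_abs] at h3
      have h5 : |φ z i| * 1 ≤ |φ z i| * (|φ y i| + t i * |φ z i|) := by nlinarith
      have h6 := le_of_mul_le_mul_left h5 hpos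
      have h7 : t i * |φ z i| ≤ t i₀ * |φ z i| := by gcongr
      nlinarith
    obtain ⟨i₁, ⟨hi₁, hti₁⟩, hmin⟩ := Set.exists_min_image F t hF ⟨i₀, hi₀, le_rfl⟩
    have hmin' (i : ι) (hi : φ z i ≠ 0) : t i₁ ≤ t i := by
      rcases le_total (t i) (t i₀) with h | h
      · exact hmin i ⟨hi, h⟩
      · exact hti₁.trans h
    refine ⟨y + t i₁ • z, fun i => ?_, insert i₁ A, ?_, fun i hi => ?_⟩
    · simp only [map_add, map_smul, Pi.add_apply, Pi.smul_apply, smul_eq_mul]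
      obtain ⟨hl, hr⟩ := abs_le.1 (hy i)
      rcases eq_or_ne (φ z i) 0 with h0 | h0
      · simpa [h0] using hy i
      · have h1 := mul_le_mul_of_nonneg_right (hmin' i h0) (sq_nonneg (φ z i))
        rw [t_mul i h0] at h1
        have h2 := t_nonneg i₁
        rcases h0.lt_or_gt with h | h
        · rw [abs_of_neg h] at h1
          exact abs_le.2 ⟨by nlinarith, by nlinarith⟩
        · rw [abs_of_pos h] at h1
          exact abs_le.2 ⟨by nlinarith, by nlinarith⟩
    · rw [Finset.card_insert_of_notMem fun h => hi₁ (hzA _ h), hA]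
    · simp only [map_add, map_smul, Pi.add_apply, Pi.smul_apply, smul_eq_mul]
      rcases Finset.mem_insert.1 hi with rfl | hi
      · have h1 : φ y i + t i * φ z i = |φ z i| / φ z i := by
          rw [eq_div_iff hi₁]
          linear_combination t_mul i hi₁
        rw [h1, abs_div, abs_abs, div_self (abs_ne_zero.2 hi₁)]
      · simpa [hzA i hi] using hyA i hi

theorem sum_single_sub_smul {ι R M : Type*} [Fintype ι] [DecidableEq ι] [Ring R]
    [AddCommGroup M] [Module R M] (j : ι) (μ : ι → R) (f : ι → M) :
    ∑ i, (Pi.single j 1 - μ : ι → R) i • f i = f j - ∑ i, μ i • f i := by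
  simp [sub_smul, Finset.sum_sub_distrib, Pi.single_apply]

/-- The space `ℓ^(j+1)` of real sequences. -/
abbrev EllSucc (j : ℕ) : Type := lp (fun _ : ℕ => ℝ) ((j + 1 : ℕ) : ℝ≥0∞)

instance one_le_natCast_succ (j : ℕ) : Fact (1 ≤ ((j + 1 : ℕ) : ℝ≥0∞)) :=
  ⟨by exact_mod_cast Nat.succ_pos j⟩

namespace EllSucc

theorem hasSum_abs_pow {j : ℕ} (f : EllSucc j) :
    HasSum (fun n => |f n| ^ (j + 1)) (‖f‖ ^ (j + 1)) := by
  have h := lp.hasSum_norm (p := ((j + 1 : ℕ) : ℝ≥0∞)) (by rw [ENNReal.toReal_natCast]; positivity) f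
  simpa only [ENNReal.toReal_natCast, Real.rpow_natCast, Real.norm_eq_abs] using h

theorem abs_apply_le_norm {j : ℕ} (f : EllSucc j) (n : ℕ) : |f n| ≤ ‖f‖ :=
  lp.norm_apply_le_norm (by simp) f n

theorem finite_le_abs {j : ℕ} (f : EllSucc j) {ε : ℝ} (hε : 0 < ε) :
    {n | ε ≤ |f n|}.Finite := by
  have h := (hasSum_abs_pow f).summable.tendsto_cofinite_zero.eventually_lt_const
    (pow_pos hε (j + 1))
  refine (Filter.eventually_cofinite.1 h).subset fun n hn => ?_
  exact not_lt.2 (pow_le_pow_left₀ hε.le hn _)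

instance separableSpace (j : ℕ) : TopologicalSpace.SeparableSpace (EllSucc j) := by
  let B : Set (EllSucc j) := Set.range fun n : ℕ => lp.single _ n (1 : ℝ)
  have hB : TopologicalSpace.IsSeparable (closure (Submodule.span ℝ B : Set (EllSucc j))) :=
    ((Set.countable_range _).isSeparable.span (R := ℝ)).closure
  refine TopologicalSpace.isSeparable_univ_iff.1 (hB.mono fun f _ => ?_)
  refine mem_closure_of_tendsto (lp.hasSum_single (by simp) f) (.of_forall fun s => ?_)
  refine Submodule.sum_mem _ fun n _ => ?_
  have : lp.single ((j + 1 : ℕ) : ℝ≥0∞) (E := fun _ : ℕ => ℝ) n (f n) =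
      f n • lp.single _ n (1 : ℝ) := by
    rw [← lp.single_smul, smul_eq_mul, mul_one]
  rw [this]
  exact Submodule.smul_mem _ _ (Submodule.subset_span ⟨n, rfl⟩)

/-- The formal inclusion of `ℓ^(j+1)` into `ℓ^(j+2)` as a linear map. -/
noncomputable def inclusionₗ (j : ℕ) : EllSucc j →ₗ[ℝ] EllSucc (j + 1) :=
  lp.linearMapOfLE ℝ _ (by exact_mod_cast Nat.le_succ (j + 1))

@[simp]
theorem inclusionₗ_apply {j : ℕ} (f : EllSucc j) (n : ℕ) : inclusionₗ j f n = f n := rfl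

theorem norm_inclusionₗ_pow_le {j : ℕ} (f : EllSucc j) {a : ℝ} (ha : ∀ n, |f n| ≤ a) :
    ‖inclusionₗ j f‖ ^ (j + 2) ≤ a * ‖f‖ ^ (j + 1) := by
  refine hasSum_le (fun n => ?_) (hasSum_abs_pow (inclusionₗ j f))
    ((hasSum_abs_pow f).mul_left a)
  rw [inclusionₗ_apply, pow_succ']
  gcongr
  exact ha n

/-- The formal inclusion of `ℓ^(j+1)` into `ℓ^(j+2)`. -/
noncomputable def inclusion (j : ℕ) : EllSucc j →L[ℝ] EllSucc (j + 1) :=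
  (inclusionₗ j).mkContinuous 1 fun f => by
    rw [one_mul]
    refine le_of_pow_le_pow_left₀ (n := j + 2) (by omega) (norm_nonneg f) ?_
    rw [pow_succ' ‖f‖]
    exact norm_inclusionₗ_pow_le f (abs_apply_le_norm f)

@[simp]
theorem inclusion_apply {j : ℕ} (f : EllSucc j) (n : ℕ) : inclusion j f n = f n := rfl

theorem norm_inclusion_pow_le {j : ℕ} (f : EllSucc j) {a : ℝ} (ha : ∀ n, |f n| ≤ a) :
    ‖inclusion j f‖ ^ (j + 2) ≤ a * ‖f‖ ^ (j + 1) :=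
  norm_inclusionₗ_pow_le f ha

end EllSucc

/-- The direct sum `ℓ^1 ⊕ ⋯ ⊕ ℓ^k`. -/
abbrev EllSum (k : ℕ) : Type := (i : Fin k) → EllSucc i

namespace EllSum

/-- The `i`-th component of `shift`. -/
noncomputable def shiftComponent (k : ℕ) : (i : Fin k) → EllSum k →L[ℝ] EllSucc i
  | ⟨0, _⟩ => 0
  | ⟨j + 1, h⟩ => (EllSucc.inclusion j).comp
      (ContinuousLinearMap.proj (R := ℝ) (φ := fun i : Fin k => EllSucc i)
        ⟨j, Nat.lt_of_succ_lt h⟩)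

/-- The forward shift `(x₁, …, x_k) ↦ (0, x₁, …, x_{k-1})` on `ℓ^1 ⊕ ⋯ ⊕ ℓ^k`. -/
noncomputable def shift (k : ℕ) : EllSum k →L[ℝ] EllSum k :=
  ContinuousLinearMap.pi (shiftComponent k)

variable {k : ℕ}

theorem shift_apply_zero (x : EllSum k) (h : 0 < k) : shift k x ⟨0, h⟩ = 0 := rfl

theorem shift_apply_succ (x : EllSum k) (j : ℕ) (h : j + 1 < k) :
    shift k x ⟨j + 1, h⟩ = EllSucc.inclusion j (x ⟨j, Nat.lt_of_succ_lt h⟩) := rfl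

theorem shift_pow_apply (m : ℕ) (x : EllSum k) (i : ℕ) (hi : i < k) (n : ℕ) :
    (shift k ^ m) x ⟨i, hi⟩ n =
      if m ≤ i then x ⟨i - m, (Nat.sub_le i m).trans_lt hi⟩ n else 0 := by
  induction m generalizing i with
  | zero => simp
  | succ m ih =>
    rw [pow_succ', mul_apply_eq_comp]
    cases i with
    | zero => simp [shift_apply_zero]
    | succ j =>
      rw [shift_apply_succ, EllSucc.inclusion_apply, ih]
      simp only [Nat.add_le_add_iff_right]
      congr 1
      exact congrArg (fun l : Fin k => x l n) (Fin.ext (Nat.add_sub_add_right j 1 m).symm)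

theorem shift_pow_eq_zero : shift k ^ k = 0 := by
  ext x i n
  rw [shift_pow_apply k x i i.2 n, if_neg (not_le.2 i.2)]
  rfl

theorem shift_pow_single_apply (m : ℕ) (hk : 0 < k) (e : EllSucc 0) (i : Fin k) (n : ℕ) :
    (shift k ^ m) (Pi.single (M := fun i : Fin k => EllSucc i) ⟨0, hk⟩ e) i n =
      if m = i then e n else 0 := by
  rw [shift_pow_apply m _ i i.2 n]
  rcases lt_trichotomy m i with h | rfl | h
  · rw [if_pos h.le, if_neg h.ne, Pi.single_eq_of_ne]
    · rfl
    · simp only [ne_eq, Fin.mk.injEq]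
      omega
  · have h0 : (⟨i - i, (Nat.sub_le i i).trans_lt i.2⟩ : Fin k) = ⟨0, hk⟩ := by simp
    simp only [le_refl, if_true]
    refine (congrArg (fun l : Fin k =>
      Pi.single (M := fun i : Fin k => EllSucc i) ⟨0, hk⟩ e l n) h0).trans ?_
    rw [Pi.single_eq_same]
  · rw [if_neg (not_le.2 h), if_neg h.ne']

theorem eq_zero_of_isCompactOperator_sum (lam : Fin k → ℝ)
    (h : IsCompactOperator (∑ i : Fin k, ⇑(lam i • shift k ^ (i : ℕ)))) (i : Fin k) :
    lam i = 0 := by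
  have hk : 0 < k := i.pos
  set T : EllSum k →L[ℝ] EllSum k := ∑ i : Fin k, lam i • shift k ^ (i : ℕ) with hT
  replace h : IsCompactOperator T := by
    convert! h
    ext1 x
    rw [hT, _root_.sum_apply, Finset.sum_apply]
  let e : ℕ → EllSum k := fun n =>
    Pi.single (M := fun i : Fin k => EllSucc i) ⟨0, hk⟩ (lp.single _ n (1 : ℝ))
  have he (n : ℕ) : e n ∈ Metric.closedBall 0 1 := by
    rw [mem_closedBall_zero_iff, Pi.norm_single, lp.norm_single (by simp), norm_one]
  have hTe (n m : ℕ) : T (e n) i m = lam i * Pi.single (M := fun _ => ℝ) n 1 m := by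
    rw [hT, _root_.sum_apply, Finset.sum_apply, lp.coeFn_sum, Finset.sum_apply,
      Finset.sum_eq_single i]
    · change lam i * (shift k ^ (i : ℕ)) (e n) i m = _
      rw [shift_pow_single_apply, if_pos rfl, lp.coeFn_single]
    · intro j _ hj
      change lam j * (shift k ^ (j : ℕ)) (e n) i m = _
      rw [shift_pow_single_apply, if_neg (Fin.val_ne_of_ne hj), mul_zero]
    · simp
  obtain ⟨K, hK, hTK⟩ := h.image_closedBall_subset_compact (f := T.toLinearMap) 1
  obtain ⟨z, -, φ, hφ, hlim⟩ := hK.tendsto_subseq fun n => hTK ⟨e n, he n, rfl⟩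
  have h0 := (hlim.comp (Filter.tendsto_add_atTop_nat 1)).sub hlim
  rw [sub_self] at h0
  refine norm_le_zero_iff.1 (ge_of_tendsto h0.norm (.of_forall fun n => ?_) |>.trans_eq norm_zero)
  refine le_trans ?_ (norm_le_pi_norm _ i)
  refine le_trans ?_ (EllSucc.abs_apply_le_norm _ (φ (n + 1)))
  change |lam i| ≤ |T (e (φ (n + 1))) i (φ (n + 1)) - T (e (φ n)) i (φ (n + 1))|
  rw [hTe, hTe, Pi.single_eq_same, Pi.single_eq_of_ne (hφ n.lt_succ_self).ne']
  simp

theorem strictlySingular_shift : StrictlySingular (shift k) := by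
  intro Y hY c hc
  let φ : Y →ₗ[ℝ] Fin k × ℕ → ℝ :=
    { toFun := fun y p => (y : EllSum k) p.1 p.2
      map_add' := fun _ _ => rfl
      map_smul' := fun _ _ => rfl }
  have hφ : Function.Injective φ := by
    intro x y hxy
    ext i n
    exact congrFun hxy (i, n)
  have hfin (v : Y) (ε : ℝ) (hε : 0 < ε) : {p | ε ≤ |φ v p|}.Finite := by
    refine (Set.finite_iUnion fun i : Fin k =>
      (EllSucc.finite_le_abs ((v : EllSum k) i) hε).image (Prod.mk i)).subset ?_
    rintro ⟨i, n⟩ h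
    exact Set.mem_iUnion.2 ⟨i, n, h, rfl⟩
  let a : ℝ := max 1 c⁻¹
  have ha : 1 ≤ a := le_max_left _ _
  obtain ⟨M, hM⟩ := exists_nat_gt ((k : ℝ) * (a ^ k) ^ k)
  obtain ⟨y, hy, A, hA, hyA⟩ := exists_card_eq_abs_eq_one φ hφ hfin hY M
  have hyn : a ^ k < ‖(y : EllSum k)‖ := by
    by_contra! hle
    refine hM.not_ge ?_
    calc (M : ℝ) = ∑ p ∈ A, |φ y p| ^ ((p.1 : ℕ) + 1) := by
          rw [Finset.sum_congr rfl fun p hp => by rw [hyA p hp, one_pow]]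
          simp [hA]
      _ ≤ ∑ p ∈ Finset.univ ×ˢ A.image Prod.snd, |φ y p| ^ ((p.1 : ℕ) + 1) := by
          refine Finset.sum_le_sum_of_subset_of_nonneg (fun p hp => ?_)
            fun _ _ _ => by positivity
          exact Finset.mem_product.2 ⟨Finset.mem_univ _, Finset.mem_image_of_mem _ hp⟩
      _ = ∑ i : Fin k, ∑ n ∈ A.image Prod.snd, |(y : EllSum k) i n| ^ ((i : ℕ) + 1) :=
          Finset.sum_product _ _ _
      _ ≤ ∑ i : Fin k, (a ^ k) ^ k := by
          refine Finset.sum_le_sum fun i _ => ?_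
          refine (sum_le_hasSum _ (fun _ _ => by positivity)
            (EllSucc.hasSum_abs_pow ((y : EllSum k) i))).trans ?_
          calc ‖(y : EllSum k) i‖ ^ ((i : ℕ) + 1) ≤ (a ^ k) ^ ((i : ℕ) + 1) := by
                gcongr
                exact (norm_le_pi_norm _ i).trans hle
            _ ≤ (a ^ k) ^ k := pow_le_pow_right₀ (one_le_pow₀ ha) i.2
      _ = k * (a ^ k) ^ k := by simp
  have hpos : 0 < ‖(y : EllSum k)‖ := lt_of_le_of_lt (by positivity) hyn
  refine ⟨y, y.2, (pi_norm_lt_iff (mul_pos hc hpos)).2 ?_⟩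
  rintro ⟨i, hi⟩
  cases i with
  | zero =>
    rw [shift_apply_zero, norm_zero]
    exact mul_pos hc hpos
  | succ j =>
    rw [shift_apply_succ]
    set N := ‖(y : EllSum k)‖
    refine lt_of_pow_lt_pow_left₀ (j + 2) (mul_pos hc hpos).le ?_
    have hN : (c⁻¹) ^ (j + 2) < N :=
      calc (c⁻¹) ^ (j + 2) ≤ a ^ (j + 2) := by
            gcongr
            exact le_max_right _ _
        _ ≤ a ^ k := pow_le_pow_right₀ ha hi
        _ < N := hyn
    rw [inv_pow, inv_lt_iff_one_lt_mul₀' (by positivity)] at hN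
    calc ‖EllSucc.inclusion j ((y : EllSum k) ⟨j, _⟩)‖ ^ (j + 2)
        ≤ 1 * ‖(y : EllSum k) ⟨j, _⟩‖ ^ (j + 1) :=
          EllSucc.norm_inclusion_pow_le _ fun n => hy (⟨j, _⟩, n)
      _ ≤ 1 * N ^ (j + 1) := by
          gcongr
          exact norm_le_pi_norm _ _
      _ < (c ^ (j + 2) * N) * N ^ (j + 1) := by gcongr
      _ = (c * N) ^ (j + 2) := by ring

theorem not_isCompactOperator_shift_pow (j : Fin k) :
    ¬IsCompactOperator (shift k ^ (j : ℕ)) := by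
  intro h
  have h1 := eq_zero_of_isCompactOperator_sum (Pi.single j 1)
    (by
      rw [Finset.sum_eq_single j]
      · simpa using h
      · intro i _ hi
        ext1 x
        simp [hi]
      · simp) j
  simp at h1

end EllSum

theorem stmt2 (k : ℕ) (hk : 2 ≤ k) :
    ∃ (X : Type) (_ : NormedAddCommGroup X) (_ : NormedSpace ℝ X),
      CompleteSpace X ∧ TopologicalSpace.SeparableSpace X ∧ ¬FiniteDimensional ℝ X ∧
      ∃ S : X →L[ℝ] X, S ^ k = 0 ∧ S ^ (k - 1) ≠ 0 ∧
        StrictlySingular S ∧ ¬IsCompactOperator S ∧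
        (∀ lam : Fin k → ℝ,
          IsCompactOperator (∑ i : Fin k, lam i • S ^ (i : ℕ)) → ∀ i, lam i = 0) ∧
        (∀ j : Fin k, ∀ mu : Fin k → ℝ, mu j = 0 →
          ∀ K : X →L[ℝ] X, IsCompactOperator K →
            S ^ (j : ℕ) ≠ (∑ i : Fin k, mu i • S ^ (i : ℕ)) + K) := by
  refine ⟨EllSum k, inferInstance, inferInstance, inferInstance, inferInstance, fun hfd => ?_,
    EllSum.shift k, EllSum.shift_pow_eq_zero, fun h0 => ?_, EllSum.strictlySingular_shift,
    fun hS => ?_, EllSum.eq_zero_of_isCompactOperator_sum, fun j mu hmu K hK hj => ?_⟩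
  · have : LocallyCompactSpace (EllSum k) :=
      haveI := FiniteDimensional.proper_real (EllSum k)
      inferInstance
    exact EllSum.not_isCompactOperator_shift_pow (⟨0, by omega⟩ : Fin k)
      (isCompactOperator_of_locallyCompactSpace_dom _)
  · refine EllSum.not_isCompactOperator_shift_pow (⟨k - 1, by omega⟩ : Fin k) ?_
    rw [h0]
    exact isCompactOperator_zero
  · refine EllSum.not_isCompactOperator_shift_pow (⟨1, by omega⟩ : Fin k) ?_
    rwa [pow_one]
  · have h1 := EllSum.eq_zero_of_isCompactOperator_sum (Pi.single j 1 - mu) ?_ j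
    · simp [hmu] at h1
    · have hsum :
          ∑ i : Fin k, (Pi.single j 1 - mu : Fin k → ℝ) i • EllSum.shift k ^ (i : ℕ) = K := by
        refine (sum_single_sub_smul j mu _).trans ?_
        rw [sub_eq_iff_eq_add', ← hj]
      rw [← hsum] at hK
      convert! hK
      ext1 x
      rw [_root_.sum_apply, Finset.sum_apply]
end

section
/- There exists an infinite-dimensional separable real Banach space X with the following two properties: (i) for every bounded linear operator T : X → X there exists λ ∈ ℝ such that T − λ·Id is strictly singular; (ii) there exists a bounded linear operator T : X → X such that T − λ·Id is not a compact operator for any λ ∈ ℝ. (Thus X has 'few operators' but not 'very few operators', giving a negative solution to Problem 10.7 of Argyros–Haydon.) -/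
namespace FewOps

open Finset

/-- Finitely supported rational functionals. -/
abbrev Fn := ℕ →₀ ℚ

/-- Finitely supported real vectors. -/
abbrev Vc := ℕ →₀ ℝ

theorem exists_weights : ∃ m s : ℕ → ℕ, (∀ j, 8 ≤ m j) ∧ (∀ j, 2 ≤ s j) ∧
    (∀ j, m (j + 1) = (m j ^ (4 * s j)) ^ 4) ∧ ∀ j, s (j + 1) = m j ^ (4 * s j) := by
  let p : ℕ → ℕ × ℕ := fun j =>
    Nat.rec (8, 2) (fun _ q => ((q.1 ^ (4 * q.2)) ^ 4, q.1 ^ (4 * q.2))) j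
  have key : ∀ j, 8 ≤ (p j).1 ∧ 2 ≤ (p j).2 := by
    intro j
    induction j with
    | zero => exact ⟨le_rfl, le_rfl⟩
    | succ j ih =>
      obtain ⟨h1, h2⟩ := ih
      have h3 : 8 ≤ (p j).1 ^ (4 * (p j).2) :=
        h1.trans (Nat.le_self_pow (by omega) _)
      exact ⟨h3.trans (Nat.le_self_pow (by omega) _), le_trans (by norm_num) h3⟩
  exact ⟨fun j => (p j).1, fun j => (p j).2, fun j => (key j).1, fun j => (key j).2,
    fun _ => rfl, fun _ => rfl⟩

/-- The weights `m j`. -/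
noncomputable def wm : ℕ → ℕ := exists_weights.choose

/-- The exponents relating lengths to weights. -/
noncomputable def ws : ℕ → ℕ := exists_weights.choose_spec.choose

/-- The lengths `n j`. -/
noncomputable def wn (j : ℕ) : ℕ := wm j ^ (4 * ws j)

theorem wm_ge (j : ℕ) : 8 ≤ wm j := exists_weights.choose_spec.choose_spec.1 j

theorem ws_ge (j : ℕ) : 2 ≤ ws j := exists_weights.choose_spec.choose_spec.2.1 j

theorem wm_succ (j : ℕ) : wm (j + 1) = wn j ^ 4 :=
  exists_weights.choose_spec.choose_spec.2.2.1 j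

theorem ws_succ (j : ℕ) : ws (j + 1) = wn j := exists_weights.choose_spec.choose_spec.2.2.2 j

theorem wm_pow_le_wn (j a : ℕ) (h : a ≤ 4 * ws j) : wm j ^ a ≤ wn j :=
  Nat.pow_le_pow_right (by have := wm_ge j; omega) h

theorem wm_le_wn (j : ℕ) : wm j ≤ wn j := by
  have := wm_pow_le_wn j 1 (by have := ws_ge j; omega)
  simpa using this

theorem wn_ge (j : ℕ) : 8 ≤ wn j := (wm_ge j).trans (wm_le_wn j)

theorem wm_lt_succ (j : ℕ) : wm j < wm (j + 1) := by
  rw [wm_succ]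
  have h := wm_le_wn j
  have h8 := wn_ge j
  calc wm j ≤ wn j := h
    _ = wn j ^ 1 := (pow_one _).symm
    _ < wn j ^ 4 := Nat.pow_lt_pow_right (by omega) (by omega)

theorem wm_strictMono : StrictMono wm := strictMono_nat_of_lt_succ wm_lt_succ

theorem ws_lt_succ (j : ℕ) : ws j < ws (j + 1) := by
  rw [ws_succ]
  calc ws j < 2 ^ ws j := Nat.lt_two_pow_self
    _ ≤ wm j ^ ws j := Nat.pow_le_pow_left (by have := wm_ge j; omega) _
    _ ≤ wn j := wm_pow_le_wn j _ (by omega)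

theorem ws_strictMono : StrictMono ws := strictMono_nat_of_lt_succ ws_lt_succ

theorem wn_le_ws {i j : ℕ} (h : i < j) : wn i ≤ ws j := by
  rw [← ws_succ]
  exact ws_strictMono.monotone h

theorem wn_mono : Monotone wn := by
  refine monotone_nat_of_le_succ fun j => ?_
  calc wn j ≤ wn j ^ 4 := Nat.le_self_pow (by omega) _
    _ = wm (j + 1) := (wm_succ j).symm
    _ ≤ wn (j + 1) := wm_le_wn _

theorem wn_mul_wm_cube_le (j : ℕ) : wn j * wm j ^ 3 ≤ wm (j + 1) := by
  rw [wm_succ]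
  calc wn j * wm j ^ 3 ≤ wn j * wn j ^ 3 :=
        Nat.mul_le_mul_left _ (Nat.pow_le_pow_left (wm_le_wn j) _)
    _ = wn j ^ 4 := by ring

theorem exists_length (a : ℕ) :
    ∃ j t, Even j ∧ (2 ^ a) ^ t ≤ wn j ∧ 2 * wm j < 2 ^ t := by
  refine ⟨2 * a, Nat.log 2 (wm (2 * a)) + 2, even_two_mul a, ?_, ?_⟩
  · have h0 : wm (2 * a) ≠ 0 := by have := wm_ge (2 * a); omega
    have h1 : 2 ^ (Nat.log 2 (wm (2 * a)) + 2) ≤ wm (2 * a) ^ 2 := by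
      have := Nat.pow_log_le_self 2 h0
      have h8 := wm_ge (2 * a)
      rw [pow_add]
      nlinarith
    have h2 : 2 * a ≤ ws (2 * a) := ws_strictMono.le_apply
    calc (2 ^ a) ^ (Nat.log 2 (wm (2 * a)) + 2)
        = (2 ^ (Nat.log 2 (wm (2 * a)) + 2)) ^ a := by rw [← pow_mul, ← pow_mul, mul_comm]
      _ ≤ (wm (2 * a) ^ 2) ^ a := Nat.pow_le_pow_left h1 _
      _ = wm (2 * a) ^ (2 * a) := by rw [← pow_mul]
      _ ≤ wn (2 * a) := wm_pow_le_wn _ _ (by omega)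
  · have := Nat.lt_pow_succ_log_self (b := 2) (by norm_num) (wm (2 * a))
    rw [pow_succ] at this ⊢
    rw [pow_succ]
    omega

/-- A concave growth function controlling sums of fewer than `n j` terms. -/
theorem exists_growth (j : ℕ) : ∃ φ : ℕ → ℝ, φ 0 = 0 ∧ (∀ r, 1 ≤ r → 1 ≤ φ r) ∧
    φ (wn j) * (wm j : ℝ) ^ 4 = wn j ∧
    ∀ i < j, ∀ d ≤ wn i, ∀ r : ℕ → ℕ, ∀ R : ℕ, ∑ l ∈ range d, r l ≤ R →
      ∑ l ∈ range d, φ (r l) ≤ wm i / 4 * φ R := by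
  have hs2 : (2 : ℝ) ≤ ws j := by exact_mod_cast ws_ge j
  have hs0 : (0 : ℝ) < ws j := by linarith
  set β : ℝ := 1 / ws j with hβ
  have hβ0 : 0 < β := by positivity
  have hβ1 : β < 1 := by rw [hβ, div_lt_one hs0]; linarith
  have hα : 0 < 1 - β := by linarith
  refine ⟨fun r => (r : ℝ) ^ (1 - β), ?_, ?_, ?_, ?_⟩
  · simp [Real.zero_rpow hα.ne']
  · intro r hr
    exact Real.one_le_rpow (by exact_mod_cast hr) hα.le
  · have hn : (0 : ℝ) < wn j := by exact_mod_cast (by have := wn_ge j; omega : 0 < wn j)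
    have hb : (wn j : ℝ) ^ β = (wm j : ℝ) ^ 4 := by
      have hm : (0 : ℝ) ≤ wm j := Nat.cast_nonneg _
      rw [wn, Nat.cast_pow, pow_mul, hβ, one_div]
      exact Real.pow_rpow_inv_natCast (by positivity) (by have := ws_ge j; omega)
    rw [← hb, ← Real.rpow_add hn]
    simp
  · intro i hi d hd r R hR
    have hsum : ∑ l ∈ range d, ((r l : ℝ)) ^ (1 - β) ≤ (d : ℝ) ^ β * (R : ℝ) ^ (1 - β) := by
      rcases Nat.eq_zero_or_pos d with rfl | hd0
      · simp; positivity
      have hdpos : (0 : ℝ) < d := by exact_mod_cast hd0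
      have hconc := (Real.concaveOn_rpow hα.le (by linarith)).le_map_sum
        (t := range d) (w := fun _ => (1 / d : ℝ)) (p := fun l => (r l : ℝ))
        (fun _ _ => by positivity) (by simp [hdpos.ne']) (fun l _ => by simp)
      simp only [smul_eq_mul, ← mul_sum] at hconc
      have hR' : (∑ l ∈ range d, (r l : ℝ)) ≤ R := by exact_mod_cast hR
      have h2 : (1 / (d : ℝ) * ∑ l ∈ range d, (r l : ℝ)) ^ (1 - β) ≤ (1 / d * (R : ℝ)) ^ (1 - β) :=
        Real.rpow_le_rpow (by positivity) (by gcongr) hα.le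
      have h3 : (1 / d * (R : ℝ)) ^ (1 - β) = (d : ℝ) ^ β / d * (R : ℝ) ^ (1 - β) := by
        rw [Real.mul_rpow (by positivity) (by positivity), one_div, Real.inv_rpow hdpos.le,
          Real.rpow_sub hdpos, Real.rpow_one, inv_div]
      have h4 : 1 / (d : ℝ) * ∑ l ∈ range d, ((r l : ℝ)) ^ (1 - β)
          ≤ (d : ℝ) ^ β / d * (R : ℝ) ^ (1 - β) := hconc.trans (h2.trans h3.le)
      have h5 := mul_le_mul_of_nonneg_left h4 hdpos.le
      have e1 : (d : ℝ) * (1 / (d : ℝ) * ∑ l ∈ range d, ((r l : ℝ)) ^ (1 - β))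
          = ∑ l ∈ range d, ((r l : ℝ)) ^ (1 - β) := by field_simp
      have e2 : (d : ℝ) * ((d : ℝ) ^ β / d * (R : ℝ) ^ (1 - β)) = (d : ℝ) ^ β * (R : ℝ) ^ (1 - β) := by
        field_simp
      rw [e1, e2] at h5
      exact h5
    refine hsum.trans (mul_le_mul_of_nonneg_right ?_ (by positivity))
    have h8 : (8 : ℝ) ≤ wm i := by exact_mod_cast wm_ge i
    have hdn : (d : ℝ) ≤ ((wm i : ℝ) / 4) ^ ws j := by
      have h1 : d ≤ 2 ^ ws j := hd.trans ((wn_le_ws hi).trans Nat.lt_two_pow_self.le)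
      calc (d : ℝ) ≤ 2 ^ ws j := by exact_mod_cast h1
        _ ≤ _ := pow_le_pow_left₀ (by norm_num) (by linarith) _
    calc (d : ℝ) ^ β ≤ (((wm i : ℝ) / 4) ^ ws j) ^ β :=
          Real.rpow_le_rpow (by positivity) hdn hβ0.le
      _ = (wm i : ℝ) / 4 := by
          rw [hβ, one_div]
          exact Real.pow_rpow_inv_natCast (by positivity) (by have := ws_ge j; omega)

theorem exists_code : ∃ σ : ℕ → List (ℕ × Fn) → ℕ, (∀ j, Function.Injective (σ j)) ∧
    ∀ j L, Even (σ j L) ∧ j < σ j L := by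
  obtain ⟨e, he⟩ := exists_injective_nat (List (ℕ × Fn))
  refine ⟨fun j L => 2 * (e L + j + 1), fun j L L' h => he ?_, fun j L => ⟨even_two_mul _, ?_⟩⟩
  · simp only at h; omega
  · show j < 2 * (e L + j + 1); omega

/-- The coding function. -/
noncomputable def code : ℕ → List (ℕ × Fn) → ℕ := exists_code.choose

theorem code_injective (j : ℕ) : Function.Injective (code j) := exists_code.choose_spec.1 j

theorem code_even (j : ℕ) (L : List (ℕ × Fn)) : Even (code j L) := (exists_code.choose_spec.2 j L).1

theorem lt_code (j : ℕ) (L : List (ℕ × Fn)) : j < code j L := (exists_code.choose_spec.2 j L).2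

/-- Evaluation of a functional, linear in the vector. -/
noncomputable def ev (f : Fn) : Vc →ₗ[ℝ] ℝ := Finsupp.linearCombination ℝ fun n => (f n : ℝ)

theorem ev_single (f : Fn) (n : ℕ) (c : ℝ) : ev f (Finsupp.single n c) = c * f n := by
  simp [ev]

theorem ev_apply (f : Fn) (x : Vc) : ev f x = x.sum fun n c => c * f n := rfl

theorem ext_ev {E : Type*} [AddCommMonoid E] [Module ℝ E] {A B : Vc →ₗ[ℝ] E}
    (h : ∀ n, A (Finsupp.single n 1) = B (Finsupp.single n 1)) : A = B := by
  ext n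
  simpa using h n

theorem ev_add (f g : Fn) (x : Vc) : ev (f + g) x = ev f x + ev g x := by
  suffices h : ev (f + g) = ev f + ev g by rw [h]; rfl
  exact ext_ev fun n => by simp [ev_single]

theorem ev_smul (q : ℚ) (f : Fn) (x : Vc) : ev (q • f) x = q * ev f x := by
  suffices h : ev (q • f) = (q : ℝ) • ev f by rw [h]; rfl
  exact ext_ev fun n => by simp [ev_single]

theorem ev_zero (x : Vc) : ev 0 x = 0 := by
  have := ev_smul 0 0 x
  simpa using this

theorem ev_neg (f : Fn) (x : Vc) : ev (-f) x = -ev f x := by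
  have := ev_smul (-1) f x
  simpa using this

theorem ev_sum {ι : Type*} (s : Finset ι) (f : ι → Fn) (x : Vc) :
    ev (∑ i ∈ s, f i) x = ∑ i ∈ s, ev (f i) x := by
  classical
  induction s using Finset.induction_on with
  | empty => simp [ev_zero]
  | insert a s ha ih => rw [sum_insert ha, sum_insert ha, ev_add, ih]

theorem exists_of_ev_ne_zero {f : Fn} {x : Vc} (h : ev f x ≠ 0) : ∃ n, f n ≠ 0 ∧ x n ≠ 0 := by
  by_contra! hc
  refine h ?_
  rw [ev_apply, Finsupp.sum]
  refine sum_eq_zero fun n hn => ?_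
  by_cases hf : f n = 0
  · simp [hf]
  · exact absurd (hc n hf) (Finsupp.mem_support_iff.1 hn)

/-- The shift on vectors. -/
noncomputable def T : Vc →ₗ[ℝ] Vc :=
  Finsupp.linearCombination ℝ fun n => if Even n then Finsupp.single (n + 1) 1 else 0

theorem T_single (n : ℕ) (c : ℝ) :
    T (Finsupp.single n c) = if Even n then Finsupp.single (n + 1) c else 0 := by
  simp only [T, Finsupp.linearCombination_single]
  split_ifs <;> simp

theorem T_T (x : Vc) : T (T x) = 0 := by
  suffices h : T ∘ₗ T = 0 by exact LinearMap.congr_fun h x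
  refine ext_ev fun n => ?_
  simp only [LinearMap.comp_apply, T_single]
  split_ifs with h
  · rw [T_single, if_neg (by simpa [Nat.even_add_one] using h)]; simp
  · simp

/-- The adjoint shift on functionals. -/
noncomputable def Tstar (f : Fn) : Fn :=
  Finsupp.onFinset (f.support.image (fun n => n - 1)) (fun n => if Even n then f (n + 1) else 0) (by
    intro n hn
    rw [mem_image]
    exact ⟨n + 1, by simp at hn ⊢; exact hn.2, rfl⟩)

theorem Tstar_apply (f : Fn) (n : ℕ) : Tstar f n = if Even n then f (n + 1) else 0 := rfl

theorem ev_Tstar (f : Fn) (x : Vc) : ev (Tstar f) x = ev f (T x) := by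
  suffices h : ev (Tstar f) = ev f ∘ₗ T by rw [h]; rfl
  refine ext_ev fun n => ?_
  simp only [LinearMap.comp_apply, ev_single, Tstar_apply, T_single]
  split_ifs <;> simp [ev_single]

theorem Tstar_neg (f : Fn) : Tstar (-f) = -Tstar f := by
  ext n
  simp only [Tstar_apply, Finsupp.neg_apply]
  split_ifs <;> simp

/-- Restriction of a functional to the coordinates from `a` on. -/
noncomputable def cut (a : ℕ) (f : Fn) : Fn := f.filter (a ≤ ·)

theorem cut_apply (a : ℕ) (f : Fn) (n : ℕ) : cut a f n = if a ≤ n then f n else 0 :=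
  Finsupp.filter_apply _ _ _

theorem cut_zero (f : Fn) : cut 0 f = f := by
  ext n; simp [cut_apply]

theorem cut_cut (a b : ℕ) (f : Fn) : cut a (cut b f) = cut (max a b) f := by
  ext n
  simp only [cut_apply, max_le_iff]
  split_ifs <;> tauto

theorem cut_add (a : ℕ) (f g : Fn) : cut a (f + g) = cut a f + cut a g := by
  ext n
  simp only [cut_apply, Finsupp.add_apply]
  split_ifs <;> simp

theorem cut_smul (a : ℕ) (c : ℚ) (f : Fn) : cut a (c • f) = c • cut a f := by
  ext n
  simp only [cut_apply, Finsupp.smul_apply]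
  split_ifs <;> simp

theorem cut_sum {ι : Type*} (a : ℕ) (s : Finset ι) (f : ι → Fn) :
    cut a (∑ i ∈ s, f i) = ∑ i ∈ s, cut a (f i) := by
  ext n
  simp only [cut_apply, Finsupp.finsetSum_apply]
  split_ifs <;> simp

theorem cut_Tstar (a : ℕ) (f : Fn) : cut a (Tstar f) = Tstar (cut (a + 1) f) := by
  ext n
  simp only [cut_apply, Tstar_apply]
  split_ifs <;> first | rfl | omega

theorem cut_single (a n : ℕ) (c : ℚ) :
    cut a (Finsupp.single n c) = Finsupp.single n (if a ≤ n then c else 0) := by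
  ext k
  simp only [cut_apply, Finsupp.single_apply]
  split_ifs <;> first | rfl | omega

/-- Restriction of a vector to the coordinates from `a` on. -/
noncomputable def cutv (a : ℕ) : Vc →ₗ[ℝ] Vc :=
  Finsupp.linearCombination ℝ fun n => if a ≤ n then Finsupp.single n 1 else 0

theorem cutv_single (a n : ℕ) (c : ℝ) :
    cutv a (Finsupp.single n c) = if a ≤ n then Finsupp.single n c else 0 := by
  simp only [cutv, Finsupp.linearCombination_single]
  split_ifs <;> simp

theorem cutv_apply (a : ℕ) (x : Vc) (n : ℕ) : cutv a x n = if a ≤ n then x n else 0 := by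
  suffices h : Finsupp.lapply n ∘ₗ cutv a = if a ≤ n then Finsupp.lapply n else 0 by
    have := LinearMap.congr_fun h x
    split_ifs at this ⊢ <;> simpa using this
  refine ext_ev fun k => ?_
  simp only [LinearMap.comp_apply, cutv_single]
  by_cases h : k = n
  · subst h
    split_ifs <;> simp
  · split_ifs <;> simp [h]

theorem ev_cut (a : ℕ) (f : Fn) (x : Vc) : ev (cut a f) x = ev f (cutv a x) := by
  suffices h : ev (cut a f) = ev f ∘ₗ cutv a by rw [h]; rfl
  refine ext_ev fun n => ?_
  simp only [LinearMap.comp_apply, ev_single, cut_apply, cutv_single]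
  split_ifs <;> simp [ev_single]

/-- The first `d` members of a sequence are successive. -/
def Blk {R : Type*} [Zero R] (d : ℕ) (f : ℕ → ℕ →₀ R) : Prop :=
  ∀ l l', l < l' → l' < d → ∀ a b, f l a ≠ 0 → f l' b ≠ 0 → a < b

/-- The norming set (index `none`) and its functionals of weight `j` (index `some j`). -/
inductive Nm : Option ℕ → Fn → Prop
  | atom (n : ℕ) (c : ℚ) (hc : |c| ≤ 1) : Nm none (Finsupp.single n c)
  | forget (j : ℕ) (f : Fn) (hf : Nm (some j) f) : Nm none f
  | conv (t : ℚ) (f g : Fn) (h0 : 0 ≤ t) (h1 : t ≤ 1) (hf : Nm none f) (hg : Nm none g) :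
      Nm none (t • f + (1 - t) • g)
  | shift (f : Fn) (hf : Nm none f) : Nm none (Tstar f)
  | free (j d : ℕ) (f : ℕ → Fn) (c : ℚ) (hj : Even j) (hd : d ≤ wn j) (hc : |c| * wm j ≤ 1)
      (hf : ∀ l < d, Nm none (f l)) (hb : Blk d f) : Nm (some j) (c • ∑ l ∈ range d, f l)
  | special (j d : ℕ) (i : ℕ → ℕ) (f : ℕ → Fn) (c : ℚ) (a : ℕ) (hj : Odd j) (hd : d ≤ wn j)
      (hc : |c| * wm j ≤ 1) (hf : ∀ l < d, Nm (some (i l)) (f l)) (hb : Blk d f)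
      (hi : ∀ l < d, i l = code j ((List.range l).map fun r => (i r, f r))) :
      Nm (some j) (c • ∑ l ∈ range d, cut a (f l))

theorem Blk.cut {d : ℕ} {f : ℕ → Fn} (h : Blk d f) (a : ℕ) : Blk d fun l => cut a (f l) := by
  intro l l' hl hl' p q hp hq
  simp only [cut_apply, ne_eq, ite_eq_right_iff, Classical.not_imp] at hp hq
  exact h l l' hl hl' p q hp.2 hq.2

theorem Nm.neg {o : Option ℕ} {f : Fn} (h : Nm o f) : Nm o (-f) := by
  induction h with
  | atom n c hc => rw [← Finsupp.single_neg]; exact .atom n _ (by rwa [abs_neg])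
  | forget j f _ ih => exact .forget j _ ih
  | conv t f g h0 h1 _ _ ihf ihg =>
    rw [neg_add, ← smul_neg, ← smul_neg]; exact .conv t _ _ h0 h1 ihf ihg
  | shift f _ ih => rw [← Tstar_neg]; exact .shift _ ih
  | free j d f c hj hd hc hf hb _ =>
    rw [← neg_smul]; exact .free j d f (-c) hj hd (by rwa [abs_neg]) hf hb
  | special j d i f c a hj hd hc hf hb hi _ =>
    rw [← neg_smul]; exact .special j d i f (-c) a hj hd (by rwa [abs_neg]) hf hb hi

theorem Nm.cut {o : Option ℕ} {f : Fn} (h : Nm o f) (a : ℕ) : Nm o (cut a f) := by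
  induction h generalizing a with
  | atom n c hc =>
    rw [cut_single]; refine .atom n _ ?_
    split_ifs
    · exact hc
    · simp
  | forget j f _ ih => exact .forget j _ (ih a)
  | conv t f g h0 h1 _ _ ihf ihg =>
    rw [cut_add, cut_smul, cut_smul]; exact .conv t _ _ h0 h1 (ihf a) (ihg a)
  | shift f _ ih => rw [cut_Tstar]; exact .shift _ (ih _)
  | free j d f c hj hd hc hf hb ih =>
    rw [cut_smul, cut_sum]; exact .free j d _ c hj hd hc (fun l hl => ih l hl a) (hb.cut a)
  | special j d i f c b hj hd hc hf hb hi _ =>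
    rw [cut_smul, cut_sum]
    simp only [cut_cut]
    exact .special j d i f c _ hj hd hc hf hb hi

theorem Nm.zero : Nm none 0 := by
  have := Nm.atom 0 0 (by simp)
  simpa using this

/-- Weighted functionals are averages of successive members of the norming set. -/
theorem Nm.shape {i : ℕ} {f : Fn} (h : Nm (some i) f) : ∃ d ≤ wn i, ∃ g : ℕ → Fn, ∃ c : ℚ,
    (∀ l < d, Nm none (g l)) ∧ Blk d g ∧ |c| * wm i ≤ 1 ∧ f = c • ∑ l ∈ range d, g l := by
  cases h with
  | free _ d f c hj hd hc hf hb => exact ⟨d, hd, f, c, hf, hb, hc, rfl⟩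
  | special _ d i f c a hj hd hc hf hb hi =>
    exact ⟨d, hd, fun l => FewOps.cut a (f l), c, fun l hl => .forget _ _ ((hf l hl).cut a),
      hb.cut a, hc, rfl⟩

theorem abs_coord_le_of_blk {d i : ℕ} {g : ℕ → Fn} {c : ℚ} (hc : |c| * wm i ≤ 1)
    (hb : Blk d g) (n : ℕ) (hg : ∀ l < d, |g l n| ≤ 1) :
    |(c • ∑ l ∈ range d, g l) n| * wm i ≤ 1 := by
  have h1 : |∑ l ∈ range d, g l n| ≤ 1 := by
    by_cases h : ∃ l < d, g l n ≠ 0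
    · obtain ⟨l, hl, hne⟩ := h
      rw [sum_eq_single l]
      · exact hg l hl
      · intro l' hl' hne'
        by_contra hx
        rcases lt_or_gt_of_ne hne' with h | h
        · exact lt_irrefl _ (hb _ _ h hl _ _ hx hne)
        · exact lt_irrefl _ (hb _ _ h (mem_range.1 hl') _ _ hne hx)
      · intro h; simp [hl] at h
    · push Not at h
      rw [sum_eq_zero fun l hl => h l (mem_range.1 hl)]; simp
  rw [Finsupp.smul_apply, Finsupp.finsetSum_apply, smul_eq_mul, abs_mul]
  calc |c| * |∑ l ∈ range d, g l n| * wm i ≤ |c| * 1 * wm i := by gcongr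
    _ ≤ 1 := by linarith

theorem Nm.abs_coord_le {o : Option ℕ} {f : Fn} (h : Nm o f) (n : ℕ) : |f n| ≤ 1 := by
  have aux : ∀ (i : ℕ) (q : ℚ), |q| * wm i ≤ 1 → |q| ≤ 1 := by
    intro i q hq
    have h8 : (8 : ℚ) ≤ wm i := by exact_mod_cast wm_ge i
    nlinarith [abs_nonneg q]
  induction h generalizing n with
  | atom k c hc =>
    rw [Finsupp.single_apply]
    split_ifs
    · exact hc
    · simp
  | forget j f _ ih => exact ih n
  | conv t f g h0 h1 _ _ ihf ihg =>
    have hf := abs_le.1 (ihf n)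
    have hg := abs_le.1 (ihg n)
    simp only [Finsupp.add_apply, Finsupp.smul_apply, smul_eq_mul]
    rw [abs_le]
    constructor <;> nlinarith
  | shift f _ ih =>
    rw [Tstar_apply]
    split_ifs
    · exact ih _
    · simp
  | free j d f c hj hd hc hf hb ih =>
    exact aux j _ (abs_coord_le_of_blk hc hb n fun l hl => ih l hl n)
  | special j d i f c a hj hd hc hf hb hi ih =>
    refine aux j _ (abs_coord_le_of_blk hc (hb.cut a) n fun l hl => ?_)
    rw [cut_apply]
    split_ifs
    · exact ih l hl n
    · simp

theorem Nm.abs_coord_mul_le {i : ℕ} {f : Fn} (h : Nm (some i) f) (n : ℕ) :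
    |f n| * wm i ≤ 1 := by
  obtain ⟨d, _, g, c, hg, hb, hc, rfl⟩ := h.shape
  exact abs_coord_le_of_blk hc hb n fun l hl => (hg l hl).abs_coord_le n

/-- Splitting a staircase matrix into columns with several entries and single entries. -/
theorem staircase_split (d : ℕ) (F : Finset ℕ) (a : ℕ → ℕ → ℝ)
    (h : ∀ l k l' k', l < l' → l' < d → k ∈ F → k' ∈ F → a l k ≠ 0 → a l' k' ≠ 0 → k ≤ k') :
    ∃ G ⊆ F, ∃ Fl : ℕ → Finset ℕ, (∀ l, Fl l ⊆ F) ∧ G.card ≤ d ∧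
      ∑ l ∈ range d, (Fl l).card ≤ F.card ∧
      ∑ l ∈ range d, ∑ k ∈ F, a l k =
        ∑ k ∈ G, ∑ l ∈ range d, a l k + ∑ l ∈ range d, ∑ k ∈ Fl l, a l k := by
  classical
  set P : ℕ → Prop := fun k => ∃ l l', l < l' ∧ l' < d ∧ a l k ≠ 0 ∧ a l' k ≠ 0 with hP
  refine ⟨F.filter P, filter_subset _ _, fun l => F.filter fun k => ¬P k ∧ a l k ≠ 0,
    fun l => filter_subset _ _, ?_, ?_, ?_⟩
  · have hp : ∀ k, ∃ l, P k → ∃ l', l < l' ∧ l' < d ∧ a l k ≠ 0 ∧ a l' k ≠ 0 := by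
      intro k
      by_cases hk : P k
      · obtain ⟨l, hl⟩ := hk; exact ⟨l, fun _ => hl⟩
      · exact ⟨0, fun h => absurd h hk⟩
    choose p hp using hp
    rw [← card_range d]
    refine card_le_card_of_injOn p ?_ ?_
    · intro k hk
      obtain ⟨l', h1, h2, -⟩ := hp k (mem_filter.1 hk).2
      simpa using h1.trans h2
    · have key : ∀ k ∈ F.filter P, ∀ k' ∈ F.filter P, p k = p k' → k' ≤ k := by
        intro k hk k' hk' he
        obtain ⟨hkF, hkP⟩ := mem_filter.1 hk
        obtain ⟨hkF', hkP'⟩ := mem_filter.1 hk'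
        obtain ⟨l, h1, h2, h3, h4⟩ := hp k hkP
        obtain ⟨-, -, -, h3', -⟩ := hp k' hkP'
        rw [he] at h1
        exact h _ _ _ _ h1 h2 hkF' hkF h3' h4
      intro k hk k' hk' he
      exact le_antisymm (key _ hk' _ hk he.symm) (key _ hk _ hk' he)
  · simp only [card_filter]
    rw [sum_comm]
    calc ∑ k ∈ F, ∑ l ∈ range d, (if ¬P k ∧ a l k ≠ 0 then 1 else 0) ≤ ∑ k ∈ F, 1 := by
          refine sum_le_sum fun k _ => ?_
          by_cases hk : P k
          · simp [hk]
          rw [← card_filter, card_le_one]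
          intro l hl l' hl'
          simp only [mem_filter, mem_range] at hl hl'
          by_contra hne
          rcases lt_or_gt_of_ne hne with hlt | hlt
          · exact hk ⟨l, l', hlt, hl'.1, hl.2.2, hl'.2.2⟩
          · exact hk ⟨l', l, hlt, hl.1, hl'.2.2, hl.2.2⟩
      _ = F.card := by simp
  · simp only [sum_filter]
    conv_rhs => arg 1; rw [← sum_filter, sum_comm, ]
    rw [← sum_add_distrib]
    refine sum_congr rfl fun l _ => ?_
    rw [sum_filter, ← sum_add_distrib]
    refine sum_congr rfl fun k _ => ?_
    by_cases hk : P k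
    · simp [hk]
    · by_cases h0 : a l k = 0 <;> simp [hk, h0]

theorem ev_staircase {d : ℕ} {g : ℕ → Fn} (hg : Blk d g) {x : ℕ → Vc}
    (hx : ∀ n, Blk n x) :
    ∀ l k l' k', l < l' → l' < d → ev (g l) (x k) ≠ 0 → ev (g l') (x k') ≠ 0 → k ≤ k' := by
  intro l k l' k' hl hl' h1 h2
  obtain ⟨p, hp, hp'⟩ := exists_of_ev_ne_zero h1
  obtain ⟨q, hq, hq'⟩ := exists_of_ev_ne_zero h2
  by_contra! hlt
  have e1 := hg l l' hl hl' p q hp hq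
  have e2 := hx (k + 1) k' k hlt (by omega) q p hq' hp'
  omega

/-- A sequence of successive vectors. -/
def Bs (x : ℕ → Vc) : Prop := ∀ n, Blk n x

theorem Bs.lt {x : ℕ → Vc} (h : Bs x) {k k' a b : ℕ} (hk : k < k') (ha : x k a ≠ 0)
    (hb : x k' b ≠ 0) : a < b := h (k' + 1) k k' hk (by omega) a b ha hb

theorem wm_cast_ge (j : ℕ) : (8 : ℝ) ≤ wm j := by exact_mod_cast wm_ge j

theorem abs_coef_le {c : ℚ} {i : ℕ} (hc : |c| * wm i ≤ 1) : |(c : ℝ)| ≤ 1 / wm i := by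
  have h8 := wm_cast_ge i
  rw [le_div_iff₀ (by linarith)]
  exact_mod_cast hc

theorem ev_shape (c : ℚ) (d : ℕ) (g : ℕ → Fn) (x : Vc) :
    ev (c • ∑ l ∈ range d, g l) x = c * ∑ l ∈ range d, ev (g l) x := by
  rw [ev_smul, ev_sum]

theorem basic_step {i d : ℕ} {φ : ℕ → ℝ} {x : ℕ → Vc} {C θ : ℝ} {g : ℕ → Fn} {c : ℚ}
    (hφ0 : φ 0 = 0) (hφ1 : ∀ r, 1 ≤ r → 1 ≤ φ r)
    (hφ : ∀ d ≤ wn i, ∀ r : ℕ → ℕ, ∀ R : ℕ, ∑ l ∈ range d, r l ≤ R →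
      ∑ l ∈ range d, φ (r l) ≤ wm i / 4 * φ R)
    (hx : Bs x) (hC : 0 ≤ C) (hθ : 0 ≤ θ) (hd : d ≤ wn i) (hg : Blk d g)
    (hc : |c| * wm i ≤ 1) (F : Finset ℕ)
    (hβ : ∀ G ⊆ F, ∑ k ∈ G, |ev (c • ∑ l ∈ range d, g l) (x k)| ≤ C * (1 + G.card / wm i))
    (ih : ∀ l < d, ∀ G ⊆ F, |ev (g l) (∑ k ∈ G, x k)| ≤ C * (2 * φ G.card + θ * G.card)) :
    |ev (c • ∑ l ∈ range d, g l) (∑ k ∈ F, x k)|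
      ≤ C * (2 * φ F.card + θ * F.card / wm i) := by
  rcases F.eq_empty_or_nonempty with rfl | hF
  · simp [hφ0]
  have h8 := wm_cast_ge i
  have h1 := hφ1 _ hF.card_pos
  have hc' := abs_coef_le hc
  obtain ⟨G, hGF, Fl, hFl, hGd, hcard, hsum⟩ := staircase_split d F
    (fun l k => ev (g l) (x k))
    (fun l k l' k' hl hl' _ _ h h' => ev_staircase hg hx l k l' k' hl hl' h h')
  have e : ev (c • ∑ l ∈ range d, g l) (∑ k ∈ F, x k)
      = ∑ k ∈ G, ev (c • ∑ l ∈ range d, g l) (x k)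
        + c * ∑ l ∈ range d, ev (g l) (∑ k ∈ Fl l, x k) := by
    simp only [ev_shape, map_sum] at hsum ⊢
    rw [← mul_sum, sum_comm, hsum, mul_add, mul_sum]
  have hGφ : (G.card : ℝ) ≤ wm i / 4 * φ F.card := by
    by_cases hdF : d ≤ F.card
    · have h2 := hφ d hd (fun _ => 1) F.card (by simpa using hdF)
      have h3 : (d : ℝ) ≤ ∑ l ∈ range d, φ 1 := by
        rw [sum_const, card_range, nsmul_eq_mul]
        exact le_mul_of_one_le_right (Nat.cast_nonneg _) (hφ1 1 le_rfl)
      have h4 : (G.card : ℝ) ≤ d := by exact_mod_cast hGd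
      linarith
    · push Not at hdF
      have h2 := hφ F.card (by omega) (fun _ => 1) F.card (by simp)
      have h3 : (F.card : ℝ) ≤ ∑ l ∈ range F.card, φ 1 := by
        rw [sum_const, card_range, nsmul_eq_mul]
        exact le_mul_of_one_le_right (Nat.cast_nonneg _) (hφ1 1 le_rfl)
      have h4 : (G.card : ℝ) ≤ F.card := by exact_mod_cast card_le_card hGF
      linarith
  have hA : |∑ k ∈ G, ev (c • ∑ l ∈ range d, g l) (x k)| ≤ C * (1 + φ F.card / 4) := by
    refine (abs_sum_le_sum_abs _ _).trans ((hβ G hGF).trans ?_)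
    have : (G.card : ℝ) / wm i ≤ φ F.card / 4 := by
      rw [div_le_iff₀ (by linarith)]; linarith
    gcongr
  have hB : |(c : ℝ) * ∑ l ∈ range d, ev (g l) (∑ k ∈ Fl l, x k)|
      ≤ C * (φ F.card / 2 + θ * F.card / wm i) := by
    rw [abs_mul]
    have h2 : |∑ l ∈ range d, ev (g l) (∑ k ∈ Fl l, x k)|
        ≤ C * (wm i / 2 * φ F.card + θ * F.card) := by
      have h3 := hφ d hd (fun l => (Fl l).card) F.card hcard
      have h4 : (∑ l ∈ range d, ((Fl l).card : ℝ)) ≤ F.card := by exact_mod_cast hcard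
      calc |∑ l ∈ range d, ev (g l) (∑ k ∈ Fl l, x k)|
          ≤ ∑ l ∈ range d, C * (2 * φ (Fl l).card + θ * (Fl l).card) :=
            (abs_sum_le_sum_abs _ _).trans
              (sum_le_sum fun l hl => ih l (mem_range.1 hl) _ (hFl l))
        _ = C * (2 * ∑ l ∈ range d, φ (Fl l).card + θ * ∑ l ∈ range d, ((Fl l).card : ℝ)) := by
            rw [← mul_sum, sum_add_distrib, ← mul_sum, ← mul_sum]
        _ ≤ C * (2 * (wm i / 4 * φ F.card) + θ * F.card) := by gcongr
        _ = _ := by ring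
    calc |(c : ℝ)| * |∑ l ∈ range d, ev (g l) (∑ k ∈ Fl l, x k)|
        ≤ 1 / wm i * (C * (wm i / 2 * φ F.card + θ * F.card)) :=
          mul_le_mul hc' h2 (abs_nonneg _) (by positivity)
      _ = _ := by
          have : (wm i : ℝ) ≠ 0 := by linarith
          field_simp
  rw [e]
  refine (abs_add_le _ _).trans ((add_le_add hA hB).trans ?_)
  rw [← mul_add]
  exact mul_le_mul_of_nonneg_left (by linarith) hC

theorem basic_inequality {j : ℕ} {φ : ℕ → ℝ} {x : ℕ → Vc} {C θ : ℝ} {I : ℕ → Prop}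
    (hφ0 : φ 0 = 0) (hφ1 : ∀ r, 1 ≤ r → 1 ≤ φ r)
    (hφ : ∀ i < j, ∀ d ≤ wn i, ∀ r : ℕ → ℕ, ∀ R : ℕ, ∑ l ∈ range d, r l ≤ R →
      ∑ l ∈ range d, φ (r l) ≤ wm i / 4 * φ R)
    (hx : Bs x) (hC : 0 ≤ C) (hθ : 0 ≤ θ)
    (H0 : ∀ f, Nm none f → ∀ k, I k → |ev f (x k)| ≤ C)
    (Hβ : ∀ i < j, ∀ f, Nm (some i) f → ∀ F : Finset ℕ, (∀ k ∈ F, I k) →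
      ∑ k ∈ F, |ev f (x k)| ≤ C * (1 + F.card / wm i))
    (Hj : ∀ i, j ≤ i → ∀ f, Nm (some i) f → ∀ F : Finset ℕ, (∀ k ∈ F, I k) →
      |ev f (∑ k ∈ F, x k)| ≤ C * (1 + θ * F.card))
    (HT : ∀ f, Nm none f → ∀ F : Finset ℕ, (∀ k ∈ F, I k) → |ev f (T (∑ k ∈ F, x k))| ≤ C)
    {o : Option ℕ} {f : Fn} (hf : Nm o f) (a : ℕ) (F : Finset ℕ) (hF : ∀ k ∈ F, I k) :
    |ev (cut a f) (∑ k ∈ F, x k)| ≤ C * (2 * φ F.card + θ * F.card) ∧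
      ∀ i < j, o = some i →
        |ev (cut a f) (∑ k ∈ F, x k)| ≤ C * (2 * φ F.card + θ * F.card / wm i) := by
  have hle : ∀ F : Finset ℕ, F.Nonempty → C ≤ C * (2 * φ F.card + θ * F.card) := by
    intro F hF
    have h1 := hφ1 _ hF.card_pos
    have : 0 ≤ θ * F.card := by positivity
    exact le_mul_of_one_le_right hC (by linarith)
  have weighted : ∀ (i : ℕ) (h : Fn), Nm (some i) h → (i < j → ∀ F : Finset ℕ,
      (∀ k ∈ F, I k) → |ev h (∑ k ∈ F, x k)| ≤ C * (2 * φ F.card + θ * F.card / wm i)) →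
      ∀ F : Finset ℕ, (∀ k ∈ F, I k) →
      |ev h (∑ k ∈ F, x k)| ≤ C * (2 * φ F.card + θ * F.card) ∧
      ∀ i' < j, some i = some i' →
        |ev h (∑ k ∈ F, x k)| ≤ C * (2 * φ F.card + θ * F.card / wm i') := by
    intro i h hh hyp F hF
    by_cases hij : i < j
    · refine ⟨(hyp hij F hF).trans ?_, fun i' _ he => ?_⟩
      · gcongr
        have h8 := wm_cast_ge i
        exact div_le_self (by positivity) (by linarith)
      · cases he; exact hyp hij F hF
    · refine ⟨?_, fun i' h' he => by cases he; exact absurd h' hij⟩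
      rcases F.eq_empty_or_nonempty with rfl | hFn
      · simp [hφ0]
      · refine (Hj i (by omega) h hh F hF).trans ?_
        have := hφ1 _ hFn.card_pos
        gcongr
        linarith
  induction hf generalizing a F with
  | atom n c hc =>
    refine ⟨?_, by simp⟩
    rcases F.eq_empty_or_nonempty with rfl | hFn
    · simp [hφ0]
    refine le_trans ?_ (hle F hFn)
    have hK := (Nm.atom n c hc).cut a
    rw [cut_single] at hK ⊢
    rw [map_sum]
    by_cases h : ∃ k ∈ F, ev (Finsupp.single n (if a ≤ n then c else 0)) (x k) ≠ 0
    · obtain ⟨k, hk, hne⟩ := h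
      rw [sum_eq_single k]
      · exact H0 _ hK k (hF k hk)
      · intro k' _ hkk
        by_contra h'
        obtain ⟨p, hp, hp'⟩ := exists_of_ev_ne_zero hne
        obtain ⟨q, hq, hq'⟩ := exists_of_ev_ne_zero h'
        have e1 : n = p := by by_contra hh; simp [hh] at hp
        have e2 : n = q := by by_contra hh; simp [hh] at hq
        rcases lt_or_gt_of_ne hkk with h | h
        · have := hx.lt h hq' hp'; omega
        · have := hx.lt h hp' hq'; omega
      · intro h; exact absurd hk h
    · push Not at h
      rw [sum_eq_zero h]; simpa using hC
  | forget i f hf ih => exact ⟨(ih a F hF).1, by simp⟩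
  | conv t f g h0 h1 hf hg ihf ihg =>
    refine ⟨?_, by simp⟩
    rw [cut_add, cut_smul, cut_smul, ev_add, ev_smul, ev_smul]
    have h0' : (0 : ℝ) ≤ t := by exact_mod_cast h0
    have h1' : (t : ℝ) ≤ 1 := by exact_mod_cast h1
    have a1 := abs_le.1 (ihf a F hF).1
    have a2 := abs_le.1 (ihg a F hF).1
    push_cast
    rw [abs_le]
    constructor <;> nlinarith
  | shift f hf ih =>
    refine ⟨?_, by simp⟩
    rcases F.eq_empty_or_nonempty with rfl | hFn
    · simp [hφ0]
    rw [cut_Tstar, ev_Tstar]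
    exact (HT _ (hf.cut _) F hF).trans (hle F hFn)
  | free i d f c hj hd hc hf hb ih =>
    have hN := (Nm.free i d f c hj hd hc hf hb).cut a
    refine weighted i _ hN ?_ F hF
    rw [cut_smul, cut_sum] at hN ⊢
    intro hij F hF
    exact basic_step hφ0 hφ1 (hφ i hij) hx hC hθ hd (hb.cut a) hc F
      (fun G hG => Hβ i hij _ hN G fun k hk => hF k (hG hk))
      (fun l hl G hG => (ih l hl a G fun k hk => hF k (hG hk)).1)
  | special i d w f c b hj hd hc hf hb hi ih =>
    have hN := (Nm.special i d w f c b hj hd hc hf hb hi).cut a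
    refine weighted i _ hN ?_ F hF
    rw [cut_smul, cut_sum] at hN ⊢
    simp only [cut_cut] at hN ⊢
    intro hij F hF
    exact basic_step hφ0 hφ1 (hφ i hij) hx hC hθ hd (hb.cut _) hc F
      (fun G hG => Hβ i hij _ hN G fun k hk => hF k (hG hk))
      (fun l hl G hG => (ih l hl _ G fun k hk => hF k (hG hk)).1)

/-- Rapidly increasing sequences with constant `C`. -/
structure RIS (C : ℝ) (x : ℕ → Vc) : Prop where
  bs : Bs x
  bd : ∀ f, Nm none f → ∀ k, |ev f (x k)| ≤ C
  wt : ∀ i f, Nm (some i) f → ∀ F : Finset ℕ, ∑ k ∈ F, |ev f (x k)| ≤ C * (1 + F.card / wm i)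
  sh : ∀ f, Nm none f → ∀ F : Finset ℕ, ∑ k ∈ F, |ev f (T (x k))| ≤ C

theorem RIS.nonneg {C : ℝ} {x : ℕ → Vc} (h : RIS C x) : 0 ≤ C := by
  have := h.sh 0 .zero ∅
  simpa using this

theorem RIS.comp {C : ℝ} {x : ℕ → Vc} (h : RIS C x) {u : ℕ → ℕ} (hu : StrictMono u) :
    RIS C (fun k => x (u k)) := by
  classical
  refine ⟨fun n l l' hl _ a b ha hb => h.bs.lt (hu hl) ha hb, fun f hf k => h.bd f hf _,
    fun i f hf F => ?_, fun f hf F => ?_⟩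
  · have := h.wt i f hf (F.map ⟨u, hu.injective⟩)
    simpa using this
  · have := h.sh f hf (F.map ⟨u, hu.injective⟩)
    simpa using this

theorem RIS.smul {C : ℝ} {x : ℕ → Vc} (h : RIS C x) {s : ℕ → ℝ} (hs : ∀ k, |s k| ≤ 1) :
    RIS C (fun k => s k • x k) := by
  have key : ∀ k (r : ℝ), |s k * r| ≤ |r| := fun k r => by
    rw [abs_mul]; exact mul_le_of_le_one_left (abs_nonneg _) (hs k)
  refine ⟨fun n l l' hl _ a b ha hb => h.bs.lt hl ?_ ?_, fun f hf k => ?_,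
    fun i f hf F => ?_, fun f hf F => ?_⟩
  · intro h0; exact ha (by simp [h0])
  · intro h0; exact hb (by simp [h0])
  · simp only [map_smul, smul_eq_mul]; exact (key _ _).trans (h.bd f hf k)
  · simp only [map_smul, smul_eq_mul]
    exact (sum_le_sum fun k _ => key _ _).trans (h.wt i f hf F)
  · simp only [map_smul, smul_eq_mul]
    exact (sum_le_sum fun k _ => key _ _).trans (h.sh f hf F)

/-- The estimates satisfied by normalised averages of rapidly increasing sequences. -/
structure IsExact (C : ℝ) (j : ℕ) (v : Vc) : Prop where
  bd : ∀ f, Nm none f → |ev f v| ≤ C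
  lo : ∀ i < j, ∀ f, Nm (some i) f → |ev f v| ≤ C / wm i
  hi : ∀ i, j < i → ∀ f, Nm (some i) f → |ev f v| ≤ C / (wm j : ℝ) ^ 2
  sh : ∀ f, Nm none f → |ev f (T v)| ≤ C / (wm j : ℝ) ^ 2

theorem wm_cube_le_wn (j : ℕ) : (wm j : ℝ) ^ 3 ≤ wn j := by
  exact_mod_cast wm_pow_le_wn j 3 (by have := ws_ge j; omega)

theorem RIS.isExact {C : ℝ} {x : ℕ → Vc} (h : RIS C x) {j : ℕ} {F : Finset ℕ}
    (hF : F.card = wn j) : IsExact (3 * C) j ((wm j / wn j : ℝ) • ∑ k ∈ F, x k) := by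
  obtain ⟨φ, hφ0, hφ1, hφn, hφ⟩ := exists_growth j
  have hC := h.nonneg
  have hm := wm_cast_ge j
  have hn := wm_cube_le_wn j
  have hn0 : (0 : ℝ) < wn j := lt_of_lt_of_le (by positivity) hn
  have hm0 : (0 : ℝ) < wm j := by linarith
  have hr : (wm j / wn j : ℝ) ≤ 1 / (wm j : ℝ) ^ 2 := by
    rw [div_le_div_iff₀ hn0 (by positivity)]; linarith
  have hr0 : (0 : ℝ) ≤ wm j / wn j := by positivity
  have key := fun (o : Option ℕ) (f : Fn) (hf : Nm o f) =>
    basic_inequality (θ := 1 / wm j) (I := fun _ => True) hφ0 hφ1 hφ h.bs hC (by positivity)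
      (fun f hf k _ => h.bd f hf k) (fun i _ f hf F _ => h.wt i f hf F)
      (fun i hi f hf F _ => by
        rw [map_sum]
        refine (abs_sum_le_sum_abs _ _).trans ((h.wt i f hf F).trans ?_)
        have : (wm j : ℝ) ≤ wm i := by exact_mod_cast wm_strictMono.monotone hi
        rw [div_eq_mul_one_div, mul_comm (F.card : ℝ)]
        gcongr)
      (fun f hf F _ => by
        rw [map_sum, map_sum]
        exact (abs_sum_le_sum_abs _ _).trans (h.sh f hf F)) hf 0 F (fun _ _ => trivial)
  have hφe : φ (wn j) = wn j / (wm j : ℝ) ^ 4 := by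
    rw [eq_div_iff (by positivity)]; exact hφn
  refine ⟨fun f hf => ?_, fun i hi f hf => ?_, fun i hi f hf => ?_, fun f hf => ?_⟩
  · have h1 := (key _ f hf).1
    rw [cut_zero, hF, hφe] at h1
    rw [map_smul, smul_eq_mul, abs_mul, abs_of_nonneg hr0]
    refine (mul_le_mul_of_nonneg_left h1 hr0).trans ?_
    have e : (wm j / wn j : ℝ) * (C * (2 * (wn j / (wm j : ℝ) ^ 4) + 1 / wm j * wn j))
        = C * (2 * (1 / (wm j : ℝ) ^ 3) + 1) := by field_simp
    have e2 : 1 / (wm j : ℝ) ^ 3 ≤ 1 := by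
      rw [div_le_one (by positivity)]; exact one_le_pow₀ (by linarith)
    rw [e]
    nlinarith
  · have h1 := (key _ f hf).2 i hi rfl
    have hi8 := wm_cast_ge i
    have him : (wm i : ℝ) ≤ wm j := by exact_mod_cast wm_strictMono.monotone hi.le
    rw [cut_zero, hF, hφe] at h1
    rw [map_smul, smul_eq_mul, abs_mul, abs_of_nonneg hr0]
    refine (mul_le_mul_of_nonneg_left h1 hr0).trans ?_
    have e : (wm j / wn j : ℝ) * (C * (2 * (wn j / (wm j : ℝ) ^ 4) + 1 / wm j * wn j / wm i))
        = C * (2 * (1 / (wm j : ℝ) ^ 3) + 1 / wm i) := by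
      have : (wm i : ℝ) ≠ 0 := by linarith
      field_simp
    have e2 : 1 / (wm j : ℝ) ^ 3 ≤ 1 / wm i := by
      refine one_div_le_one_div_of_le (by linarith) (him.trans ?_)
      exact le_self_pow₀ (by linarith) (by norm_num)
    rw [e, show 3 * C / (wm i : ℝ) = C * (2 * (1 / wm i) + 1 / wm i) by ring]
    gcongr
  · have h1 := h.wt i f hf F
    have h2 : (wn j : ℝ) * (wm j) ^ 3 ≤ wm i := by
      have := (wn_mul_wm_cube_le j).trans (wm_strictMono.monotone (Nat.succ_le_of_lt hi))
      exact_mod_cast this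
    rw [hF] at h1
    rw [map_smul, smul_eq_mul, abs_mul, abs_of_nonneg hr0, map_sum]
    have h3 : (wn j : ℝ) / wm i ≤ 1 := by
      rw [div_le_one (by have := wm_cast_ge i; linarith)]
      refine le_trans ?_ h2
      exact le_mul_of_one_le_right hn0.le (one_le_pow₀ (by linarith))
    have h4 : |∑ k ∈ F, ev f (x k)| ≤ 3 * C := by
      refine (abs_sum_le_sum_abs _ _).trans (h1.trans ?_)
      nlinarith
    calc (wm j / wn j : ℝ) * |∑ k ∈ F, ev f (x k)| ≤ 1 / (wm j : ℝ) ^ 2 * (3 * C) :=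
          mul_le_mul hr h4 (abs_nonneg _) (by positivity)
      _ = _ := by ring
  · rw [map_smul, map_smul, smul_eq_mul, abs_mul, abs_of_nonneg hr0, map_sum, map_sum]
    have h4 : |∑ k ∈ F, ev f (T (x k))| ≤ 3 * C := by
      refine (abs_sum_le_sum_abs _ _).trans ((h.sh f hf F).trans ?_)
      linarith
    calc (wm j / wn j : ℝ) * |∑ k ∈ F, ev f (T (x k))| ≤ 1 / (wm j : ℝ) ^ 2 * (3 * C) :=
          mul_le_mul hr h4 (abs_nonneg _) (by positivity)
      _ = _ := by ring

theorem IsExact.nonneg {C : ℝ} {j : ℕ} {v : Vc} (h : IsExact C j v) : 0 ≤ C :=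
  (abs_nonneg _).trans (h.bd 0 .zero)

theorem IsExact.mismatch {C : ℝ} {j i j₀ : ℕ} {v : Vc} (h : IsExact C j v) (hj : j₀ < j)
    (hi : j₀ < i) (hne : i ≠ j) {f : Fn} (hf : Nm (some i) f) :
    |ev f v| ≤ C / wm (j₀ + 1) := by
  have h8 := wm_cast_ge (j₀ + 1)
  have hC := h.nonneg
  rcases lt_or_gt_of_ne hne with hlt | hlt
  · refine (h.lo i hlt f hf).trans ?_
    have : (wm (j₀ + 1) : ℝ) ≤ wm i := by exact_mod_cast wm_strictMono.monotone hi
    gcongr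
  · refine (h.hi i hlt f hf).trans ?_
    have h1 : (wm (j₀ + 1) : ℝ) ≤ wm j := by exact_mod_cast wm_strictMono.monotone hj
    have : (wm (j₀ + 1) : ℝ) ≤ (wm j : ℝ) ^ 2 := h1.trans (le_self_pow₀ (by linarith) (by norm_num))
    gcongr

/-- A sequence of exact vectors whose weights are coded by an accompanying sequence of
functionals that nearly annihilate them. -/
structure Dependent (C ε : ℝ) (j₀ : ℕ) (v : ℕ → Vc) (g : ℕ → Fn) (w N : ℕ → ℕ) : Prop where
  exact : ∀ k, IsExact C (w k) (v k)
  wt : ∀ k, w k = code j₀ ((List.range k).map fun r => (w r, g r))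
  mem : ∀ k, Nm (some (w k)) (g k)
  mono : Monotone N
  supp : ∀ k n, v k n ≠ 0 → N k ≤ n ∧ n < N (k + 1)
  suppg : ∀ k n, g k n ≠ 0 → N k ≤ n ∧ n < N (k + 1)
  small : ∀ k, |ev (g k) (v k)| ≤ ε

section
variable {C ε : ℝ} {j₀ : ℕ} {v : ℕ → Vc} {g : ℕ → Fn} {w N : ℕ → ℕ}

theorem Dependent.lt (h : Dependent C ε j₀ v g w N) (k : ℕ) : j₀ < w k := by
  rw [h.wt]; exact lt_code _ _

theorem coded_eq {i i' : ℕ → ℕ} {f f' : ℕ → Fn} {l k : ℕ}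
    (h : code j₀ ((List.range l).map fun r => (i r, f r)) =
      code j₀ ((List.range k).map fun r => (i' r, f' r))) :
    l = k ∧ ∀ r < l, i r = i' r ∧ f r = f' r := by
  have h1 := code_injective j₀ h
  have h2 : l = k := by simpa using congrArg List.length h1
  subst h2
  refine ⟨rfl, fun r hr => ?_⟩
  have := List.map_inj_left.1 h1 r (List.mem_range.2 hr)
  simpa using this

theorem sum_indicator_le {F : Finset ℕ} {P : ℕ → Prop} [DecidablePred P] {C : ℝ} (hC : 0 ≤ C)
    (h : ∀ k k', k < k' → P k → P k' → False) : ∑ k ∈ F, (if P k then C else 0) ≤ C := by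
  rw [← sum_filter, sum_const, nsmul_eq_mul]
  have : (F.filter P).card ≤ 1 := by
    rw [card_le_one]
    intro a ha b hb
    by_contra hne
    rcases lt_or_gt_of_ne hne with h' | h'
    · exact h a b h' (mem_filter.1 ha).2 (mem_filter.1 hb).2
    · exact h b a h' (mem_filter.1 hb).2 (mem_filter.1 ha).2
  have : ((F.filter P).card : ℝ) ≤ 1 := by exact_mod_cast this
  nlinarith

theorem Dependent.matched (h : Dependent C ε j₀ v g w N) (hε : 0 ≤ ε) {d : ℕ} {i : ℕ → ℕ}
    {f : ℕ → Fn} (hf : ∀ l < d, Nm (some (i l)) (f l))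
    (hi : ∀ l < d, i l = code j₀ ((List.range l).map fun r => (i r, f r))) (a : ℕ)
    (F : Finset ℕ) :
    ∑ k ∈ F, (if k < d ∧ i k = w k then |ev (cut a (f k)) (v k)| else 0)
      ≤ F.card * ε + 2 * C := by
  classical
  have hC := (h.exact 0).nonneg
  have b1 := sum_indicator_le (F := F) (P := fun k => k < d ∧ i k = w k ∧ f k ≠ g k) hC (by
    rintro k k' hlt ⟨h1, h2, h3⟩ ⟨h1', h2', h3'⟩
    rw [hi k' h1', h.wt] at h2'
    exact h3 ((coded_eq h2').2 k hlt).2)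
  have b2 := sum_indicator_le (F := F) (P := fun k => N k < a ∧ a < N (k + 1)) hC (by
    rintro k k' hlt ⟨h1, h2⟩ ⟨h1', h2'⟩
    have := h.mono (show k + 1 ≤ k' by omega)
    omega)
  have key : ∀ k ∈ F, (if k < d ∧ i k = w k then |ev (cut a (f k)) (v k)| else 0)
      ≤ ε + (if k < d ∧ i k = w k ∧ f k ≠ g k then C else 0)
        + (if N k < a ∧ a < N (k + 1) then C else 0) := by
    intro k _
    have p1 : (0 : ℝ) ≤ if N k < a ∧ a < N (k + 1) then C else 0 := by split_ifs <;> simp [hC]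
    have p2 : (0 : ℝ) ≤ if k < d ∧ i k = w k ∧ f k ≠ g k then C else 0 := by
      split_ifs <;> simp [hC]
    by_cases hk : k < d ∧ i k = w k
    · rw [if_pos hk]
      have hb := (h.exact k).bd _ ((Nm.forget _ _ (hf k hk.1)).cut a)
      by_cases hfg : f k = g k
      · by_cases ha : N k < a ∧ a < N (k + 1)
        · rw [if_pos ha]; linarith
        · rw [hfg] at p2 ⊢
          rw [not_and_or, not_lt, not_lt] at ha
          have : |ev (cut a (g k)) (v k)| ≤ ε := by
            rcases ha with ha | ha
            · have : cut a (g k) = g k := by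
                ext n
                rw [cut_apply]
                split_ifs with hn
                · rfl
                · by_contra hne
                  have := (h.suppg k n (Ne.symm hne)).1
                  omega
              rw [this]; exact h.small k
            · have : cut a (g k) = 0 := by
                ext n
                rw [cut_apply]
                split_ifs with hn
                · by_contra hne
                  have := (h.suppg k n hne).2
                  omega
                · rfl
              rw [this, ev_zero]; simpa using hε
          linarith
      · rw [if_pos ⟨hk.1, hk.2, hfg⟩]; linarith
    · rw [if_neg hk]; linarith
  refine (sum_le_sum key).trans ?_
  rw [sum_add_distrib, sum_add_distrib, sum_const, nsmul_eq_mul]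
  linarith

theorem Dependent.bs (h : Dependent C ε j₀ v g w N) : Bs v := by
  intro n l l' hl _ a b ha hb
  have h1 := (h.supp l a ha).2
  have h2 := (h.supp l' b hb).1
  have h3 := h.mono (show l + 1 ≤ l' by omega)
  omega

theorem Dependent.weighted_bound (h : Dependent C ε j₀ v g w N) (hj : Odd j₀) (hε : 0 ≤ ε)
    (hεC : wn j₀ * ε ≤ C) {i : ℕ} (hi : j₀ ≤ i) {f : Fn} (hf : Nm (some i) f) {F : Finset ℕ}
    (hF : ∀ k ∈ F, k < wn j₀) :
    |ev f (∑ k ∈ F, v k)| ≤ 3 * C * (1 + 1 / (wm j₀ : ℝ) ^ 2 * F.card) := by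
  classical
  have hC := (h.exact 0).nonneg
  have h8 := wm_cast_ge j₀
  have h8' := wm_cast_ge (j₀ + 1)
  have hFc : (F.card : ℝ) ≤ wn j₀ := by
    have := card_le_card (fun k hk => mem_range.2 (hF k hk) : F ⊆ range (wn j₀))
    rw [card_range] at this
    exact_mod_cast this
  have hnm : (wn j₀ : ℝ) * (C / wm (j₀ + 1)) ≤ C * (1 / (wm j₀ : ℝ) ^ 2) := by
    have h1 : (wn j₀ : ℝ) * wm j₀ ^ 3 ≤ wm (j₀ + 1) := by exact_mod_cast wn_mul_wm_cube_le j₀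
    have h2 : (wn j₀ : ℝ) * wm j₀ ^ 2 ≤ wm (j₀ + 1) := by
      refine le_trans ?_ h1
      gcongr
      · linarith
      · norm_num
    have h3 : (wn j₀ : ℝ) / wm (j₀ + 1) ≤ 1 / (wm j₀ : ℝ) ^ 2 := by
      rw [div_le_div_iff₀ (by linarith) (by positivity)]; linarith
    calc (wn j₀ : ℝ) * (C / wm (j₀ + 1)) = C * (wn j₀ / wm (j₀ + 1)) := by ring
      _ ≤ _ := by gcongr
  rw [map_sum]
  rcases hi.eq_or_lt with rfl | hlt
  · cases hf with
    | free _ d f c hj' hd hc hf hb => exact absurd hj' (Nat.not_even_iff_odd.2 hj)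
    | special _ d i f c a hj' hd hc hf hb hi =>
      have hc' : |(c : ℝ)| ≤ 1 := (abs_coef_le hc).trans (by
        rw [div_le_one (by linarith)]; linarith)
      have hk : ∀ k ∈ F, |ev (c • ∑ l ∈ range d, cut a (f l)) (v k)| ≤
          C * (1 / (wm j₀ : ℝ) ^ 2)
            + if k < d ∧ i k = w k then |ev (cut a (f k)) (v k)| else 0 := by
        intro k _
        rw [ev_shape, abs_mul]
        refine (mul_le_of_le_one_left (abs_nonneg _) hc').trans
          ((abs_sum_le_sum_abs _ _).trans ?_)
        have hl : ∀ l ∈ range d, |ev (cut a (f l)) (v k)| ≤ C / wm (j₀ + 1)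
            + if l = k then (if k < d ∧ i k = w k then |ev (cut a (f k)) (v k)| else 0)
              else 0 := by
          intro l hl
          have hl := mem_range.1 hl
          have p0 : 0 ≤ C / wm (j₀ + 1) := by positivity
          have hil : j₀ < i l := by rw [hi l hl]; exact lt_code _ _
          by_cases hm : i l = w k
          · have hlk : l = k := by
              have hm' := hm
              rw [hi l hl, h.wt k] at hm'
              exact (coded_eq hm').1
            subst hlk
            rw [if_pos rfl, if_pos ⟨hl, hm⟩]
            linarith
          · have := (h.exact k).mismatch (h.lt k) hil hm ((hf l hl).cut a)
            refine this.trans (le_add_of_nonneg_right ?_)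
            split_ifs <;> positivity
        refine (sum_le_sum hl).trans ?_
        rw [sum_add_distrib, sum_const, card_range, nsmul_eq_mul, sum_ite_eq']
        have hd' : (d : ℝ) ≤ wn j₀ := by exact_mod_cast hd
        have : (d : ℝ) * (C / wm (j₀ + 1)) ≤ C * (1 / (wm j₀ : ℝ) ^ 2) :=
          le_trans (by gcongr) hnm
        refine add_le_add this ?_
        split_ifs <;> first | exact le_rfl | positivity
      refine (abs_sum_le_sum_abs _ _).trans ((sum_le_sum hk).trans ?_)
      rw [sum_add_distrib, sum_const, nsmul_eq_mul]
      have h1 := h.matched hε hf hi a F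
      have h2 : (F.card : ℝ) * ε ≤ C := le_trans (by gcongr) hεC
      have h3 : 0 ≤ C * (1 / (wm j₀ : ℝ) ^ 2 * F.card) := by positivity
      nlinarith
  · have b1 := sum_indicator_le (F := F) (P := fun k => w k = i) hC (by
      intro k k' hlt h1 h2
      rw [← h2, h.wt k, h.wt k'] at h1
      exact hlt.ne (coded_eq h1).1)
    have hk : ∀ k ∈ F, |ev f (v k)| ≤ C * (1 / (wm j₀ : ℝ) ^ 2) + if w k = i then C else 0 := by
      intro k _
      have p1 : 0 ≤ C * (1 / (wm j₀ : ℝ) ^ 2) := by positivity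
      split_ifs with hw
      · have := (h.exact k).bd f (.forget _ _ hf)
        linarith
      · have h1 := (h.exact k).mismatch (h.lt k) hlt (Ne.symm hw) hf
        have h2 : C / wm (j₀ + 1) ≤ wn j₀ * (C / wm (j₀ + 1)) := by
          refine le_mul_of_one_le_left (by positivity) ?_
          exact_mod_cast (by have := wn_ge j₀; omega : 1 ≤ wn j₀)
        linarith
    refine (abs_sum_le_sum_abs _ _).trans ((sum_le_sum hk).trans ?_)
    rw [sum_add_distrib, sum_const, nsmul_eq_mul]
    have h3 : 0 ≤ C * (1 / (wm j₀ : ℝ) ^ 2 * F.card) := by positivity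
    nlinarith

theorem Dependent.norm_bound (h : Dependent C ε j₀ v g w N) (hj : Odd j₀) (hε : 0 ≤ ε)
    (hεC : wn j₀ * ε ≤ C) {f : Fn} (hf : Nm none f) :
    |ev f (∑ k ∈ range (wn j₀), v k)| ≤ 9 * C * wn j₀ / (wm j₀ : ℝ) ^ 2 := by
  obtain ⟨φ, hφ0, hφ1, hφn, hφ⟩ := exists_growth j₀
  have hC := (h.exact 0).nonneg
  have h8 := wm_cast_ge j₀
  have hm0 : (0 : ℝ) < wm j₀ := by linarith
  have key := (basic_inequality (θ := 1 / (wm j₀ : ℝ) ^ 2) (I := fun k => k < wn j₀)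
    (C := 3 * C) hφ0 hφ1 hφ h.bs
    (by positivity) (by positivity) (fun f hf k _ => ((h.exact k).bd f hf).trans (by linarith))
    (fun i hi f hf F _ => by
      have hw := wm_cast_ge i
      have h1 : ∀ k ∈ F, |ev f (v k)| ≤ C / wm i := fun k _ =>
        (h.exact k).lo i (hi.trans (h.lt k)) f hf
      refine (sum_le_sum h1).trans ?_
      rw [sum_const, nsmul_eq_mul]
      have : 0 ≤ C * (F.card / wm i) := by positivity
      have e : (F.card : ℝ) * (C / wm i) = C * (F.card / wm i) := by ring
      rw [e]
      nlinarith)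
    (fun i hi f hf F hF => h.weighted_bound hj hε hεC hi hf hF)
    (fun f hf F hF => by
      have hFc : (F.card : ℝ) ≤ wn j₀ := by
        have := card_le_card (fun k hk => mem_range.2 (hF k hk) : F ⊆ range (wn j₀))
        rw [card_range] at this
        exact_mod_cast this
      rw [map_sum, map_sum]
      have hn0 : (0 : ℝ) < wn j₀ := by exact_mod_cast (by have := wn_ge j₀; omega : 0 < wn j₀)
      have h1 : ∀ k ∈ F, |ev f (T (v k))| ≤ C / wn j₀ := by
        intro k _
        refine ((h.exact k).sh f hf).trans ?_
        have h2 : (wn j₀ : ℝ) ≤ (wm (w k) : ℝ) ^ 2 := by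
          have h3 : wn j₀ ≤ wm (j₀ + 1) := by
            rw [wm_succ]; exact Nat.le_self_pow (by norm_num) _
          have h4 := h3.trans (wm_strictMono.monotone (Nat.succ_le_of_lt (h.lt k)))
          exact_mod_cast h4.trans (Nat.le_self_pow (by norm_num) _)
        gcongr
      refine (abs_sum_le_sum_abs _ _).trans ((sum_le_sum h1).trans ?_)
      rw [sum_const, nsmul_eq_mul]
      calc (F.card : ℝ) * (C / wn j₀) ≤ wn j₀ * (C / wn j₀) := by gcongr
        _ = C := by field_simp
        _ ≤ 3 * C := by linarith) hf 0 (range (wn j₀)) (fun k hk => mem_range.1 hk)).1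
  have hφe : φ (wn j₀) = wn j₀ / (wm j₀ : ℝ) ^ 4 := by
    rw [eq_div_iff (by positivity)]; exact hφn
  rw [cut_zero, card_range, hφe] at key
  refine key.trans ?_
  have e2 : 1 / (wm j₀ : ℝ) ^ 4 ≤ 1 / (wm j₀ : ℝ) ^ 2 :=
    one_div_le_one_div_of_le (by positivity) (pow_le_pow_right₀ (by linarith) (by norm_num))
  calc 3 * C * (2 * (wn j₀ / (wm j₀ : ℝ) ^ 4) + 1 / (wm j₀ : ℝ) ^ 2 * wn j₀)
      = 3 * C * wn j₀ * (2 * (1 / (wm j₀ : ℝ) ^ 4) + 1 / (wm j₀ : ℝ) ^ 2) := by ring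
    _ ≤ 3 * C * wn j₀ * (2 * (1 / (wm j₀ : ℝ) ^ 2) + 1 / (wm j₀ : ℝ) ^ 2) := by gcongr
    _ = _ := by ring

end

/-- The norming set as a type, with the discrete topology. -/
def K : Type := {f : Fn // Nm none f}

instance : TopologicalSpace K := ⊥

instance : DiscreteTopology K := ⟨rfl⟩

/-- Bounded functions on the norming set. -/
def Z : Type := BoundedContinuousFunction K ℝ

noncomputable instance : NormedAddCommGroup Z :=
  inferInstanceAs (NormedAddCommGroup (BoundedContinuousFunction K ℝ))

noncomputable instance : NormedSpace ℝ Z :=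
  inferInstanceAs (NormedSpace ℝ (BoundedContinuousFunction K ℝ))

instance : CompleteSpace Z := inferInstanceAs (CompleteSpace (BoundedContinuousFunction K ℝ))

instance : FunLike Z K ℝ := inferInstanceAs (FunLike (BoundedContinuousFunction K ℝ) K ℝ)

instance : ContinuousEvalConst Z K ℝ :=
  inferInstanceAs (ContinuousEvalConst (BoundedContinuousFunction K ℝ) K ℝ)

theorem Z.norm_coe_le_norm (w : Z) (f : K) : |w f| ≤ ‖w‖ :=
  BoundedContinuousFunction.norm_coe_le_norm w f

theorem Z.norm_le {w : Z} {C : ℝ} (hC : 0 ≤ C) : ‖w‖ ≤ C ↔ ∀ f, |w f| ≤ C :=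
  BoundedContinuousFunction.norm_le hC

theorem Nm.abs_ev_le_l1 {o : Option ℕ} {f : Fn} (hf : Nm o f) (x : Vc) :
    |ev f x| ≤ x.sum fun _ c => |c| := by
  rw [ev_apply, Finsupp.sum, Finsupp.sum]
  refine (abs_sum_le_sum_abs _ _).trans (sum_le_sum fun n _ => ?_)
  rw [abs_mul]
  refine mul_le_of_le_one_right (abs_nonneg _) ?_
  exact_mod_cast hf.abs_coord_le n

/-- The canonical embedding of finitely supported vectors. -/
noncomputable def J : Vc →ₗ[ℝ] Z where
  toFun x := BoundedContinuousFunction.ofNormedAddCommGroupDiscrete (fun f : K => ev f.1 x)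
    (x.sum fun _ c => |c|) fun f => f.2.abs_ev_le_l1 x
  map_add' x y := by refine DFunLike.ext _ _ fun f => ?_; exact map_add (ev f.1) x y
  map_smul' c x := by refine DFunLike.ext _ _ fun f => ?_; exact map_smul (ev f.1) c x

theorem Nm.none_of {o : Option ℕ} {f : Fn} (hf : Nm o f) : Nm none f := by
  cases o with
  | none => exact hf
  | some i => exact .forget i f hf

theorem Nm.abs_ev_le {o : Option ℕ} {f : Fn} (hf : Nm o f) (x : Vc) : |ev f x| ≤ ‖J x‖ :=
  (J x).norm_coe_le_norm ⟨f, hf.none_of⟩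

theorem norm_J_le {x : Vc} {C : ℝ} (h : ∀ f, Nm none f → |ev f x| ≤ C) : ‖J x‖ ≤ C :=
  (Z.norm_le ((abs_nonneg _).trans (h 0 .zero))).2 fun f => h f.1 f.2

theorem norm_J_le_l1 (x : Vc) : ‖J x‖ ≤ x.sum fun _ c => |c| :=
  norm_J_le fun _ hf => hf.abs_ev_le_l1 x

theorem exists_lt_ev {x : Vc} {c : ℝ} (h : c < ‖J x‖) : ∃ f, Nm none f ∧ c < ev f x := by
  by_contra! hc
  refine absurd (norm_J_le fun f hf => abs_le.2 ⟨?_, hc f hf⟩) (not_le.2 h)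
  have := hc _ hf.neg
  rw [ev_neg] at this
  linarith

theorem norm_J_cutv_le (a : ℕ) (x : Vc) : ‖J (cutv a x)‖ ≤ ‖J x‖ :=
  norm_J_le fun f hf => by rw [← ev_cut]; exact (hf.cut a).abs_ev_le x

theorem norm_J_T_le (x : Vc) : ‖J (T x)‖ ≤ ‖J x‖ :=
  norm_J_le fun f hf => by rw [← ev_Tstar]; exact (Nm.shift f hf).abs_ev_le x

theorem ev_single_one (n : ℕ) (x : Vc) : ev (Finsupp.single n 1) x = x n := by
  suffices h : ev (Finsupp.single n 1) = Finsupp.lapply n by rw [h]; rfl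
  refine ext_ev fun k => ?_
  by_cases hk : k = n
  · subst hk; simp [ev_single]
  · simp [ev_single, hk, Ne.symm hk]

theorem Nm.coord (n : ℕ) : Nm none (Finsupp.single n 1) := .atom n 1 (by simp)

theorem abs_coord_le_norm (n : ℕ) (x : Vc) : |x n| ≤ ‖J x‖ := by
  have := (Nm.coord n).abs_ev_le x
  rwa [ev_single_one] at this

theorem J_injective : Function.Injective J := by
  rw [injective_iff_map_eq_zero]
  intro x hx
  ext n
  have := abs_coord_le_norm n x
  rw [hx, norm_zero] at this
  simpa using this

theorem norm_J_pos {x : Vc} (hx : x ≠ 0) : 0 < ‖J x‖ :=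
  norm_pos_iff.2 fun h => hx (J_injective (by rw [h, map_zero]))

/-- The shift acting on bounded functions. -/
noncomputable def TZ : Z →L[ℝ] Z :=
  LinearMap.mkContinuous
    { toFun := fun w => BoundedContinuousFunction.compContinuous w
        ⟨fun f : K => (⟨Tstar f.1, .shift _ f.2⟩ : K), continuous_of_discreteTopology⟩
      map_add' := fun _ _ => rfl
      map_smul' := fun _ _ => rfl } 1 fun w => by
    rw [one_mul]
    exact (Z.norm_le (norm_nonneg _)).2 fun f => w.norm_coe_le_norm _

theorem TZ_J (x : Vc) : TZ (J x) = J (T x) := by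
  refine DFunLike.ext _ _ fun f => ?_
  exact ev_Tstar f.1 x

/-- The space, as a closed subspace of the bounded functions on the norming set. -/
noncomputable def X : Submodule ℝ Z := (LinearMap.range J).topologicalClosure

theorem J_mem (x : Vc) : J x ∈ X := Submodule.le_topologicalClosure _ ⟨x, rfl⟩

theorem exists_near {w : Z} (hw : w ∈ X) {ε : ℝ} (hε : 0 < ε) : ∃ x, ‖w - J x‖ < ε := by
  have : w ∈ closure (LinearMap.range J : Set Z) := hw
  obtain ⟨_, ⟨x, rfl⟩, hx⟩ := Metric.mem_closure_iff.1 this ε hε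
  exact ⟨x, by rwa [← dist_eq_norm]⟩

theorem TZ_mem {w : Z} (hw : w ∈ X) : TZ w ∈ X := by
  have h : Set.MapsTo TZ (LinearMap.range J : Set Z) (LinearMap.range J : Set Z) := by
    rintro _ ⟨x, rfl⟩
    exact ⟨T x, (TZ_J x).symm⟩
  exact h.closure TZ.continuous hw

open Classical in
/-- The value of a bounded function at a functional of the norming set. -/
noncomputable def zev (w : Z) (f : Fn) : ℝ := if h : Nm none f then w ⟨f, h⟩ else 0

theorem zev_of {f : Fn} (h : Nm none f) (w : Z) : zev w f = w ⟨f, h⟩ := dif_pos h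

theorem zev_J {f : Fn} (h : Nm none f) (x : Vc) : zev (J x) f = ev f x := zev_of h _

theorem abs_zev_le (w : Z) (f : Fn) : |zev w f| ≤ ‖w‖ := by
  unfold zev
  split_ifs with h
  · exact w.norm_coe_le_norm _
  · simp

theorem continuous_zev (f : Fn) : Continuous fun w => zev w f := by
  unfold zev
  split_ifs with h
  · exact continuous_eval_const (⟨f, h⟩ : K)
  · exact continuous_const

theorem zev_add (w w' : Z) (f : Fn) : zev (w + w') f = zev w f + zev w' f := by
  unfold zev
  split_ifs
  · rfl
  · simp

theorem zev_sub (w w' : Z) (f : Fn) : zev (w - w') f = zev w f - zev w' f := by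
  unfold zev
  split_ifs
  · rfl
  · simp

theorem zev_smul (c : ℝ) (w : Z) (f : Fn) : zev (c • w) f = c * zev w f := by
  unfold zev
  split_ifs
  · rfl
  · simp

theorem zev_sum {ι : Type*} (s : Finset ι) (w : ι → Z) (f : Fn) :
    zev (∑ i ∈ s, w i) f = ∑ i ∈ s, zev (w i) f := by
  classical
  induction s using Finset.induction_on with
  | empty =>
    have := zev_smul 0 0 f
    simpa using this
  | insert a s ha ih => rw [sum_insert ha, sum_insert ha, zev_add, ih]

theorem exists_lt_zev {w : Z} {c : ℝ} (h : c < ‖w‖) (hc : 0 ≤ c) :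
    ∃ f, Nm none f ∧ c < |zev w f| := by
  by_contra! hh
  refine absurd ((Z.norm_le hc).2 fun f => ?_) (not_le.2 h)
  have := hh f.1 f.2
  rwa [zev_of f.2] at this

theorem eq_zero_of_mem {w : Z} (hw : w ∈ X) {Φ : Z → ℝ} (hΦ : Continuous Φ)
    (h : ∀ x, Φ (J x) = 0) : Φ w = 0 := by
  have hc : IsClosed {w | Φ w = 0} := isClosed_eq hΦ continuous_const
  have : w ∈ closure (LinearMap.range J : Set Z) := hw
  refine closure_minimal (t := {w | Φ w = 0}) ?_ hc this
  rintro _ ⟨x, rfl⟩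
  exact h x

theorem zev_smul_sum {w : Z} (hw : w ∈ X) {c : ℚ} {d : ℕ} {f : ℕ → Fn}
    (hf : ∀ l < d, Nm none (f l)) (h : Nm none (c • ∑ l ∈ range d, f l)) :
    zev w (c • ∑ l ∈ range d, f l) = c * ∑ l ∈ range d, zev w (f l) := by
  have hc : Continuous fun w => zev w (c • ∑ l ∈ range d, f l)
      - c * ∑ l ∈ range d, zev w (f l) := by
    have := continuous_zev
    fun_prop
  refine sub_eq_zero.1 (eq_zero_of_mem hw hc fun x => ?_)
  rw [zev_J h, ev_shape, sum_congr rfl fun l hl => zev_J (hf l (mem_range.1 hl)) x, sub_self]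

theorem zev_conv {w : Z} (hw : w ∈ X) {t : ℚ} {f g : Fn} (h0 : 0 ≤ t) (h1 : t ≤ 1)
    (hf : Nm none f) (hg : Nm none g) :
    zev w (t • f + (1 - t) • g) = t * zev w f + (1 - t) * zev w g := by
  have hc : Continuous fun w => zev w (t • f + (1 - t) • g)
      - (t * zev w f + (1 - t) * zev w g) := by
    have := continuous_zev
    fun_prop
  refine sub_eq_zero.1 (eq_zero_of_mem hw hc fun x => ?_)
  rw [zev_J (.conv t f g h0 h1 hf hg), ev_add, ev_smul, ev_smul, zev_J hf, zev_J hg]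
  push_cast
  ring

theorem zev_neg {w : Z} (hw : w ∈ X) {f : Fn} (hf : Nm none f) : zev w (-f) = -zev w f := by
  have hc : Continuous fun w => zev w (-f) + zev w f := by
    have := continuous_zev
    fun_prop
  refine eq_neg_of_add_eq_zero_left (eq_zero_of_mem hw hc fun x => ?_)
  rw [zev_J hf.neg, ev_neg, zev_J hf]
  ring

/-- The size of the first `N` coordinates. -/
noncomputable def hd (N : ℕ) (w : Z) : ℝ := ∑ n ∈ range N, |zev w (Finsupp.single n 1)|

theorem abs_zev_sub_cut_le {w : Z} (hw : w ∈ X) {f : Fn} (hf : Nm none f) (N : ℕ) :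
    |zev w f - zev w (cut N f)| ≤ hd N w := by
  have hc : Continuous fun w => zev w f - zev w (cut N f)
      - ∑ n ∈ range N, f n * zev w (Finsupp.single n 1) := by
    have := continuous_zev
    fun_prop
  have h := eq_zero_of_mem hw hc fun x => by
    have e : f = cut N f + ∑ n ∈ range N, f n • Finsupp.single n (1 : ℚ) := by
      ext k
      simp only [cut_apply, Finsupp.add_apply, Finsupp.finsetSum_apply, Finsupp.smul_apply,
        Finsupp.single_apply, smul_eq_mul, mul_ite, mul_one, mul_zero, sum_ite_eq', mem_range]
      split_ifs <;> first | omega | simp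
    have e2 : ev f x = ev (cut N f) x + ∑ n ∈ range N, f n * ev (Finsupp.single n 1) x := by
      conv_lhs => rw [e]
      rw [ev_add, ev_sum]
      simp only [ev_smul]
    rw [zev_J hf, zev_J (hf.cut N), e2]
    simp only [zev_J (Nm.coord _)]
    ring
  rw [sub_eq_zero.1 h]
  refine (abs_sum_le_sum_abs _ _).trans (sum_le_sum fun n _ => ?_)
  rw [abs_mul]
  refine mul_le_of_le_one_left (abs_nonneg _) ?_
  exact_mod_cast hf.abs_coord_le n

theorem exists_tail {w : Z} (hw : w ∈ X) {ε : ℝ} (hε : 0 < ε) :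
    ∃ N, ∀ f, Nm none f → (∀ n, f n ≠ 0 → N ≤ n) → |zev w f| ≤ ε := by
  obtain ⟨x, hx⟩ := exists_near hw hε
  refine ⟨x.support.sup id + 1, fun f hf hN => ?_⟩
  have h0 : ev f x = 0 := by
    by_contra hne
    obtain ⟨n, h1, h2⟩ := exists_of_ev_ne_zero hne
    have h3 := hN n h1
    have h4 : n ≤ x.support.sup id := le_sup (f := id) (Finsupp.mem_support_iff.2 h2)
    omega
  have h1 := abs_zev_le (w - J x) f
  rw [zev_sub, zev_J hf, h0, sub_zero] at h1
  linarith

theorem exists_adaptive_seq {α : Type*} (P : List α → ℕ → ℕ → α → Prop)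
    (h : ∀ L N, ∃ a N', N < N' ∧ P L N N' a) (N₀ : ℕ) :
    ∃ (a : ℕ → α) (N : ℕ → ℕ), N 0 = N₀ ∧ StrictMono N ∧
      ∀ k, P ((List.range k).map a) (N k) (N (k + 1)) (a k) := by
  choose A B hB hP using h
  let st : ℕ → List α × ℕ := fun k =>
    Nat.rec ([], N₀) (fun _ q => (q.1 ++ [A q.1 q.2], B q.1 q.2)) k
  have hst : ∀ k, st (k + 1) = ((st k).1 ++ [A (st k).1 (st k).2], B (st k).1 (st k).2) :=
    fun _ => rfl
  have hL : ∀ k, (st k).1 = (List.range k).map fun r => A (st r).1 (st r).2 := by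
    intro k
    induction k with
    | zero => rfl
    | succ k ih => rw [hst, List.range_succ, List.map_append, ← ih]; rfl
  refine ⟨fun k => A (st k).1 (st k).2, fun k => (st k).2, rfl,
    strictMono_nat_of_lt_succ fun k => hB _ _, fun k => ?_⟩
  rw [← hL k]
  exact hP _ _

theorem exists_block_seq {α : Type*} (P : ℕ → ℕ → ℕ → α → Prop)
    (h : ∀ k N, ∃ a N', N < N' ∧ P k N N' a) (N₀ : ℕ) :
    ∃ (a : ℕ → α) (N : ℕ → ℕ), N 0 = N₀ ∧ StrictMono N ∧
      ∀ k, P k (N k) (N (k + 1)) (a k) := by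
  obtain ⟨a, N, h0, hN, hP⟩ := exists_adaptive_seq (fun L => P L.length) (fun L => h L.length) N₀
  exact ⟨a, N, h0, hN, fun k => by simpa using hP k⟩

/-- The vector has no coordinates before `N`. -/
def From (N : ℕ) (x : Vc) : Prop := ∀ n < N, x n = 0

theorem From.le {N : ℕ} {x : Vc} (h : From N x) {n : ℕ} (hn : x n ≠ 0) : N ≤ n := by
  by_contra! hlt
  exact hn (h n hlt)

theorem From.mono {N M : ℕ} {x : Vc} (h : From N x) (hM : M ≤ N) : From M x :=
  fun n hn => h n (by omega)

theorem exists_bound {R : Type*} [Zero R] (x : ℕ →₀ R) : ∃ M, ∀ n, x n ≠ 0 → n < M := by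
  refine ⟨x.support.sup id + 1, fun n hn => ?_⟩
  have : n ≤ x.support.sup id := le_sup (f := id) (Finsupp.mem_support_iff.2 hn)
  omega

theorem bs_of_intervals {x : ℕ → Vc} {N : ℕ → ℕ} (hN : Monotone N)
    (h : ∀ k n, x k n ≠ 0 → N k ≤ n ∧ n < N (k + 1)) : Bs x := by
  intro n l l' hl _ a b ha hb
  have h1 := (h l a ha).2
  have h2 := (h l' b hb).1
  have h3 := hN (show l + 1 ≤ l' by omega)
  omega

/-- Subspaces containing vectors supported arbitrarily far out. -/
def Rich (V : Submodule ℝ Vc) : Prop := ∀ N, ∃ z ∈ V, z ≠ 0 ∧ From N z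

theorem weighted_sum_le {x : ℕ → Vc} (hx : Bs x) (h1 : ∀ k, ‖J (x k)‖ ≤ 1) {i : ℕ} {f : Fn}
    (hf : Nm (some i) f) (F : Finset ℕ) :
    |ev f (∑ k ∈ F, x k)| ≤ F.card / wm i + wn i := by
  have hb : ∀ {o : Option ℕ} {h : Fn}, Nm o h → ∀ G : Finset ℕ,
      |∑ k ∈ G, ev h (x k)| ≤ G.card := by
    intro o h hh G
    refine (abs_sum_le_sum_abs _ _).trans ((sum_le_sum fun k _ =>
      (hh.abs_ev_le (x k)).trans (h1 k)).trans ?_)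
    simp
  have hm := wm_cast_ge i
  obtain ⟨d, hd, g, c, hg, hblk, hc, rfl⟩ := hf.shape
  obtain ⟨G, hGF, Fl, hFl, hGd, hcard, hsum⟩ := staircase_split d F
    (fun l k => ev (g l) (x k))
    (fun l k l' k' hl hl' _ _ h h' => ev_staircase hblk hx l k l' k' hl hl' h h')
  have e : ev (c • ∑ l ∈ range d, g l) (∑ k ∈ F, x k)
      = c * ∑ l ∈ range d, ∑ k ∈ Fl l, ev (g l) (x k)
        + ∑ k ∈ G, ev (c • ∑ l ∈ range d, g l) (x k) := by
    simp only [ev_shape, map_sum] at hsum ⊢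
    rw [← mul_sum, sum_comm, hsum, mul_add, add_comm, mul_sum]
    simp only [mul_sum]
  rw [e]
  refine (abs_add_le _ _).trans (add_le_add ?_ ?_)
  · rw [abs_mul]
    have h2 : |∑ l ∈ range d, ∑ k ∈ Fl l, ev (g l) (x k)| ≤ F.card := by
      refine (abs_sum_le_sum_abs _ _).trans ((sum_le_sum fun l hl =>
        hb (hg l (mem_range.1 hl)) (Fl l)).trans ?_)
      exact_mod_cast hcard
    calc |(c : ℝ)| * _ ≤ 1 / wm i * F.card :=
          mul_le_mul (abs_coef_le hc) h2 (abs_nonneg _) (by positivity)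
      _ = _ := by ring
  · refine (hb hf G).trans ?_
    exact_mod_cast hGd.trans hd

/-- Iterated block sums. -/
noncomputable def tree (M : ℕ) (b : ℕ → Vc) : ℕ → ℕ → Vc
  | 0, p => b p
  | t + 1, p => ∑ s ∈ range M, tree M b t (p * M + s)

theorem tree_mem {V : Submodule ℝ Vc} {M : ℕ} {b : ℕ → Vc} (h : ∀ k, b k ∈ V) (t p : ℕ) :
    tree M b t p ∈ V := by
  induction t generalizing p with
  | zero => exact h p
  | succ t ih => exact Submodule.sum_mem _ fun s _ => ih _

theorem tree_supp {M : ℕ} {b : ℕ → Vc} {N : ℕ → ℕ} (hN : Monotone N)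
    (h : ∀ k n, b k n ≠ 0 → N k ≤ n ∧ n < N (k + 1)) (t p n : ℕ) (hn : tree M b t p n ≠ 0) :
    N (p * M ^ t) ≤ n ∧ n < N ((p + 1) * M ^ t) := by
  induction t generalizing p with
  | zero => simpa using h p n hn
  | succ t ih =>
    rw [tree, Finsupp.finsetSum_apply] at hn
    obtain ⟨s, hs, hne⟩ := exists_ne_zero_of_sum_ne_zero hn
    obtain ⟨h1, h2⟩ := ih _ hne
    have hs := mem_range.1 hs
    have e1 : p * M ^ (t + 1) ≤ (p * M + s) * M ^ t := by
      rw [pow_succ, mul_comm (M ^ t), ← mul_assoc]; gcongr; omega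
    have e2 : (p * M + s + 1) * M ^ t ≤ (p + 1) * M ^ (t + 1) := by
      rw [pow_succ, mul_comm (M ^ t), ← mul_assoc]; gcongr; nlinarith
    exact ⟨(hN e1).trans h1, h2.trans_le (hN e2)⟩

theorem tree_lower {M : ℕ} {b : ℕ → Vc} {g : Fn} {n : ℕ} (h : ∀ k < n, 1 / 2 ≤ ev g (b k))
    (t p : ℕ) (hp : (p + 1) * M ^ t ≤ n) : (M : ℝ) ^ t / 2 ≤ ev g (tree M b t p) := by
  induction t generalizing p with
  | zero => simpa [tree] using h p (by simpa using hp)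
  | succ t ih =>
    rw [tree, map_sum]
    have : ∀ s ∈ range M, (M : ℝ) ^ t / 2 ≤ ev g (tree M b t (p * M + s)) := by
      intro s hs
      have hs := mem_range.1 hs
      refine ih _ (le_trans ?_ hp)
      rw [pow_succ, mul_comm (M ^ t), ← mul_assoc]; gcongr; nlinarith
    have h2 := sum_le_sum this
    rw [sum_const, card_range, nsmul_eq_mul] at h2
    calc (M : ℝ) ^ (t + 1) / 2 = M * (M ^ t / 2) := by ring
      _ ≤ _ := h2

theorem Rich.exists_biorthogonal {V : Submodule ℝ Vc} (hV : Rich V) (N₀ : ℕ) :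
    ∃ (b : ℕ → Vc) (g : ℕ → Fn) (N : ℕ → ℕ), N 0 = N₀ ∧ Monotone N ∧ (∀ k, b k ∈ V) ∧
      (∀ k, ‖J (b k)‖ ≤ 1) ∧ (∀ k, Nm none (g k)) ∧ (∀ k, 1 / 2 ≤ ev (g k) (b k)) ∧
      (∀ k n, b k n ≠ 0 → N k ≤ n ∧ n < N (k + 1)) ∧
      (∀ k n, g k n ≠ 0 → N k ≤ n ∧ n < N (k + 1)) := by
  obtain ⟨a, N, h0, hN, h⟩ := exists_block_seq (α := Vc × Fn)
    (fun _ N N' q => q.1 ∈ V ∧ ‖J q.1‖ ≤ 1 ∧ Nm none q.2 ∧ 1 / 2 ≤ ev q.2 q.1 ∧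
      (∀ n, q.1 n ≠ 0 → N ≤ n ∧ n < N') ∧ (∀ n, q.2 n ≠ 0 → N ≤ n ∧ n < N')) (by
    intro _ N
    obtain ⟨z, hzV, hz0, hzN⟩ := hV N
    have hpos := norm_J_pos hz0
    set y : Vc := ‖J z‖⁻¹ • z with hy
    have hy1 : ‖J y‖ = 1 := by
      rw [hy, map_smul, norm_smul, norm_inv, norm_norm, inv_mul_cancel₀ hpos.ne']
    have hyN : From N y := fun n hn => by rw [hy, Finsupp.smul_apply, hzN n hn, smul_zero]
    obtain ⟨f, hf, hfy⟩ := exists_lt_ev (x := y) (c := 1 / 2) (by rw [hy1]; norm_num)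
    obtain ⟨M₁, hM₁⟩ := exists_bound y
    obtain ⟨M₂, hM₂⟩ := exists_bound f
    have hcv : cutv N y = y := by
      ext n
      rw [cutv_apply]
      split_ifs with h
      · rfl
      · exact (hyN n (by omega)).symm
    refine ⟨(y, cut N f), N + M₁ + M₂ + 1, by omega, V.smul_mem _ hzV, hy1.le, hf.cut N, ?_,
      fun n hn => ⟨hyN.le hn, by have := hM₁ n hn; omega⟩, fun n hn => ?_⟩
    · rw [ev_cut, hcv]; exact hfy.le
    · simp only [cut_apply, ne_eq, ite_eq_right_iff, Classical.not_imp] at hn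
      exact ⟨hn.1, by have := hM₂ n hn.2; omega⟩) N₀
  exact ⟨fun k => (a k).1, fun k => (a k).2, N, h0, hN.monotone, fun k => (h k).1,
    fun k => (h k).2.1, fun k => (h k).2.2.1, fun k => (h k).2.2.2.1, fun k => (h k).2.2.2.2.1,
    fun k => (h k).2.2.2.2.2⟩

theorem Rich.exists_average {V : Submodule ℝ Vc} (hV : Rich V) (w N₀ : ℕ) :
    ∃ x ∈ V, From N₀ x ∧ 1 / 2 ≤ ‖J x‖ ∧ ‖J x‖ ≤ 1 ∧
      ∀ i < w, ∀ f, Nm (some i) f → |ev f x| ≤ 2 / wm i := by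
  by_contra hcon
  obtain ⟨b, g, N, hN0, hN, hbV, hb1, hg, hgb, hbs, hgs⟩ := hV.exists_biorthogonal N₀
  set a := wn w * wm w with ha
  set M := 2 ^ a with hM
  have hMa : wn w * wm w ≤ M := Nat.lt_two_pow_self.le
  have hM0 : (0 : ℝ) < M := by exact_mod_cast (by positivity : 0 < 2 ^ a)
  obtain ⟨j, t, hj, hjt, hjm⟩ := exists_length a
  have small : ∀ z : ℕ → Vc, Bs z → (∀ s, z s ∈ V) → (∀ s, From N₀ (z s)) →
      (∀ s, ‖J (z s)‖ ≤ 1) → ‖J (∑ s ∈ range M, z s)‖ ≤ M / 2 := by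
    intro z hz hzV hzN hz1
    by_contra! hlt
    refine hcon ⟨(M : ℝ)⁻¹ • ∑ s ∈ range M, z s, V.smul_mem _ (V.sum_mem fun s _ => hzV s),
      fun n hn => ?_, ?_, ?_, fun i hi f hf => ?_⟩
    · rw [Finsupp.smul_apply, Finsupp.finsetSum_apply, sum_eq_zero fun s _ => hzN s n hn,
        smul_zero]
    · rw [map_smul, norm_smul, norm_inv, Real.norm_natCast, inv_mul_eq_div, le_div_iff₀ hM0]
      linarith
    · rw [map_smul, norm_smul, norm_inv, Real.norm_natCast, inv_mul_eq_div, div_le_one hM0,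
        map_sum]
      refine (norm_sum_le _ _).trans ((sum_le_sum fun s _ => hz1 s).trans ?_)
      simp
    · rw [map_smul, smul_eq_mul, abs_mul, abs_of_nonneg (by positivity), inv_mul_eq_div,
        div_le_iff₀ hM0]
      refine (weighted_sum_le hz hz1 hf _).trans ?_
      rw [card_range]
      have hm := wm_cast_ge i
      have h1 : wn i * wm i ≤ M :=
        le_trans (Nat.mul_le_mul (wn_mono hi.le) (wm_strictMono.monotone hi.le)) hMa
      have h2 : (wn i : ℝ) * wm i ≤ M := by exact_mod_cast h1
      have h3 : (wn i : ℝ) ≤ M / wm i := by rw [le_div_iff₀ (by linarith)]; exact h2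
      calc (M : ℝ) / wm i + wn i ≤ M / wm i + M / wm i := by gcongr
        _ = 2 / wm i * M := by ring
  have hup : ∀ t p, ‖J (tree M b t p)‖ ≤ (M / 2 : ℝ) ^ t := by
    intro t
    induction t with
    | zero => intro p; simpa [tree] using hb1 p
    | succ t ih =>
      intro p
      have hr : (0 : ℝ) < (M / 2 : ℝ) ^ t := by positivity
      have hsupp : ∀ s n, tree M b t (p * M + s) n ≠ 0 →
          N ((p * M + s) * M ^ t) ≤ n ∧ n < N ((p * M + s + 1) * M ^ t) :=
        fun s n hn => tree_supp hN hbs t _ n hn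
      have h1 := small (fun s => ((M / 2 : ℝ) ^ t)⁻¹ • tree M b t (p * M + s))
        (bs_of_intervals (N := fun s => N ((p * M + s) * M ^ t)) (fun s s' h => hN (by gcongr))
          (fun s n hn => hsupp s n (by intro h0; exact hn (by simp [h0]))))
        (fun s => V.smul_mem _ (tree_mem hbV t _))
        (fun s n hn => by
          by_contra hne
          have := (hsupp s n (by intro h0; exact hne (by simp [h0]))).1
          have := hN (Nat.zero_le ((p * M + s) * M ^ t))
          omega)
        (fun s => by
          rw [map_smul, norm_smul, norm_inv, Real.norm_of_nonneg hr.le, inv_mul_le_one₀ hr]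
          exact ih _)
      rw [← smul_sum, map_smul, norm_smul, norm_inv, Real.norm_of_nonneg hr.le,
        inv_mul_le_iff₀ hr] at h1
      rw [tree, pow_succ]
      exact h1
  have hm := wm_cast_ge j
  have hG : Nm (some j) ((1 / wm j : ℚ) • ∑ r ∈ range (wn j), g r) := by
    refine .free j (wn j) g _ hj le_rfl ?_ (fun l _ => hg l) ?_
    · have : (8 : ℚ) ≤ wm j := by exact_mod_cast wm_ge j
      rw [abs_of_nonneg (by positivity), one_div, inv_mul_cancel₀ (by linarith)]
    · intro l l' hl _ p q hp hq
      have h1 := (hgs l p hp).2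
      have h2 := (hgs l' q hq).1
      have h3 := hN (show l + 1 ≤ l' by omega)
      omega
  have hlow : ∀ k < wn j, 1 / 2 ≤ ev (∑ r ∈ range (wn j), g r) (b k) := by
    intro k hk
    rw [ev_sum, sum_eq_single k]
    · exact hgb k
    · intro r _ hne
      by_contra h0
      obtain ⟨n, h1, h2⟩ := exists_of_ev_ne_zero h0
      have h3 := hgs r n h1
      have h4 := hbs k n h2
      rcases lt_or_gt_of_ne hne with h | h
      · have := hN (show r + 1 ≤ k by omega); omega
      · have := hN (show k + 1 ≤ r by omega); omega
    · intro h; exact absurd (mem_range.2 hk) h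
  have h1 := tree_lower (M := M) hlow t 0 (by simpa using hjt)
  have h2 := (hG.abs_ev_le (tree M b t 0)).trans (hup t 0)
  rw [ev_smul, abs_mul] at h2
  push_cast at h2
  rw [abs_of_nonneg (by positivity), one_div, inv_mul_le_iff₀ (by linarith)] at h2
  have h3 := h1.trans ((le_abs_self _).trans h2)
  rw [div_pow] at h3
  have h4 : (2 * wm j : ℝ) < 2 ^ t := by exact_mod_cast hjm
  have h5 : (0 : ℝ) < (M : ℝ) ^ t := by positivity
  have h6 : (M : ℝ) ^ t * 2 ^ t ≤ 2 * wm j * M ^ t := by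
    have : (M : ℝ) ^ t / 2 * 2 ^ t ≤ wm j * (M ^ t / 2 ^ t) * 2 ^ t := by gcongr
    have e : (wm j : ℝ) * (M ^ t / 2 ^ t) * 2 ^ t = wm j * M ^ t := by field_simp
    rw [e] at this
    linarith
  nlinarith

theorem sum_half_pow_le (F : Finset ℕ) : ∑ k ∈ F, (1 / 2 : ℝ) ^ (k + 1) ≤ 1 := by
  have h1 : HasSum (fun k : ℕ => (1 / 2 : ℝ) ^ (k + 1)) 1 := by
    have := (hasSum_geometric_two).mul_left (1 / 2 : ℝ)
    simpa [pow_succ, mul_comm] using this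
  exact sum_le_hasSum F (fun k _ => by positivity) h1

theorem Rich.exists_small {V : Submodule ℝ Vc} {ρ : Vc → ℝ}
    (hρa : ∀ x y, ρ (x + y) ≤ ρ x + ρ y) (hρs : ∀ (c : ℝ) x, ρ (c • x) = |c| * ρ x)
    (h : ∀ c > 0, ∀ N, ∃ z ∈ V, z ≠ 0 ∧ From N z ∧ ρ z ≤ c * ‖J z‖) {ε : ℝ} (hε : 0 < ε) :
    ∃ V' ≤ V, Rich V' ∧ ∀ z ∈ V', ρ z ≤ ε * ‖J z‖ := by
  obtain ⟨b, N, h0, hN, hb⟩ := exists_block_seq (α := Vc)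
    (fun k N N' b => b ∈ V ∧ b ≠ 0 ∧ ρ b ≤ ε / 2 * (1 / 2) ^ (k + 1) * ‖J b‖ ∧
      ∀ n, b n ≠ 0 → N ≤ n ∧ n < N') (by
    intro k N
    obtain ⟨z, hzV, hz0, hzN, hz⟩ := h (ε / 2 * (1 / 2) ^ (k + 1)) (by positivity) N
    obtain ⟨M, hM⟩ := exists_bound z
    exact ⟨z, N + M + 1, by omega, hzV, hz0, hz,
      fun n hn => ⟨hzN.le hn, by have := hM n hn; omega⟩⟩) 0
  have hρ0 : ρ 0 = 0 := by simpa using hρs 0 0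
  refine ⟨Submodule.span ℝ (Set.range b), Submodule.span_le.2 (by
    rintro _ ⟨k, rfl⟩; exact (hb k).1), fun n => ?_, fun z hz => ?_⟩
  · refine ⟨b n, Submodule.subset_span ⟨n, rfl⟩, (hb n).2.1, fun p hp => ?_⟩
    by_contra hne
    have h1 := ((hb n).2.2.2 p hne).1
    have h2 := hN.le_apply (x := n)
    omega
  · obtain ⟨a, rfl⟩ := Finsupp.mem_span_range_iff_exists_finsupp.1 hz
    set z := a.sum fun i c => c • b i with hzdef
    have hcut : ∀ k, cutv (N k) z - cutv (N (k + 1)) z = a k • b k := by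
      intro k
      have e : ∀ i, cutv (N k) (b i) - cutv (N (k + 1)) (b i) = if i = k then b k else 0 := by
        intro i
        ext n
        rw [Finsupp.sub_apply, cutv_apply, cutv_apply]
        by_cases hn : b i n = 0
        · by_cases hik : i = k
          · subst hik
            split_ifs <;> simp [hn]
          · simp [hn, hik]
        · have h1 := (hb i).2.2.2 n hn
          rcases lt_trichotomy i k with h | h | h
          · have := hN.monotone (show i + 1 ≤ k by omega)
            have := hN.monotone (show k ≤ k + 1 by omega)
            rw [if_neg (by omega), if_neg (by omega), if_neg (by omega)]; simp
          · subst h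
            rw [if_pos (by omega), if_neg (by omega), if_pos rfl]; simp
          · have := hN.monotone (show k + 1 ≤ i by omega)
            have := hN.monotone (show k ≤ k + 1 by omega)
            rw [if_pos (by omega), if_pos (by omega), if_neg (by omega)]; simp
      rw [hzdef, Finsupp.sum, map_sum, map_sum, ← sum_sub_distrib]
      simp only [map_smul, ← smul_sub, e, smul_ite, smul_zero]
      rw [sum_ite_eq']
      split_ifs with hk
      · rfl
      · rw [Finsupp.notMem_support_iff.1 hk, zero_smul]
    have hak : ∀ k, |a k| * ‖J (b k)‖ ≤ 2 * ‖J z‖ := by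
      intro k
      have h1 : ‖J (a k • b k)‖ ≤ ‖J z‖ + ‖J z‖ := by
        rw [← hcut, map_sub]
        exact (norm_sub_le _ _).trans (add_le_add (norm_J_cutv_le _ _) (norm_J_cutv_le _ _))
      rw [map_smul, norm_smul, Real.norm_eq_abs] at h1
      linarith
    have hsub : ∀ s : Finset ℕ, ρ (∑ k ∈ s, a k • b k) ≤ ∑ k ∈ s, ρ (a k • b k) := by
      intro s
      classical
      induction s using Finset.induction_on with
      | empty => simp [hρ0]
      | insert i s hi ih =>
        rw [sum_insert hi, sum_insert hi]
        exact (hρa _ _).trans (by linarith)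
    have hterm : ∀ k ∈ a.support, ρ (a k • b k) ≤ ε * ‖J z‖ * (1 / 2) ^ (k + 1) := by
      intro k _
      rw [hρs]
      calc |a k| * ρ (b k) ≤ |a k| * (ε / 2 * (1 / 2) ^ (k + 1) * ‖J (b k)‖) := by
            gcongr; exact (hb k).2.2.1
        _ = ε / 2 * (1 / 2) ^ (k + 1) * (|a k| * ‖J (b k)‖) := by ring
        _ ≤ ε / 2 * (1 / 2) ^ (k + 1) * (2 * ‖J z‖) := by exact mul_le_mul_of_nonneg_left (hak k) (by positivity)
        _ = _ := by ring
    calc ρ z ≤ ∑ k ∈ a.support, ρ (a k • b k) := hsub _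
      _ ≤ ∑ k ∈ a.support, ε * ‖J z‖ * (1 / 2) ^ (k + 1) := sum_le_sum hterm
      _ = ε * ‖J z‖ * ∑ k ∈ a.support, (1 / 2) ^ (k + 1) := by rw [mul_sum]
      _ ≤ ε * ‖J z‖ * 1 := by gcongr; exact sum_half_pow_le _
      _ = _ := mul_one _

/-- On suitable rich subspaces the shift is as small as desired. -/
def TSmall (V : Submodule ℝ Vc) : Prop :=
  ∀ ε > 0, ∃ V' ≤ V, Rich V' ∧ ∀ z ∈ V', ‖J (T z)‖ ≤ ε * ‖J z‖

theorem exists_RIS (V : ℕ → Submodule ℝ Vc) (hT : ∀ k, TSmall (V k)) :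
    ∃ x : ℕ → Vc, RIS 2 x ∧ ∀ k, x k ∈ V k ∧ From k (x k) ∧ 1 / 2 ≤ ‖J (x k)‖ := by
  obtain ⟨x, N, h0, hN, hx⟩ := exists_block_seq (α := Vc)
    (fun k N N' x => x ∈ V k ∧ (∀ n, x n ≠ 0 → N ≤ n ∧ n < N') ∧ 1 / 2 ≤ ‖J x‖ ∧ ‖J x‖ ≤ 1 ∧
      (∀ i < N, ∀ f, Nm (some i) f → |ev f x| ≤ 2 / wm i) ∧
      ‖J (T x)‖ ≤ (1 / 2) ^ (k + 1) ∧
      (x.sum fun _ c => |c|) ≤ (1 / 2) ^ (k + 1) * wm N') (by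
    intro k N
    obtain ⟨V', hV', hrich, hsm⟩ := hT k ((1 / 2) ^ (k + 1)) (by positivity)
    obtain ⟨x, hxV, hxN, hlow, hup, hw⟩ := hrich.exists_average N N
    obtain ⟨M, hM⟩ := exists_bound x
    obtain ⟨R, hR⟩ := exists_nat_ge ((x.sum fun _ c => |c|) / (1 / 2) ^ (k + 1))
    refine ⟨x, N + M + R + 1, by omega, hV' hxV,
      fun n hn => ⟨hxN.le hn, by have := hM n hn; omega⟩, hlow, hup, hw, ?_, ?_⟩
    · refine (hsm x hxV).trans (mul_le_of_le_one_right (by positivity) hup)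
    · rw [div_le_iff₀ (by positivity)] at hR
      have h1 : R ≤ wm (N + M + R + 1) := le_trans (by omega) (wm_strictMono.le_apply)
      have h2 : (R : ℝ) ≤ wm (N + M + R + 1) := by exact_mod_cast h1
      rw [mul_comm]
      exact hR.trans (by gcongr)) 0
  refine ⟨x, ⟨bs_of_intervals hN.monotone fun k => (hx k).2.1,
    fun f hf k => (hf.abs_ev_le _).trans ((hx k).2.2.2.1.trans (by norm_num)),
    fun i f hf F => ?_, fun f hf F => ?_⟩, fun k => ⟨(hx k).1, fun n hn => ?_, (hx k).2.2.1⟩⟩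
  · have hm := wm_cast_ge i
    have key : ∀ k ∈ F, |ev f (x k)| ≤ 2 / wm i + (1 / 2) ^ (k + 1)
        + if N k ≤ i ∧ i < N (k + 1) then 1 else 0 := by
      intro k _
      obtain ⟨-, -, -, h1, h2, -, h3⟩ := hx k
      have p1 : (0 : ℝ) ≤ 2 / wm i := by positivity
      have p2 : (0 : ℝ) ≤ (1 / 2) ^ (k + 1) := by positivity
      by_cases hi : N k ≤ i
      · by_cases hi' : i < N (k + 1)
        · rw [if_pos ⟨hi, hi'⟩]
          have := (hf.abs_ev_le (x k)).trans h1
          linarith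
        · rw [if_neg (by tauto)]
          have h4 : |ev f (x k)| ≤ (x k).sum (fun _ c => |c|) / wm i := by
            rw [le_div_iff₀ (by linarith), ev_apply, Finsupp.sum, Finsupp.sum]
            refine (mul_le_mul_of_nonneg_right (abs_sum_le_sum_abs _ _) (by linarith)).trans ?_
            rw [sum_mul]
            refine sum_le_sum fun n _ => ?_
            rw [abs_mul, mul_assoc]
            refine mul_le_of_le_one_right (abs_nonneg _) ?_
            exact_mod_cast hf.abs_coord_mul_le n
          have h5 : (wm (N (k + 1)) : ℝ) ≤ wm i := by
            exact_mod_cast wm_strictMono.monotone (not_lt.1 hi')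
          have h6 : (x k).sum (fun _ c => |c|) / wm i ≤ (1 / 2) ^ (k + 1) := by
            rw [div_le_iff₀ (by linarith)]
            exact h3.trans (by gcongr)
          linarith
      · rw [if_neg (by tauto)]
        have := h2 i (by omega) f hf
        linarith
    have b := sum_indicator_le (F := F) (P := fun k => N k ≤ i ∧ i < N (k + 1)) zero_le_one (by
      rintro k k' hlt ⟨h1, h2⟩ ⟨h1', h2'⟩
      have := hN.monotone (show k + 1 ≤ k' by omega)
      omega)
    refine (sum_le_sum key).trans ?_
    rw [sum_add_distrib, sum_add_distrib, sum_const, nsmul_eq_mul]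
    have := sum_half_pow_le F
    have e : (F.card : ℝ) * (2 / wm i) = 2 * (F.card / wm i) := by ring
    rw [e]
    linarith
  · refine (sum_le_sum fun k _ => (hf.abs_ev_le _).trans (hx k).2.2.2.2.2.1).trans ?_
    exact (sum_half_pow_le F).trans (by norm_num)
  · by_contra hne
    have h1 := ((hx k).2.1 n hne).1
    have h2 := hN.le_apply (x := k)
    omega

theorem hd_mono {N N' : ℕ} (h : N ≤ N') (w : Z) : hd N w ≤ hd N' w :=
  sum_le_sum_of_subset_of_nonneg (range_mono h) fun _ _ _ => abs_nonneg _

theorem hd_add_le (N : ℕ) (w w' : Z) : hd N (w + w') ≤ hd N w + hd N w' := by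
  rw [hd, hd, hd, ← sum_add_distrib]
  exact sum_le_sum fun n _ => by rw [zev_add]; exact abs_add_le _ _

theorem hd_smul (N : ℕ) (c : ℝ) (w : Z) : hd N (c • w) = |c| * hd N w := by
  rw [hd, hd, mul_sum]
  exact sum_congr rfl fun n _ => by rw [zev_smul, abs_mul]

theorem hd_zero (N : ℕ) : hd N 0 = 0 := by simpa using hd_smul N 0 0

theorem hd_sum_le (N : ℕ) (s : Finset ℕ) (w : ℕ → Z) : hd N (∑ k ∈ s, w k) ≤ ∑ k ∈ s, hd N (w k) := by
  classical
  induction s using Finset.induction_on with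
  | empty => simp [hd_zero]
  | insert i s hi ih =>
    rw [sum_insert hi, sum_insert hi]
    exact (hd_add_le _ _ _).trans (by linarith)

theorem exists_wm_gt (B : ℝ) : ∃ j, Odd j ∧ B < wm j := by
  obtain ⟨n, hn⟩ := exists_nat_gt B
  refine ⟨2 * n + 1, ⟨n, rfl⟩, hn.trans_le ?_⟩
  have h1 : n ≤ wm (2 * n + 1) := le_trans (by omega) wm_strictMono.le_apply
  exact_mod_cast h1

/-- A vector far from the line through `J x` is normed by a functional almost vanishing at `x`. -/
theorem exists_separating {w : Z} (hw : w ∈ X) {x : Vc} {δ : ℝ} (hδ : 0 < δ)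
    (h : ∀ lam : ℝ, δ ≤ ‖w - lam • J x‖) {ε : ℝ} (hε : 0 < ε) :
    ∃ f, Nm none f ∧ |ev f x| ≤ ε ∧ δ / 2 ≤ zev w f := by
  have hval : ∀ {f : Fn}, Nm none f → ∀ lam : ℝ, zev (w - lam • J x) f = zev w f - lam * ev f x := by
    intro f hf lam
    rw [zev_sub, zev_smul, zev_J hf]
  have hmem : ∀ lam : ℝ, w - lam • J x ∈ X := fun lam =>
    X.sub_mem hw (X.smul_mem _ (J_mem x))
  by_cases hx : x = 0
  · subst hx
    obtain ⟨f, hf, h1⟩ := exists_lt_zev (w := w) (c := δ / 2) (by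
      have := h 0
      rw [zero_smul, sub_zero] at this
      linarith) (by linarith)
    rcases le_total 0 (zev w f) with h0 | h0
    · rw [abs_of_nonneg h0] at h1
      exact ⟨f, hf, by simpa using hε.le, h1.le⟩
    · rw [abs_of_nonpos h0] at h1
      exact ⟨-f, hf.neg, by simpa using hε.le, by rw [zev_neg hw hf]; exact h1.le⟩
  obtain ⟨e, he, hepos⟩ := exists_lt_ev (norm_J_pos hx)
  have hopen : ∀ Q : Fn → Prop, IsOpen {lam : ℝ | ∃ f, Nm none f ∧ Q f ∧
      3 * δ / 4 < zev w f - lam * ev f x} := by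
    intro Q
    have : {lam : ℝ | ∃ f, Nm none f ∧ Q f ∧ 3 * δ / 4 < zev w f - lam * ev f x} =
        ⋃ f : {f // Nm none f ∧ Q f}, {lam : ℝ | 3 * δ / 4 < zev w f - lam * ev f.1 x} := by
      ext lam
      simp only [Set.mem_ofPred_eq, Set.mem_iUnion, Subtype.exists, exists_prop]
      exact exists_congr fun f => by tauto
    rw [this]
    refine isOpen_iUnion fun f => isOpen_lt continuous_const (by fun_prop)
  obtain ⟨lam, -, ⟨f, hf, hf0, hfl⟩, ⟨g, hg, hg0, hgl⟩⟩ :=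
    (isPreconnected_univ (α := ℝ)) _ _ (hopen fun f => 0 ≤ ev f x) (hopen fun f => ev f x ≤ 0)
      (by
        intro lam _
        obtain ⟨f, hf, h1⟩ := exists_lt_zev (w := w - lam • J x) (c := 3 * δ / 4)
          (by have := h lam; linarith) (by linarith)
        have key : ∀ f, Nm none f → 3 * δ / 4 < zev (w - lam • J x) f →
            lam ∈ {lam : ℝ | ∃ f, Nm none f ∧ 0 ≤ ev f x ∧ 3 * δ / 4 < zev w f - lam * ev f x} ∪
              {lam : ℝ | ∃ f, Nm none f ∧ ev f x ≤ 0 ∧ 3 * δ / 4 < zev w f - lam * ev f x} := by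
          intro f hf hlt
          rw [hval hf] at hlt
          rcases le_total 0 (ev f x) with h0 | h0
          · exact Or.inl ⟨f, hf, h0, hlt⟩
          · exact Or.inr ⟨f, hf, h0, hlt⟩
        rcases le_total 0 (zev (w - lam • J x) f) with h0 | h0
        · rw [abs_of_nonneg h0] at h1
          exact key f hf h1
        · rw [abs_of_nonpos h0, ← zev_neg (hmem lam) hf] at h1
          exact key (-f) hf.neg h1)
      (by
        refine ⟨(zev w e - δ) / ev e x, trivial, e, he, hepos.le, ?_⟩
        rw [div_mul_cancel₀ _ hepos.ne']
        linarith)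
      (by
        refine ⟨(zev w (-e) - δ) / ev (-e) x, trivial, -e, he.neg, ?_, ?_⟩
        · rw [ev_neg]; linarith
        · rw [div_mul_cancel₀ _ (by rw [ev_neg]; linarith)]
          linarith)
  set a := ev f x with ha
  set b := ev g x with hb
  set τ := min ε (δ / (4 * (|lam| + 1))) with hτ
  have hτ0 : 0 < τ := by positivity
  have hτl : |lam| * τ ≤ δ / 4 := by
    calc |lam| * τ ≤ (|lam| + 1) * (δ / (4 * (|lam| + 1))) := by
          gcongr
          · linarith
          · exact min_le_right _ _
      _ = δ / 4 := by field_simp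
  obtain ⟨t, ht0, ht1, ht⟩ : ∃ t : ℚ, 0 ≤ t ∧ t ≤ 1 ∧ |(t : ℝ) * a + (1 - t) * b| ≤ τ := by
    rcases hf0.eq_or_lt with h0 | h0
    · exact ⟨1, zero_le_one, le_rfl, by simp [← h0, hτ0.le]⟩
    · have hab : 0 < a - b := by linarith
      set s := -b / (a - b) with hs
      have hs0 : 0 ≤ s := div_nonneg (by linarith) hab.le
      have hs1 : s < 1 := by rw [hs, div_lt_one hab]; linarith
      obtain ⟨t, h1, h2⟩ := exists_rat_btwn (show s < min 1 (s + τ / (a - b)) from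
        lt_min hs1 (by have : 0 < τ / (a - b) := by positivity
                       linarith))
      have h3 := h2.trans_le (min_le_left _ _)
      have h4 := h2.trans_le (min_le_right _ _)
      refine ⟨t, ?_, ?_, ?_⟩
      · exact_mod_cast hs0.trans h1.le
      · exact_mod_cast h3.le
      · have hsab : s * (a - b) = -b := by rw [hs, div_mul_cancel₀ _ hab.ne']
        have e1 : (t : ℝ) * a + (1 - t) * b = (t - s) * (a - b) := by linear_combination hsab
        have h5 : (t - s) * (a - b) ≤ τ := by
          have : (t - s : ℝ) ≤ τ / (a - b) := by linarith
          rwa [le_div_iff₀ hab] at this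
        rw [e1, abs_of_nonneg (mul_nonneg (by linarith) hab.le)]
        exact h5
  have hev : ev (t • f + (1 - t) • g) x = t * a + (1 - t) * b := by
    rw [ev_add, ev_smul, ev_smul]; push_cast; rfl
  refine ⟨t • f + (1 - t) • g, .conv t f g ht0 ht1 hf hg, ?_, ?_⟩
  · rw [hev]; exact ht.trans (min_le_left _ _)
  · rw [zev_conv hw ht0 ht1 hf hg]
    have h0 : (0 : ℝ) ≤ t := by exact_mod_cast ht0
    have h1 : (t : ℝ) ≤ 1 := by exact_mod_cast ht1
    have h2 : 3 * δ / 4 ≤ t * (zev w f - lam * a) + (1 - t) * (zev w g - lam * b) := by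
      nlinarith
    have h3 : |lam * (t * a + (1 - t) * b)| ≤ δ / 4 := by
      rw [abs_mul]
      exact (mul_le_mul_of_nonneg_left ht (abs_nonneg _)).trans hτl
    have := (abs_le.1 h3).1
    linarith

section
variable {U : Type*} [AddCommGroup U] [Module ℝ U] (p : U →ₗ[ℝ] Vc) (q : U →ₗ[ℝ] Z)

/-- The functional `f` norms `q u` but almost vanishes at `p u`, everything living essentially on
the interval `[N, N')`. -/
structure Link (o : Option ℕ) (N N' : ℕ) (ε δ : ℝ) (u : U) (f : Fn) : Prop where
  nm : Nm o f
  suppf : ∀ n, f n ≠ 0 → N ≤ n ∧ n < N'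
  suppx : ∀ n, p u n ≠ 0 → N ≤ n ∧ n < N'
  head : hd N (q u) ≤ ε
  tail : ∀ g, Nm none g → (∀ n, g n ≠ 0 → N' ≤ n) → |zev (q u) g| ≤ ε
  norms : δ ≤ zev (q u) f
  small : |ev f (p u)| ≤ ε

variable {p q}

theorem Link.combine (hq : ∀ u, q u ∈ X) {o : ℕ → Option ℕ} {N : ℕ → ℕ} (hN : Monotone N) {ε δ : ℝ}
    {u : ℕ → U} {f : ℕ → Fn} (h : ∀ k, Link p q (o k) (N k) (N (k + 1)) ε δ (u k) (f k))
    {o' : Option ℕ} {c : ℚ} (hc0 : 0 ≤ c) (hc1 : c ≤ 1) {d : ℕ}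
    (hnm : Nm o' (c • ∑ l ∈ range d, f l)) {ρ : ℝ} (hρ : 0 ≤ ρ) :
    Link p q o' (N 0) (N d) (ρ * d * ε) (ρ * c * d * (δ - d * ε))
      (ρ • ∑ k ∈ range d, u k) (c • ∑ l ∈ range d, f l) := by
  have hc0' : (0 : ℝ) ≤ c := by exact_mod_cast hc0
  have hc1' : (c : ℝ) ≤ 1 := by exact_mod_cast hc1
  have hε : 0 ≤ ε := (abs_nonneg _).trans (h 0).small
  have hoff : ∀ l k, l ≠ k → |zev (q (u k)) (f l)| ≤ ε := by
    intro l k hlk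
    have hfl := (h l).nm.none_of
    rcases lt_or_gt_of_ne hlk with hlt | hlt
    · have hcut : cut (N k) (f l) = 0 := by
        ext n
        rw [cut_apply]
        split_ifs with hn
        · by_contra hne
          have h1 := ((h l).suppf n hne).2
          have h2 := hN (show l + 1 ≤ k by omega)
          omega
        · rfl
      have h1 := abs_zev_sub_cut_le (hq (u k)) hfl (N k)
      have h0 : zev (q (u k)) 0 = 0 := by
        have := zev_neg (hq (u k)) Nm.zero
        rw [neg_zero] at this
        linarith
      rw [hcut, h0, sub_zero] at h1
      exact h1.trans (h k).head
    · refine (h k).tail _ hfl fun n hn => ?_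
      exact (hN (show k + 1 ≤ l by omega)).trans ((h l).suppf n hn).1
  refine ⟨hnm, fun n hn => ?_, fun n hn => ?_, ?_, fun g hg hgs => ?_, ?_, ?_⟩
  · rw [Finsupp.smul_apply, smul_eq_mul, Finsupp.finsetSum_apply] at hn
    obtain ⟨l, hl, hne⟩ := exists_ne_zero_of_sum_ne_zero (right_ne_zero_of_mul hn)
    obtain ⟨h1, h2⟩ := (h l).suppf n hne
    exact ⟨(hN (Nat.zero_le l)).trans h1, h2.trans_le (hN (mem_range.1 hl))⟩
  · rw [map_smul, map_sum, Finsupp.smul_apply, smul_eq_mul, Finsupp.finsetSum_apply] at hn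
    obtain ⟨l, hl, hne⟩ := exists_ne_zero_of_sum_ne_zero (right_ne_zero_of_mul hn)
    obtain ⟨h1, h2⟩ := (h l).suppx n hne
    exact ⟨(hN (Nat.zero_le l)).trans h1, h2.trans_le (hN (mem_range.1 hl))⟩
  · rw [map_smul, map_sum, hd_smul, abs_of_nonneg hρ, mul_assoc]
    refine mul_le_mul_of_nonneg_left ((hd_sum_le _ _ _).trans ?_) hρ
    refine (sum_le_card_nsmul _ _ ε fun k _ => (hd_mono (hN (Nat.zero_le k)) _).trans
      (h k).head).trans ?_
    simp
  · rw [map_smul, map_sum, zev_smul, zev_sum, abs_mul, abs_of_nonneg hρ, mul_assoc]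
    refine mul_le_mul_of_nonneg_left ((abs_sum_le_sum_abs _ _).trans ?_) hρ
    refine (sum_le_card_nsmul _ _ ε fun k hk => (h k).tail g hg fun n hn => ?_).trans ?_
    · exact (hN (mem_range.1 hk)).trans (hgs n hn)
    · simp
  · rw [map_smul, map_sum, zev_smul, zev_sum]
    have key : ∀ k ∈ range d, c * (δ - d * ε) ≤ zev (q (u k)) (c • ∑ l ∈ range d, f l) := by
      intro k hk
      rw [zev_smul_sum (hq _) (fun l _ => (h l).nm.none_of) hnm.none_of]
      refine mul_le_mul_of_nonneg_left ?_ hc0'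
      rw [← add_sum_erase _ _ hk]
      have h1 : |∑ l ∈ (range d).erase k, zev (q (u k)) (f l)| ≤ d * ε := by
        refine (abs_sum_le_sum_abs _ _).trans ((sum_le_card_nsmul _ _ ε fun l hl =>
          hoff l k (mem_erase.1 hl).1).trans ?_)
        rw [nsmul_eq_mul]
        refine mul_le_mul_of_nonneg_right ?_ hε
        exact_mod_cast (card_le_card (erase_subset _ _)).trans (card_range d).le
      have h2 := (abs_le.1 h1).1
      have h3 := (h k).norms
      linarith
    have h1 := card_nsmul_le_sum _ _ _ key
    rw [card_range, nsmul_eq_mul] at h1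
    calc ρ * c * d * (δ - d * ε) = ρ * (d * (c * (δ - d * ε))) := by ring
      _ ≤ _ := mul_le_mul_of_nonneg_left h1 hρ
  · rw [map_smul, map_sum, map_smul, smul_eq_mul, map_sum, abs_mul, abs_of_nonneg hρ, mul_assoc]
    refine mul_le_mul_of_nonneg_left ((abs_sum_le_sum_abs _ _).trans ?_) hρ
    refine (sum_le_card_nsmul _ _ ε fun k hk => ?_).trans (by simp)
    rw [ev_shape, sum_eq_single k, abs_mul, abs_of_nonneg hc0']
    · exact (mul_le_of_le_one_left (abs_nonneg _) hc1').trans (h k).small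
    · intro l _ hlk
      by_contra h0
      obtain ⟨n, h1, h2⟩ := exists_of_ev_ne_zero h0
      have h3 := (h l).suppf n h1
      have h4 := (h k).suppx n h2
      rcases lt_or_gt_of_ne hlk with hlt | hlt
      · have := hN (show l + 1 ≤ k by omega); omega
      · have := hN (show k + 1 ≤ l by omega); omega
    · exact fun hk' => absurd hk hk'

variable {M C : ℝ} {u : ℕ → U}

theorem eventually_coord_small (hM : ∀ v, ‖q v‖ ≤ M * ‖J (p v)‖)
    (hM0 : 0 ≤ M) (hx : RIS C fun k => p (u k)) (n : ℕ) {η : ℝ} (hη : 0 < η) :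
    ∀ᶠ k in Filter.atTop, |zev (q (u k)) (Finsupp.single n 1)| ≤ η := by
  by_contra hcon
  rw [Filter.not_eventually] at hcon
  obtain ⟨φ, hφ, hlt⟩ := Filter.extraction_of_frequently_atTop hcon
  simp only [not_le] at hlt
  set s : ℕ → ℝ := fun k => SignType.sign (zev (q (u (φ k))) (Finsupp.single n 1)) with hs
  have hs1 : ∀ k, |s k| ≤ 1 := by
    intro k
    simp only [hs]
    rcases SignType.sign (zev (q (u (φ k))) (Finsupp.single n 1)) with _ | _ | _ <;> simp
  have hris := (hx.comp hφ).smul hs1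
  obtain ⟨j, -, hj⟩ := exists_wm_gt (M * (3 * C) / η)
  have hm := wm_cast_ge j
  have hn : (0 : ℝ) < wn j := lt_of_lt_of_le (by positivity) (wm_cube_le_wn j)
  have hex := hris.isExact (j := j) (F := range (wn j)) (card_range _)
  set v : U := (wm j / wn j : ℝ) • ∑ k ∈ range (wn j), s k • u (φ k) with hv
  have hpv : p v = (wm j / wn j : ℝ) • ∑ k ∈ range (wn j), s k • p (u (φ k)) := by
    simp [hv, map_smul, map_sum]
  rw [← hpv] at hex
  have h1 : ‖q v‖ ≤ M * (3 * C) := (hM v).trans (by gcongr; exact norm_J_le hex.bd)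
  have h2 : wm j * η ≤ zev (q v) (Finsupp.single n 1) := by
    rw [hv, map_smul, map_sum, zev_smul, zev_sum]
    have : ∀ k ∈ range (wn j), η ≤ zev (q (s k • u (φ k))) (Finsupp.single n 1) := by
      intro k _
      rw [map_smul, zev_smul, hs]
      dsimp only
      rw [sign_mul_self]
      exact (hlt k).le
    have := card_nsmul_le_sum _ _ _ this
    rw [card_range, nsmul_eq_mul] at this
    calc (wm j : ℝ) * η = wm j / wn j * (wn j * η) := by field_simp
      _ ≤ _ := by gcongr
  have h3 := (le_abs_self _).trans (abs_zev_le (q v) (Finsupp.single n 1))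
  rw [div_lt_iff₀ hη] at hj
  linarith

theorem exists_base_link (hq : ∀ v, q v ∈ X) (hM : ∀ v, ‖q v‖ ≤ M * ‖J (p v)‖)
    (hM0 : 0 ≤ M) (hx : RIS C fun k => p (u k)) {δ : ℝ} (hδ : 0 < δ)
    (hfar : ∀ k (lam : ℝ), δ ≤ ‖q (u k) - lam • J (p (u k))‖) {ε : ℝ} (hε : 0 < ε) (N : ℕ) :
    ∃ k N' f, N < N' ∧ N ≤ k ∧ k < N' ∧ Link p q none N N' ε (δ / 4) (u k) f := by
  have hne : ∀ k, p (u k) ≠ 0 := by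
    intro k h0
    have h1 := hfar k 0
    have h2 := hM (u k)
    rw [h0, map_zero, norm_zero, mul_zero] at h2
    rw [zero_smul, sub_zero] at h1
    linarith
  have hfrom : ∀ k n, p (u k) n ≠ 0 → k ≤ n := by
    intro k
    induction k with
    | zero => intro n _; exact Nat.zero_le _
    | succ k ih =>
      intro n hn
      obtain ⟨m, hm⟩ := Finsupp.ne_iff.1 (hne k)
      have h1 := ih m hm
      have h2 := hx.bs.lt (Nat.lt_succ_self k) hm hn
      omega
  have hev : ∀ᶠ k in Filter.atTop, hd N (q (u k)) ≤ min ε (δ / 4) := by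
    have h1 : ∀ᶠ k in Filter.atTop, ∀ n ∈ range N,
        |zev (q (u k)) (Finsupp.single n 1)| ≤ min ε (δ / 4) / (N + 1) :=
      (Filter.eventually_all_finset _).2 fun n _ =>
        eventually_coord_small hM hM0 hx n (by positivity)
    filter_upwards [h1] with k hk
    refine (sum_le_card_nsmul _ _ _ hk).trans ?_
    rw [card_range, nsmul_eq_mul, mul_div_assoc', div_le_iff₀ (by positivity)]
    have : 0 < min ε (δ / 4) := by positivity
    nlinarith
  obtain ⟨k, hk, hkN⟩ := (hev.and (Filter.eventually_ge_atTop N)).exists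
  obtain ⟨f, hf, hfx, hfw⟩ := exists_separating (hq (u k)) hδ (hfar k) hε
  obtain ⟨B, hB⟩ := exists_tail (hq (u k)) hε
  obtain ⟨Bf, hBf⟩ := exists_bound f
  obtain ⟨Bx, hBx⟩ := exists_bound (p (u k))
  refine ⟨k, N + k + B + Bf + Bx + 1, cut N f, by omega, hkN, by omega, hf.cut N, fun n hn => ?_,
    fun n hn => ?_, hk.trans (min_le_left _ _), fun g hg hgs => ?_, ?_, ?_⟩
  · rw [cut_apply] at hn
    split_ifs at hn with h1
    · have := hBf n hn
      exact ⟨h1, by omega⟩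
    · exact absurd rfl hn
  · have := hBx n hn
    have := hfrom k n hn
    exact ⟨by omega, by omega⟩
  · exact hB g hg fun n hn => by have := hgs n hn; omega
  · have h1 := abs_zev_sub_cut_le (hq (u k)) hf N
    have h2 := (abs_le.1 (h1.trans (hk.trans (min_le_right _ _)))).2
    linarith
  · have : cutv N (p (u k)) = p (u k) := by
      ext n
      rw [cutv_apply]
      split_ifs with h1
      · rfl
      · by_contra h0
        have := hfrom k n (Ne.symm h0)
        omega
    rw [ev_cut, this]
    exact hfx

theorem exists_exact_link (hq : ∀ v, q v ∈ X) (hM : ∀ v, ‖q v‖ ≤ M * ‖J (p v)‖)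
    (hM0 : 0 ≤ M) (hx : RIS C fun k => p (u k)) {δ : ℝ} (hδ : 0 < δ)
    (hfar : ∀ k (lam : ℝ), δ ≤ ‖q (u k) - lam • J (p (u k))‖) {ε : ℝ} (hε : 0 < ε)
    {j : ℕ} (hj : Even j) (N : ℕ) :
    ∃ v N' f, N < N' ∧ Link p q (some j) N N' ε (δ / 8) v f ∧ IsExact (3 * C) j (p v) := by
  have hm := wm_cast_ge j
  have hn1 : (1 : ℝ) ≤ wn j := le_trans (one_le_pow₀ (by linarith)) (wm_cube_le_wn j)
  set ε' := min (ε / wm j) (δ / (8 * wn j)) with hε'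
  have hε'0 : 0 < ε' := by positivity
  obtain ⟨a, R, hR0, hR, ha⟩ := exists_block_seq (α := ℕ × Fn)
    (fun _ N N' a => N ≤ a.1 ∧ a.1 < N' ∧ Link p q none N N' ε' (δ / 4) (u a.1) a.2) (by
      intro _ N
      obtain ⟨k, N', f, h1, h2, h3, h4⟩ := exists_base_link hq hM hM0 hx hδ hfar hε'0 N
      exact ⟨(k, f), N', h1, h2, h3, h4⟩) N
  have hmono : StrictMono fun r => (a r).1 := strictMono_nat_of_lt_succ fun r =>
    (ha r).2.1.trans_le (ha (r + 1)).1
  have hex := (hx.comp hmono).isExact (j := j) (F := range (wn j)) (card_range _)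
  have hlink := fun r => (ha r).2.2
  have h8 : (8 : ℚ) ≤ wm j := by exact_mod_cast wm_ge j
  have hnm : Nm (some j) ((1 / wm j : ℚ) • ∑ l ∈ range (wn j), (a l).2) := by
    refine .free j (wn j) _ _ hj le_rfl ?_ (fun l _ => (hlink l).nm) ?_
    · rw [abs_of_nonneg (by positivity), one_div, inv_mul_cancel₀ (by linarith)]
    · intro l l' hl _ n n' hn hn'
      have h1 := ((hlink l).suppf n hn).2
      have h2 := ((hlink l').suppf n' hn').1
      have h3 := hR.monotone (show l + 1 ≤ l' by omega)
      omega
  have hc := Link.combine hq hR.monotone hlink (by positivity)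
    (by rw [div_le_one (by linarith)]; linarith) hnm (ρ := wm j / wn j) (by positivity)
  rw [hR0] at hc
  have hn0 : (0 : ℕ) < wn j := by exact_mod_cast (zero_lt_one.trans_le hn1)
  refine ⟨_, R (wn j), _, by rw [← hR0]; exact hR hn0, ⟨hc.nm, hc.suppf, hc.suppx, hc.head.trans ?_,
    fun g hg hgs => (hc.tail g hg hgs).trans ?_, le_trans ?_ hc.norms, hc.small.trans ?_⟩, ?_⟩
  rotate_right
  · simpa [map_smul, map_sum] using hex
  rotate_left 2
  · push_cast
    have e : (wm j / wn j : ℝ) * (1 / wm j) * wn j = 1 := by field_simp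
    rw [e, one_mul]
    have : wn j * ε' ≤ δ / 8 := by
      calc wn j * ε' ≤ wn j * (δ / (8 * wn j)) := by gcongr; exact min_le_right _ _
        _ = δ / 8 := by field_simp
    linarith
  all_goals
    rw [div_mul_cancel₀ _ (by positivity)]
    calc wm j * ε' ≤ wm j * (ε / wm j) := by gcongr; exact min_le_left _ _
      _ = ε := by field_simp

theorem exists_close (hq : ∀ v, q v ∈ X) (hM : ∀ v, ‖q v‖ ≤ M * ‖J (p v)‖)
    (hM0 : 0 ≤ M) (hC : 0 < C) (hx : RIS C fun k => p (u k)) {δ : ℝ} (hδ : 0 < δ) :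
    ∃ k, ∃ lam : ℝ, ‖q (u k) - lam • J (p (u k))‖ < δ := by
  by_contra! hfar
  obtain ⟨j₀, hj₀, hbig⟩ := exists_wm_gt (432 * M * C / δ)
  have hm := wm_cast_ge j₀
  have hn1 : (1 : ℝ) ≤ wn j₀ := le_trans (one_le_pow₀ (by linarith)) (wm_cube_le_wn j₀)
  set ε := min (3 * C / wn j₀) (δ / (16 * wn j₀)) with hε
  have hε0 : 0 < ε := by positivity
  obtain ⟨a, R, -, hR, ha⟩ := exists_adaptive_seq (α := U × Fn × ℕ)
    (fun L N N' a => a.2.2 = code j₀ (L.map fun b => (b.2.2, b.2.1)) ∧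
      Link p q (some a.2.2) N N' ε (δ / 8) a.1 a.2.1 ∧ IsExact (3 * C) a.2.2 (p a.1)) (by
      intro L N
      obtain ⟨v, N', f, h1, h2, h3⟩ := exists_exact_link hq hM hM0 hx hδ hfar hε0
        (code_even j₀ (L.map fun b => (b.2.2, b.2.1))) N
      exact ⟨(v, f, _), N', h1, rfl, h2, h3⟩) 0
  have hlink := fun r => (ha r).2.1
  have hdep : Dependent (3 * C) ε j₀ (fun k => p (a k).1) (fun k => (a k).2.1)
      (fun k => (a k).2.2) R := by
    refine ⟨fun k => (ha k).2.2, fun k => ?_, fun k => (hlink k).nm, hR.monotone,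
      fun k => (hlink k).suppx, fun k => (hlink k).suppf, fun k => (hlink k).small⟩
    rw [(ha k).1, List.map_map]
    rfl
  have hsmall : wn j₀ * ε ≤ 3 * C := by
    calc wn j₀ * ε ≤ wn j₀ * (3 * C / wn j₀) := by gcongr; exact min_le_left _ _
      _ = 3 * C := by field_simp
  have h8 : (8 : ℚ) ≤ wm j₀ := by exact_mod_cast wm_ge j₀
  have hnm : Nm (some j₀) ((1 / wm j₀ : ℚ) • ∑ l ∈ range (wn j₀), (a l).2.1) := by
    have := Nm.special j₀ (wn j₀) (fun k => (a k).2.2) (fun k => (a k).2.1) (1 / wm j₀) 0 hj₀ le_rfl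
      (by rw [abs_of_nonneg (by positivity), one_div, inv_mul_cancel₀ (by linarith)])
      (fun l _ => (hlink l).nm) (by
        intro l l' hl _ n n' hn hn'
        have h1 := ((hlink l).suppf n hn).2
        have h2 := ((hlink l').suppf n' hn').1
        have h3 := hR.monotone (show l + 1 ≤ l' by omega)
        omega) (fun l _ => hdep.wt l)
    simpa only [cut_zero] using this
  have hc := Link.combine hq hR.monotone hlink (by positivity)
    (by rw [div_le_one (by linarith)]; linarith) hnm (ρ := 1 / wn j₀) (by positivity)
  have hlow := hc.norms
  have hup : ‖J (p ((1 / wn j₀ : ℝ) • ∑ k ∈ range (wn j₀), (a k).1))‖ ≤ 27 * C / (wm j₀ : ℝ) ^ 2 := by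
    rw [map_smul, map_sum, map_smul, norm_smul, Real.norm_of_nonneg (by positivity)]
    calc 1 / (wn j₀ : ℝ) * _ ≤ 1 / wn j₀ * (9 * (3 * C) * wn j₀ / (wm j₀ : ℝ) ^ 2) := by
          gcongr; exact norm_J_le fun f hf => hdep.norm_bound hj₀ hε0.le hsmall hf
      _ = _ := by field_simp; ring
  have hchain := hlow.trans ((le_abs_self _).trans ((abs_zev_le _ _).trans ((hM _).trans
    (mul_le_mul_of_nonneg_left hup hM0))))
  have h1 : δ / 16 ≤ δ / 8 - wn j₀ * ε := by
    have : wn j₀ * ε ≤ δ / 16 := by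
      calc wn j₀ * ε ≤ wn j₀ * (δ / (16 * wn j₀)) := by gcongr; exact min_le_right _ _
        _ = δ / 16 := by field_simp
    linarith
  push_cast at hchain
  have e : (1 / wn j₀ : ℝ) * (1 / wm j₀) * wn j₀ = 1 / wm j₀ := by field_simp
  rw [e] at hchain
  have h2 : 1 / (wm j₀ : ℝ) * (δ / 16) ≤ M * (27 * C / (wm j₀ : ℝ) ^ 2) :=
    (mul_le_mul_of_nonneg_left h1 (by positivity)).trans hchain
  rw [div_lt_iff₀ hδ] at hbig
  have h3 : 1 / (wm j₀ : ℝ) * (δ / 16) * (16 * wm j₀ ^ 2) ≤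
      M * (27 * C / (wm j₀ : ℝ) ^ 2) * (16 * wm j₀ ^ 2) :=
    mul_le_mul_of_nonneg_right h2 (by positivity)
  have e1 : 1 / (wm j₀ : ℝ) * (δ / 16) * (16 * wm j₀ ^ 2) = wm j₀ * δ := by field_simp
  have e2 : M * (27 * C / (wm j₀ : ℝ) ^ 2) * (16 * wm j₀ ^ 2) = 432 * M * C := by field_simp; ring
  rw [e1, e2] at h3
  linarith

/-- Operators are almost scalar along rapidly increasing sequences. -/
theorem eventually_close (hq : ∀ v, q v ∈ X) (hM : ∀ v, ‖q v‖ ≤ M * ‖J (p v)‖)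
    (hM0 : 0 ≤ M) (hC : 0 < C) (hx : RIS C fun k => p (u k)) {δ : ℝ} (hδ : 0 < δ) :
    ∀ᶠ k in Filter.atTop, ∃ lam : ℝ, ‖q (u k) - lam • J (p (u k))‖ < δ := by
  by_contra hcon
  rw [Filter.not_eventually] at hcon
  obtain ⟨φ, hφ, hlt⟩ := Filter.extraction_of_frequently_atTop hcon
  obtain ⟨k, lam, h⟩ := exists_close (u := fun k => u (φ k)) hq hM hM0 hC (hx.comp hφ) hδ
  exact hlt k ⟨lam, h⟩

end

theorem T_apply_even (x : Vc) {n : ℕ} (hn : Even n) : T x n = 0 := by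
  suffices h : Finsupp.lapply n ∘ₗ T = 0 from LinearMap.congr_fun h x
  refine ext_ev fun k => ?_
  rw [LinearMap.comp_apply, T_single]
  split_ifs with hk
  · have : k + 1 ≠ n := by rintro rfl; exact (Nat.even_add_one.1 hn) hk
    simp [this]
  · simp

theorem T_apply_succ (x : Vc) {n : ℕ} (hn : Even n) : T x (n + 1) = x n := by
  suffices h : Finsupp.lapply (n + 1) ∘ₗ T = Finsupp.lapply n from LinearMap.congr_fun h x
  refine ext_ev fun k => ?_
  rw [LinearMap.comp_apply, T_single]
  by_cases hkn : k = n
  · subst hkn; simp [hn]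
  · split_ifs <;> simp [hkn]

theorem From.T {N : ℕ} {x : Vc} (h : From N x) : From N (T x) := by
  intro n hn
  rcases Nat.even_or_odd n with he | ⟨m, rfl⟩
  · exact T_apply_even x he
  · rw [T_apply_succ x (even_two_mul m)]
    exact h _ (by omega)

/-- The subspace of vectors vanishing before `N`. -/
def fromSub (N : ℕ) : Submodule ℝ Vc where
  carrier := {x | From N x}
  add_mem' hx hy n hn := by rw [Finsupp.add_apply, hx n hn, hy n hn, add_zero]
  zero_mem' _ _ := rfl
  smul_mem' c x hx n hn := by rw [Finsupp.smul_apply, hx n hn, smul_zero]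

theorem Rich.tSmall {V : Submodule ℝ Vc} (hV : Rich V) : TSmall V := by
  intro ε hε
  refine Rich.exists_small (ρ := fun z => ‖J (T z)‖)
    (fun x y => by rw [map_add, map_add]; exact norm_add_le _ _)
    (fun c x => by rw [map_smul, map_smul, norm_smul, Real.norm_eq_abs]) ?_ hε
  by_contra! hcon
  obtain ⟨c, hc, N, h⟩ := hcon
  set V' := V ⊓ fromSub N with hV'
  have hlow : ∀ z ∈ V', c * ‖J z‖ ≤ ‖J (T z)‖ := by
    rintro z ⟨hz, hzN⟩
    by_cases h0 : z = 0
    · simp [h0]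
    · exact (h z hz h0 hzN).le
  set W := V'.map T with hW
  have hWrich : Rich W := by
    intro N'
    obtain ⟨z, hz, hz0, hzN⟩ := hV (max N N')
    have hz' : z ∈ V' := ⟨hz, hzN.mono (le_max_left _ _)⟩
    refine ⟨T z, ⟨z, hz', rfl⟩, fun h0 => ?_, (hzN.mono (le_max_right _ _)).T⟩
    have h1 := hlow z hz'
    rw [h0, map_zero, norm_zero] at h1
    have := mul_pos hc (norm_J_pos hz0)
    linarith
  have hWT : TSmall W := by
    intro ε hε
    refine ⟨W, le_rfl, hWrich, ?_⟩
    rintro _ ⟨z, _, rfl⟩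
    rw [T_T, map_zero, norm_zero]
    positivity
  obtain ⟨x, hx, hxW⟩ := exists_RIS (fun _ => W) fun _ => hWT
  choose u hu hux using fun k => (hxW k).1
  obtain ⟨k, lam, hk⟩ := exists_close (U := V') (p := T ∘ₗ V'.subtype) (q := J ∘ₗ V'.subtype)
    (M := 1 / c) (C := 2) (u := fun k => ⟨u k, hu k⟩) (fun v => J_mem _)
    (fun v => by
      rw [one_div, ← div_eq_inv_mul, le_div_iff₀ hc, mul_comm]
      exact hlow v.1 v.2)
    (by positivity) two_pos (by
      convert hx using 1
      funext k
      exact hux k) (δ := 1 / 2) (by norm_num)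
  have hk : ‖J (u k) - lam • J (T (u k))‖ < 1 / 2 := hk
  have h2 : ‖J (T (u k))‖ ≤ ‖J (u k) - lam • J (T (u k))‖ := by
    have e : J (T (u k)) = J (T (u k - lam • T (u k))) := by
      rw [map_sub, map_smul, T_T, smul_zero, sub_zero]
    calc ‖J (T (u k))‖ = ‖J (T (u k - lam • T (u k)))‖ := by rw [← e]
      _ ≤ ‖J (u k - lam • T (u k))‖ := norm_J_T_le _
      _ = _ := by rw [map_sub, map_smul]
  have h3 := (hxW k).2.2
  rw [← hux k] at h3
  linarith

theorem rich_top : Rich ⊤ := by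
  intro N
  refine ⟨Finsupp.single N 1, trivial, by simp, fun n hn => ?_⟩
  rw [Finsupp.single_apply, if_neg (by omega)]

theorem RIS.pair {C : ℝ} {x : ℕ → Vc} (h : RIS C x) :
    RIS (2 * C) fun k => x (2 * k) + x (2 * k + 1) := by
  have he : StrictMono fun k : ℕ => 2 * k := fun a b hab => by dsimp only; omega
  have ho : StrictMono fun k : ℕ => 2 * k + 1 := fun a b hab => by dsimp only; omega
  refine ⟨fun n l l' hl _ a b ha hb => ?_, fun f hf k => ?_, fun i f hf F => ?_, fun f hf F => ?_⟩
  · rw [Finsupp.add_apply] at ha hb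
    have ha' : x (2 * l) a ≠ 0 ∨ x (2 * l + 1) a ≠ 0 := by
      by_contra! hc; rw [hc.1, hc.2, add_zero] at ha; exact ha rfl
    have hb' : x (2 * l') b ≠ 0 ∨ x (2 * l' + 1) b ≠ 0 := by
      by_contra! hc; rw [hc.1, hc.2, add_zero] at hb; exact hb rfl
    rcases ha' with ha' | ha' <;> rcases hb' with hb' | hb' <;>
      exact h.bs.lt (by omega) ha' hb'
  · rw [map_add]
    have h1 := h.bd f hf (2 * k)
    have h2 := h.bd f hf (2 * k + 1)
    exact (abs_add_le _ _).trans (by linarith)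
  · have h1 := (h.comp he).wt i f hf F
    have h2 := (h.comp ho).wt i f hf F
    refine (sum_le_sum fun k _ => ?_).trans ((sum_add_distrib (s := F)
      (f := fun k => |ev f (x (2 * k))|) (g := fun k => |ev f (x (2 * k + 1))|)).trans_le
        (by linarith))
    rw [map_add]
    exact abs_add_le _ _
  · have h1 := (h.comp he).sh f hf F
    have h2 := (h.comp ho).sh f hf F
    refine (sum_le_sum fun k _ => ?_).trans ((sum_add_distrib (s := F)
      (f := fun k => |ev f (T (x (2 * k)))|) (g := fun k => |ev f (T (x (2 * k + 1)))|)).trans_le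
        (by linarith))
    rw [map_add, map_add]
    exact abs_add_le _ _

theorem RIS.norm_le {C : ℝ} {x : ℕ → Vc} (h : RIS C x) (k : ℕ) : ‖J (x k)‖ ≤ C :=
  norm_J_le fun f hf => h.bd f hf k

section
variable {q : Vc →ₗ[ℝ] Z} {M : ℝ}

theorem exists_scalar (hq : ∀ v, q v ∈ X) (hM : ∀ v, ‖q v‖ ≤ M * ‖J v‖) (hM0 : 0 ≤ M) :
    ∃ lam : ℝ, ∀ ε > 0, ∃ V, Rich V ∧ ∀ z ∈ V, ‖q z - lam • J z‖ ≤ ε * ‖J z‖ := by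
  obtain ⟨x, hx, hx'⟩ := exists_RIS (fun _ => ⊤) fun _ => rich_top.tSmall
  have hex : ∀ n : ℕ, ∃ k ≥ n, ∃ lam : ℝ, ‖q (x k) - lam • J (x k)‖ < 1 / ((n : ℝ) + 1) := by
    intro n
    obtain ⟨k, hk, hn⟩ := ((eventually_close (p := LinearMap.id) (q := q) (u := x) hq hM hM0 two_pos hx
      (δ := 1 / ((n : ℝ) + 1)) (by positivity)).and (Filter.eventually_ge_atTop n)).exists
    exact ⟨k, hn, hk⟩
  choose k hk l hl using hex
  have hbd : ∀ n, l n ∈ Metric.closedBall (0 : ℝ) (4 * M + 2) := by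
    intro n
    rw [mem_closedBall_zero_iff]
    have h1 : ‖l n • J (x (k n))‖ ≤ ‖q (x (k n))‖ + ‖q (x (k n)) - l n • J (x (k n))‖ := by
      have := norm_sub_le (q (x (k n))) (q (x (k n)) - l n • J (x (k n)))
      rwa [sub_sub_cancel] at this
    have h2 : (1 : ℝ) / (n + 1) ≤ 1 := by
      rw [div_le_one (by positivity)]; linarith [(Nat.cast_nonneg n : (0 : ℝ) ≤ n)]
    have h3 := (hM (x (k n))).trans (mul_le_mul_of_nonneg_left (hx.norm_le (k n)) hM0)
    have h4 := (hx' (k n)).2.2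
    rw [norm_smul] at h1
    have h5 := mul_le_mul_of_nonneg_left h4 (norm_nonneg (l n))
    have h6 := hl n
    linarith
  obtain ⟨lam, -, φ, hφ, hlim⟩ := tendsto_subseq_of_bounded Metric.isBounded_closedBall hbd
  refine ⟨lam, fun ε hε => ?_⟩
  obtain ⟨V, -, hV, hVs⟩ := Rich.exists_small (V := ⊤) (ρ := fun z => ‖q z - lam • J z‖)
    (fun x y => by
      rw [map_add, map_add, smul_add, add_sub_add_comm]; exact norm_add_le _ _)
    (fun c x => by
      rw [map_smul, map_smul, smul_comm, ← smul_sub, norm_smul, Real.norm_eq_abs]) (by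
      intro c hc N
      have e1 : ∀ᶠ n in Filter.atTop, |l (φ n) - lam| < c / 8 := by
        filter_upwards [Metric.tendsto_nhds.1 hlim (c / 8) (by positivity)] with n hn
        exact hn
      have e2 : ∀ᶠ n : ℕ in Filter.atTop, (1 : ℝ) / (n + 1) < c / 4 :=
        (tendsto_one_div_add_atTop_nhds_zero_nat (𝕜 := ℝ)).eventually (gt_mem_nhds (by positivity))
      obtain ⟨n, ⟨h1, h2⟩, h3⟩ := ((e1.and e2).and (Filter.eventually_ge_atTop N)).exists
      have hlow := (hx' (k (φ n))).2.2
      refine ⟨x (k (φ n)), trivial, fun h0 => ?_, (hx' _).2.1.mono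
        ((h3.trans hφ.le_apply).trans (hk _)), ?_⟩
      · rw [h0, map_zero, norm_zero] at hlow; linarith
      · have h4 : q (x (k (φ n))) - lam • J (x (k (φ n))) =
            (q (x (k (φ n))) - l (φ n) • J (x (k (φ n)))) + (l (φ n) - lam) • J (x (k (φ n))) := by
          rw [sub_smul]; abel
        have h5 : (1 : ℝ) / ((φ n : ℝ) + 1) ≤ 1 / (n + 1) := by
          gcongr; exact hφ.le_apply
        have h6 := hl (φ n)
        have h7 : |l (φ n) - lam| * ‖J (x (k (φ n)))‖ ≤ c / 8 * 2 :=
          mul_le_mul h1.le (hx.norm_le _) (norm_nonneg _) (by positivity)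
        rw [h4]
        refine (norm_add_le _ _).trans ?_
        rw [norm_smul, Real.norm_eq_abs]
        nlinarith) hε
  exact ⟨V, hV, hVs⟩

theorem exists_small_of_rich (hq : ∀ v, q v ∈ X) (hM : ∀ v, ‖q v‖ ≤ M * ‖J v‖) (hM0 : 0 ≤ M)
    {lam : ℝ} (hlam : ∀ ε > 0, ∃ V, Rich V ∧ ∀ z ∈ V, ‖q z - lam • J z‖ ≤ ε * ‖J z‖)
    {V : Submodule ℝ Vc} (hV : Rich V) {c : ℝ} (hc : 0 < c) :
    ∃ z ∈ V, z ≠ 0 ∧ ‖q z - lam • J z‖ ≤ c * ‖J z‖ := by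
  set δ := c / 100 with hδ
  have hδ0 : 0 < δ := by positivity
  obtain ⟨V₀, hV₀, hV₀s⟩ := hlam δ hδ0
  obtain ⟨x, hx, hx'⟩ := exists_RIS (fun k => if Even k then V₀ else V) fun k => by
    split_ifs
    · exact hV₀.tSmall
    · exact hV.tSmall
  have ho : StrictMono fun k : ℕ => 2 * k + 1 := fun a b hab => by dsimp only; omega
  obtain ⟨k, ⟨ν, hν⟩, ⟨μ, hμ⟩⟩ := ((eventually_close (p := LinearMap.id) (q := q)
    (u := fun k => x (2 * k) + x (2 * k + 1)) hq hM hM0 (by norm_num) hx.pair hδ0).and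
    (eventually_close (p := LinearMap.id) (q := q)
    (u := fun k => x (2 * k + 1)) hq hM hM0 two_pos (hx.comp ho) hδ0)).exists
  simp only [LinearMap.id_apply] at hν hμ
  have ha := (hx' (2 * k)).1
  have hb := (hx' (2 * k + 1)).1
  rw [if_pos (even_two_mul k)] at ha
  rw [if_neg (by simp)] at hb
  have ha' := hV₀s _ ha
  have hla := (hx' (2 * k)).2.2
  have hlb := (hx' (2 * k + 1)).2.2
  have hua := hx.norm_le (2 * k)
  have hub := hx.norm_le (2 * k + 1)
  have hlt : ∀ n m, x (2 * k) n ≠ 0 → x (2 * k + 1) m ≠ 0 → n < m := fun n m hn hm =>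
    hx.bs.lt (Nat.lt_succ_self _) hn hm
  set a := x (2 * k)
  set b := x (2 * k + 1)
  have hb0 : b ≠ 0 := by
    intro h0
    rw [h0, map_zero, norm_zero] at hlb
    linarith
  have hcomb : ‖J ((ν - lam) • a + (ν - μ) • b)‖ ≤ 4 * δ := by
    have e : J ((ν - lam) • a + (ν - μ) • b) =
        (q a - lam • J a) + (q b - μ • J b) - (q (a + b) - ν • J (a + b)) := by
      simp only [map_add, map_smul]
      module
    rw [e]
    have h1 : ‖q a - lam • J a‖ ≤ δ * 2 := ha'.trans (by gcongr)
    exact (norm_sub_le _ _).trans ((add_le_add_left (norm_add_le _ _) _).trans (by linarith))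
  obtain ⟨m₀, hm₀⟩ := Finsupp.ne_iff.1 hb0
  have hex : ∃ m, b m ≠ 0 := ⟨m₀, hm₀⟩
  classical
  have hcut : cutv (Nat.find hex) ((ν - lam) • a + (ν - μ) • b) = (ν - μ) • b := by
    ext n
    rw [cutv_apply]
    split_ifs with hn
    · have h0 : a n = 0 := by
        by_contra hne
        have := hlt n _ hne (Nat.find_spec hex)
        omega
      simp [h0]
    · have h0 : b n = 0 := by
        by_contra hne
        exact hn (Nat.find_min' hex hne)
      simp [h0]
  have hnb : |ν - μ| * ‖J b‖ ≤ 4 * δ := by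
    rw [← Real.norm_eq_abs, ← norm_smul, ← map_smul, ← hcut]
    exact (norm_J_cutv_le _ _).trans hcomb
  have hna : |ν - lam| * ‖J a‖ ≤ 8 * δ := by
    rw [← Real.norm_eq_abs, ← norm_smul, ← map_smul]
    have e : J ((ν - lam) • a) = J ((ν - lam) • a + (ν - μ) • b) - (ν - μ) • J b := by
      simp only [map_add, map_smul]; abel
    rw [e]
    refine (norm_sub_le _ _).trans ?_
    rw [norm_smul, Real.norm_eq_abs]
    linarith
  have h1 : |ν - μ| ≤ 8 * δ := by nlinarith [abs_nonneg (ν - μ)]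
  have h2 : |ν - lam| ≤ 16 * δ := by nlinarith [abs_nonneg (ν - lam)]
  have h3 : |μ - lam| ≤ 24 * δ := by
    have : μ - lam = (ν - lam) - (ν - μ) := by ring
    rw [this]
    exact (abs_sub _ _).trans (by linarith)
  refine ⟨b, hb, hb0, ?_⟩
  have e : q b - lam • J b = (q b - μ • J b) + (μ - lam) • J b := by rw [sub_smul]; abel
  rw [e]
  refine (norm_add_le _ _).trans ?_
  rw [norm_smul, Real.norm_eq_abs]
  have h4 : |μ - lam| * ‖J b‖ ≤ 24 * δ * 2 := mul_le_mul h3 hub (norm_nonneg _) (by positivity)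
  nlinarith

end

theorem norm_J_sub_cutv_le (N : ℕ) (x : Vc) : ‖J (x - cutv N x)‖ ≤ hd N (J x) := by
  refine norm_J_le fun f hf => ?_
  have := abs_zev_sub_cut_le (J_mem x) hf N
  rwa [zev_J hf, zev_J (hf.cut N), ev_cut, ← map_sub] at this

theorem exists_hd_eq_zero {Y : Submodule ℝ Z} (hY : ¬FiniteDimensional ℝ Y) (N : ℕ) :
    ∃ y ∈ Y, y ≠ 0 ∧ hd N y = 0 := by
  let L : Y →ₗ[ℝ] (Fin N → ℝ) :=
    { toFun := fun y n => zev y.1 (Finsupp.single n.1 1)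
      map_add' := fun y y' => by funext n; exact zev_add _ _ _
      map_smul' := fun c y => by funext n; exact zev_smul _ _ _ }
  have hL : ¬Function.Injective L := fun h => hY (FiniteDimensional.of_injective L h)
  rw [injective_iff_map_eq_zero] at hL
  push Not at hL
  obtain ⟨y, hy, hy0⟩ := hL
  refine ⟨y.1, y.2, fun h => hy0 (Subtype.ext h), sum_eq_zero fun n hn => ?_⟩
  have := congrFun hy ⟨n, mem_range.1 hn⟩
  rw [abs_eq_zero]
  exact this

theorem exists_close_block {Y : Submodule ℝ Z} (hYX : Y ≤ X) (hY : ¬FiniteDimensional ℝ Y)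
    {c : ℝ} (hc : 0 < c) (N : ℕ) : ∃ z, z ≠ 0 ∧ From N z ∧ ∃ y ∈ Y, ‖J z - y‖ ≤ c * ‖J z‖ := by
  obtain ⟨y, hy, hy0, hhd⟩ := exists_hd_eq_zero hY N
  have hyn := norm_pos_iff.2 hy0
  set η := min c 1 / (2 * ((N : ℝ) + 1)) with hη
  have hη0 : 0 < η := by positivity
  obtain ⟨x, hx⟩ := exists_near (hYX hy) (ε := η * ‖y‖) (by positivity)
  have h1 : hd N (J x) ≤ N * (η * ‖y‖) := by
    have h2 := hd_add_le N (J x - y) y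
    rw [sub_add_cancel, hhd, add_zero] at h2
    refine h2.trans ((sum_le_card_nsmul _ _ (η * ‖y‖) fun n _ => ?_).trans (by simp))
    exact (abs_zev_le _ _).trans (by rw [norm_sub_rev]; exact hx.le)
  have h3 : ‖J (cutv N x) - y‖ ≤ min c 1 / 2 * ‖y‖ := by
    have e : J (cutv N x) - y = -(J (x - cutv N x)) - (y - J x) := by rw [map_sub]; abel
    rw [e]
    refine (norm_sub_le _ _).trans ?_
    rw [norm_neg]
    calc _ ≤ N * (η * ‖y‖) + η * ‖y‖ := add_le_add ((norm_J_sub_cutv_le N x).trans h1) hx.le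
      _ = ((N + 1) * η) * ‖y‖ := by ring
      _ = _ := by rw [hη]; congr 1; field_simp
  have hc1 := min_le_left c 1
  have hc2 := min_le_right c 1
  have h4 : ‖y‖ / 2 ≤ ‖J (cutv N x)‖ := by
    have h5 := norm_sub_norm_le y (J (cutv N x))
    rw [norm_sub_rev] at h5
    nlinarith
  refine ⟨cutv N x, fun h0 => ?_, fun n hn => ?_, y, hy, h3.trans ?_⟩
  · rw [h0, map_zero, norm_zero] at h4; linarith
  · rw [cutv_apply, if_neg (by omega)]
  · nlinarith

theorem exists_rich_close {Y : Submodule ℝ Z} (hYX : Y ≤ X) (hY : ¬FiniteDimensional ℝ Y)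
    {ε : ℝ} (hε : 0 < ε) :
    ∃ V, Rich V ∧ ∀ z ∈ V, z ≠ 0 → ∃ y ∈ Y, ‖J z - y‖ ≤ ε * ‖J z‖ := by
  obtain ⟨V, -, hV, hVs⟩ := Rich.exists_small (V := ⊤)
    (ρ := fun z => ‖(Submodule.Quotient.mk (J z) : Z ⧸ Y)‖)
    (fun x y => by rw [map_add, Submodule.Quotient.mk_add]; exact norm_add_le _ _)
    (fun c x => by rw [map_smul, Submodule.Quotient.mk_smul, norm_smul, Real.norm_eq_abs]) (by
      intro c hc N
      obtain ⟨z, hz0, hzN, y, hy, hzy⟩ := exists_close_block hYX hY hc N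
      refine ⟨z, trivial, hz0, hzN, le_trans ?_ hzy⟩
      have : (Submodule.Quotient.mk (J z) : Z ⧸ Y) = Submodule.Quotient.mk (J z - y) := by
        rw [Submodule.Quotient.eq, sub_sub_cancel]; exact hy
      rw [this]
      exact Submodule.Quotient.norm_mk_le _ _) (half_pos hε)
  refine ⟨V, hV, fun z hz hz0 => ?_⟩
  have hzp := norm_J_pos hz0
  obtain ⟨m, hm, hlt⟩ := Submodule.Quotient.norm_mk_lt (Submodule.Quotient.mk (J z) : Z ⧸ Y)
    (show 0 < ε / 2 * ‖J z‖ by positivity)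
  refine ⟨J z - m, (Submodule.Quotient.eq Y).1 hm.symm, ?_⟩
  rw [sub_sub_cancel]
  have := hVs z hz
  linarith

theorem few_operators (S : X →L[ℝ] X) :
    ∃ lam : ℝ, StrictlySingular (S - lam • ContinuousLinearMap.id ℝ X) := by
  set J' : Vc →ₗ[ℝ] X := J.codRestrict X J_mem with hJ'
  set q : Vc →ₗ[ℝ] Z := X.subtype ∘ₗ S.toLinearMap ∘ₗ J' with hqdef
  have hq : ∀ v, q v ∈ X := fun v => (S (J' v)).2
  have hM : ∀ v, ‖q v‖ ≤ ‖S‖ * ‖J v‖ := fun v => S.le_opNorm (J' v)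
  obtain ⟨lam, hlam⟩ := exists_scalar hq hM (norm_nonneg S)
  refine ⟨lam, fun Y hY c hc => ?_⟩
  set R := S - lam • ContinuousLinearMap.id ℝ X with hR
  have hRJ : ∀ v, ‖R (J' v)‖ = ‖q v - lam • J v‖ := fun v => rfl
  have hY' : ¬FiniteDimensional ℝ (Y.map X.subtype) := fun h =>
    hY ((Submodule.equivMapOfInjective X.subtype X.injective_subtype Y).symm.finiteDimensional)
  set ε := min (1 / 2) (c / (8 * (‖R‖ + 1))) with hε
  have hε0 : 0 < ε := by positivity
  obtain ⟨V, hV, hVY⟩ := exists_rich_close (Y := Y.map X.subtype)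
    (by rintro _ ⟨y, _, rfl⟩; exact y.2) hY' hε0
  obtain ⟨z, hz, hz0, hzs⟩ := exists_small_of_rich hq hM (norm_nonneg S) hlam hV
    (show 0 < c / 8 by positivity)
  obtain ⟨_, ⟨y, hy, rfl⟩, hzy⟩ := hVY z hz hz0
  have hzp := norm_J_pos hz0
  have hzy' : ‖J' z - y‖ ≤ ε * ‖J z‖ := hzy
  refine ⟨y, hy, ?_⟩
  have hJn : ‖J' z‖ = ‖J z‖ := rfl
  have h1 : ‖J z‖ / 2 ≤ ‖y‖ := by
    have h2 := norm_sub_norm_le (J' z) y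
    have h3 : ε ≤ 1 / 2 := min_le_left _ _
    rw [hJn] at h2
    nlinarith
  have h4 : ‖R‖ * ε ≤ c / 8 := by
    calc ‖R‖ * ε ≤ (‖R‖ + 1) * (c / (8 * (‖R‖ + 1))) := by
          gcongr
          · linarith
          · exact min_le_right _ _
      _ = c / 8 := by field_simp
  have h5 : R y = R (J' z) - R (J' z - y) := by rw [map_sub, sub_sub_cancel]
  have h6 : ‖R (J' z - y)‖ ≤ c / 8 * ‖J z‖ :=
    (R.le_opNorm _).trans ((mul_le_mul_of_nonneg_left hzy' (norm_nonneg _)).trans (by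
      rw [← mul_assoc]; gcongr))
  rw [← hRJ] at hzs
  have h7 : ‖R y‖ ≤ c / 4 * ‖J z‖ := by
    rw [h5]
    exact (norm_sub_le _ _).trans (by linarith)
  nlinarith

theorem not_isCompactOperator_of_separated {E : Type*} [NormedAddCommGroup E] [NormedSpace ℝ E]
    {L : E →L[ℝ] E} {a : ℕ → E} (ha : ∀ k, ‖a k‖ ≤ 1) {s : ℝ} (hs : 0 < s)
    (h : ∀ k l, k < l → s ≤ ‖L (a k) - L (a l)‖) : ¬IsCompactOperator L := by
  intro hL
  obtain ⟨K, hK, hsub⟩ := IsCompactOperator.image_closedBall_subset_compact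
    (f := L.toLinearMap) hL 1
  obtain ⟨b, -, φ, hφ, hlim⟩ := hK.tendsto_subseq (x := fun k => L (a k)) fun k =>
    hsub ⟨a k, by simpa using ha k, rfl⟩
  obtain ⟨N, hN⟩ := Metric.cauchySeq_iff.1 hlim.cauchySeq s hs
  have h1 := hN (N + 1) (by omega) N (by omega)
  rw [dist_comm, dist_eq_norm] at h1
  have h2 := h _ _ (hφ (Nat.lt_succ_self N))
  exact absurd h1 (not_lt.2 h2)

theorem exists_noncompact : ∃ S : X →L[ℝ] X, ∀ lam : ℝ,
    ¬IsCompactOperator (S - lam • ContinuousLinearMap.id ℝ X) := by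
  refine ⟨(TZ.comp X.subtypeL).codRestrict X fun w => TZ_mem w.2, fun lam => ?_⟩
  set S := (TZ.comp X.subtypeL).codRestrict X fun w => TZ_mem w.2 with hS
  set e : ℕ → X := fun n => ⟨J (Finsupp.single n 1), J_mem _⟩ with he
  have hnorm : ∀ n, ‖e n‖ ≤ 1 := by
    intro n
    refine (norm_J_le_l1 _).trans ?_
    rw [Finsupp.sum_single_index (by simp)]
    simp
  have hval : ∀ n m, ‖(S - lam • ContinuousLinearMap.id ℝ X) (e n) -
      (S - lam • ContinuousLinearMap.id ℝ X) (e m)‖ =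
      ‖J ((T (Finsupp.single n 1) - lam • Finsupp.single n 1) -
        (T (Finsupp.single m 1) - lam • Finsupp.single m 1))‖ := by
    intro n m
    simp only [map_sub, map_smul, ← TZ_J]
    rfl
  by_cases h0 : lam = 0
  · refine not_isCompactOperator_of_separated (a := fun k => e (2 * k)) (fun k => hnorm _) one_pos
      fun k l hkl => ?_
    rw [hval, h0]
    refine le_trans ?_ (abs_coord_le_norm (2 * k + 1) _)
    simp [T_single, show l ≠ k by omega]
  · refine not_isCompactOperator_of_separated (a := fun k => e (2 * k + 1)) (fun k => hnorm _)
      (abs_pos.2 h0) fun k l hkl => ?_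
    rw [hval]
    refine le_trans ?_ (abs_coord_le_norm (2 * k + 1) _)
    simp [T_single, show l ≠ k by omega]

theorem separableSpace_X : TopologicalSpace.SeparableSpace X := by
  have h1 : LinearMap.range J = Submodule.span ℝ (Set.range fun n : ℕ => J (Finsupp.single n 1)) := by
    refine le_antisymm ?_ (Submodule.span_le.2 (by rintro _ ⟨n, rfl⟩; exact ⟨_, rfl⟩))
    rintro _ ⟨x, rfl⟩
    induction x using Finsupp.induction_linear with
    | zero => rw [map_zero]; exact Submodule.zero_mem _
    | add x y hx hy => rw [map_add]; exact Submodule.add_mem _ hx hy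
    | single n c =>
      rw [← mul_one c, ← smul_eq_mul, ← Finsupp.smul_single, map_smul]
      exact Submodule.smul_mem _ _ (Submodule.subset_span ⟨n, rfl⟩)
  have h2 := ((Set.countable_range fun n : ℕ => J (Finsupp.single n 1)).isSeparable.span
    (R := ℝ)).closure
  rw [← h1] at h2
  exact h2.separableSpace

theorem not_finiteDimensional_X : ¬FiniteDimensional ℝ X := by
  intro h
  let J' : Vc →ₗ[ℝ] X := J.codRestrict X J_mem
  have h1 : FiniteDimensional ℝ Vc := FiniteDimensional.of_injective J'
    fun x y hxy => J_injective (congrArg Subtype.val hxy)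
  rcases Module.finite_finsupp_self_iff.1 h1 with h2 | h2
  · exact not_subsingleton ℝ h2
  · exact not_finite ℕ

theorem completeSpace_X : CompleteSpace X :=
  (Submodule.isClosed_topologicalClosure _).completeSpace_coe

end FewOps

theorem stmt4 :
    ∃ (X : Type) (_ : NormedAddCommGroup X) (_ : NormedSpace ℝ X),
      CompleteSpace X ∧ TopologicalSpace.SeparableSpace X ∧ ¬FiniteDimensional ℝ X ∧
      (∀ T : X →L[ℝ] X, ∃ lam : ℝ,
        StrictlySingular (T - lam • ContinuousLinearMap.id ℝ X)) ∧
      (∃ T : X →L[ℝ] X, ∀ lam : ℝ,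
        ¬IsCompactOperator (T - lam • ContinuousLinearMap.id ℝ X)) :=
  ⟨FewOps.X, inferInstance, inferInstance, FewOps.completeSpace_X, FewOps.separableSpace_X,
    FewOps.not_finiteDimensional_X, FewOps.few_operators, FewOps.exists_noncompact⟩
end
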